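/- Let U : ℝ² → ℝ be a smooth function of (X,T) satisfying identically the relation X = U·T − [ (1/6)U³ + (1/24)(U_X² + 2 U U_{XX}) + (1/240) U_{XXXX} ], and suppose that at every point the X-derivative of the right-hand side minus 1 is such that the implicit relation can be differentiated (i.e. U_X is well defined and the relation holds on an open set). Then U satisfies the KdV equation U_T + U U_X + (1/12) U_{XXX} = 0. -/

import Mathlib

noncomputable def pd1 (g : ℝ × ℝ → ℝ) (p : ℝ × ℝ) : ℝ := fderiv ℝ g p (1, 0)
noncomputable def pd2 (g : ℝ × ℝ → ℝ) (p : ℝ × ℝ) : ℝ := fderiv ℝ g p (0, 1)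

open Filter Topology

/-! ### Elementary calculus facts -/

theorem lem_dneg {f : ℝ → ℝ} {f' x : ℝ} (h : HasDerivAt f f' (-x)) :
    HasDerivAt (fun y => f (-y)) (-f') x := by
  have h1 := h.scomp x (hasDerivAt_neg x)
  exact h1.congr_deriv (by simp)

/-- a bounded function on the line with `J' ≤ -c J²` vanishes -/
theorem lem_blow_neg (J J' : ℝ → ℝ) (c C : ℝ) (hc : 0 < c)
    (hd : ∀ x, HasDerivAt J (J' x) x) (hJ : ∀ x, J' x ≤ -c * (J x)^2)
    (hb : ∀ x, |J x| ≤ C) : ∀ x, 0 ≤ J x := by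
  have hanti : Antitone J := by
    apply antitone_of_deriv_nonpos (fun x => (hd x).differentiableAt)
    intro x
    rw [(hd x).deriv]
    have := hJ x
    nlinarith [sq_nonneg (J x)]
  intro x1
  by_contra hneg
  push Not at hneg
  set a := J x1 with ha
  have h2 : AntitoneOn (fun x => J x + c * a^2 * x) (Set.Ici x1) := by
    apply antitoneOn_of_deriv_nonpos (convex_Ici x1)
    · intro x _
      exact (((hd x).continuousAt).add (by fun_prop)).continuousWithinAt
    · intro x _
      exact ((hd x).differentiableAt.add (by fun_prop)).differentiableWithinAt
    · intro x hx
      have hd2 : HasDerivAt (fun x => J x + c * a^2 * x) (J' x + c * a^2) x := by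
        exact ((hd x).add ((hasDerivAt_id x).const_mul (c * a^2))).congr_deriv (by simp)
      rw [hd2.deriv]
      have hx' : x1 ≤ x := by
        rw [interior_Ici] at hx; exact le_of_lt hx
      have h3 : J x ≤ a := hanti hx'
      have h4 : a^2 ≤ (J x)^2 := by nlinarith
      have := hJ x
      nlinarith
  have hca : 0 < c * a^2 := by
    have : 0 < a^2 := by nlinarith
    positivity
  have hC : 0 ≤ C := le_trans (abs_nonneg _) (hb 0)
  have h5 := h2 (Set.mem_Ici.mpr le_rfl) (show x1 + (C + 1) / (c * a^2) ∈ Set.Ici x1 by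
    simp; positivity) (by simp; positivity)
  simp only at h5
  have h6 : c * a^2 * (x1 + (C + 1) / (c * a^2)) = c * a^2 * x1 + (C + 1) := by
    rw [mul_add, mul_div_cancel₀ _ hca.ne']
  rw [h6] at h5
  have h7 := (abs_le.mp (hb (x1 + (C + 1) / (c * a^2)))).1
  linarith

theorem lem_blow (J J' : ℝ → ℝ) (c C : ℝ) (hc : 0 < c)
    (hd : ∀ x, HasDerivAt J (J' x) x) (hJ : ∀ x, J' x ≤ -c * (J x)^2)
    (hb : ∀ x, |J x| ≤ C) : ∀ x, J x = 0 := by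
  intro x
  apply le_antisymm _ (lem_blow_neg J J' c C hc hd hJ hb x)
  have := lem_blow_neg (fun x => -J (-x)) (fun x => J' (-x)) c C hc
    (fun x => by
      exact (lem_dneg (hd (-x))).neg.congr_deriv (by simp))
    (fun x => by simpa using hJ (-x)) (fun x => by simpa using hb (-x)) (-x)
  simp at this
  exact this

/-- Gronwall with zero initial value, forward -/
theorem lem_gron_fwd (F F' K : ℝ → ℝ) (hK : Continuous K) (x0 : ℝ)
    (hd : ∀ x, HasDerivAt F (F' x) x) (hF : ∀ x, |F' x| ≤ K x * |F x|) (h0 : F x0 = 0) :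
    ∀ x, x0 ≤ x → F x = 0 := by
  intro x hx
  obtain ⟨M, hM⟩ := (isCompact_Icc (a := x0) (b := x)).bddAbove_image hK.continuousOn
  have := norm_le_gronwallBound_of_norm_deriv_right_le (f := F) (f' := F') (δ := 0) (K := M)
    (ε := 0) (a := x0) (b := x) (fun y _ => (hd y).continuousAt.continuousWithinAt)
    (fun y _ => (hd y).hasDerivWithinAt) (by simp [h0]) (fun y hy => by
      have h1 : K y ≤ M := hM (Set.mem_image_of_mem _ ⟨hy.1, hy.2.le⟩)
      have := hF y
      simp only [Real.norm_eq_abs, add_zero]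
      nlinarith [abs_nonneg (F y)]) x ⟨hx, le_rfl⟩
  simpa [gronwallBound_ε0] using this

theorem lem_gron (F F' K : ℝ → ℝ) (hK : Continuous K) (x0 : ℝ)
    (hd : ∀ x, HasDerivAt F (F' x) x) (hF : ∀ x, |F' x| ≤ K x * |F x|) (h0 : F x0 = 0) :
    ∀ x, F x = 0 := by
  intro x
  rcases le_total x0 x with h | h
  · exact lem_gron_fwd F F' K hK x0 hd hF h0 x h
  · have := lem_gron_fwd (fun y => F (-y)) (fun y => -F' (-y)) (fun y => K (-y))
      (by fun_prop) (-x0) (fun y => by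
        exact lem_dneg (hd (-y))) (fun y => by simpa using hF (-y)) (by simpa using h0) (-x) (by linarith)
    simpa using this

/-- Linear Liouville theorem. -/
theorem lem_linLiou (v0 v1 v2 v3 : ℝ → ℝ) (m t C : ℝ) (ht : 0 ≤ t) (hmt : 0 < m^2 + t)
    (d0 : ∀ x, HasDerivAt v0 (v1 x) x) (d1 : ∀ x, HasDerivAt v1 (v2 x) x)
    (d2 : ∀ x, HasDerivAt v2 (v3 x) x)
    (d3 : ∀ x, HasDerivAt v3 (-20 * m * v2 x - (120 * m^2 + 240 * t) * v0 x) x)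
    (b0 : ∀ x, |v0 x| ≤ C) (b1 : ∀ x, |v1 x| ≤ C) (b2 : ∀ x, |v2 x| ≤ C)
    (b3 : ∀ x, |v3 x| ≤ C) :
    ∀ x, v0 x = 0 ∧ v1 x = 0 ∧ v2 x = 0 ∧ v3 x = 0 := by
  have hC : 0 ≤ C := le_trans (abs_nonneg _) (b0 0)
  set k := 20 * m^2 + 240 * t with hk
  have hkpos : 0 < k := by nlinarith [sq_nonneg m]
  set J := fun x => v0 x * v3 x - v1 x * v2 x with hJ
  set J' := fun x => -((v2 x + 10 * m * v0 x)^2 + k * (v0 x)^2) with hJ'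
  have hdJ : ∀ x, HasDerivAt J (J' x) x := by
    intro x
    exact (((d0 x).mul (d3 x)).sub ((d1 x).mul (d2 x))).congr_deriv (by
      simp only [hJ', hk]; ring)
  have hJb : ∀ x, |J x| ≤ 2 * C^2 := by
    intro x
    have e1 : |v0 x * v3 x| ≤ C * C := by
      rw [abs_mul]; exact mul_le_mul (b0 x) (b3 x) (abs_nonneg _) hC
    have e2 : |v1 x * v2 x| ≤ C * C := by
      rw [abs_mul]; exact mul_le_mul (b1 x) (b2 x) (abs_nonneg _) hC
    have := abs_sub (v0 x * v3 x) (v1 x * v2 x)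
    simp only [hJ]; nlinarith
  set D := 2 * (C^2 + 1) * (1 / k + 2 + 200 * m^2 / k) with hD
  have hDpos : 0 < D := by positivity
  have hz := lem_blow J J' (1 / D) (2 * C^2) (by positivity) hdJ (fun x => by
    have q0 : (v0 x)^2 ≤ (-J' x) / k := by
      rw [le_div_iff₀ hkpos]; simp only [hJ']; nlinarith [sq_nonneg (v2 x + 10 * m * v0 x)]
    have q1 : (v2 x)^2 ≤ 2 * (-J' x) + 200 * m^2 * ((-J' x) / k) := by
      have : (v2 x)^2 ≤ 2 * (v2 x + 10 * m * v0 x)^2 + 200 * m^2 * (v0 x)^2 := by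
        nlinarith [sq_nonneg (v2 x + 20 * m * v0 x)]
      have h1 : (v2 x + 10 * m * v0 x)^2 ≤ -J' x := by
        simp only [hJ']; nlinarith [mul_nonneg hkpos.le (sq_nonneg (v0 x))]
      nlinarith [mul_le_mul_of_nonneg_left q0 (show 0 ≤ 200 * m^2 by positivity)]
    have q2 : (J x)^2 ≤ 2 * C^2 * ((v0 x)^2 + (v2 x)^2) := by
      have e1 : (v0 x * v3 x)^2 ≤ C^2 * (v0 x)^2 := by
        have : (v3 x)^2 ≤ C^2 := by
          rw [← sq_abs]; exact pow_le_pow_left₀ (abs_nonneg _) (b3 x) 2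
        nlinarith [sq_nonneg (v0 x), mul_le_mul_of_nonneg_left this (sq_nonneg (v0 x))]
      have e2 : (v1 x * v2 x)^2 ≤ C^2 * (v2 x)^2 := by
        have : (v1 x)^2 ≤ C^2 := by
          rw [← sq_abs]; exact pow_le_pow_left₀ (abs_nonneg _) (b1 x) 2
        nlinarith [sq_nonneg (v2 x), mul_le_mul_of_nonneg_left this (sq_nonneg (v2 x))]
      simp only [hJ]
      nlinarith [sq_nonneg (v0 x * v3 x + v1 x * v2 x)]
    have q3 : 0 ≤ -J' x := by simp only [hJ']; rw [neg_neg]; positivity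
    have q4 : (J x)^2 ≤ D * (-J' x) := by
      have e : D * (-J' x) = 2 * (C^2 + 1) * ((-J' x) / k + (2 * (-J' x) +
        200 * m^2 * ((-J' x) / k))) := by
        rw [hD]; field_simp; ring
      rw [e]
      have : 0 ≤ (v0 x)^2 + (v2 x)^2 := by positivity
      nlinarith [mul_nonneg (sq_nonneg C) this, mul_nonneg (sq_nonneg C) (sub_nonneg.mpr (add_le_add q0 q1))]
    have : (1 / D) * (J x)^2 ≤ -J' x := by
      rw [one_div, inv_mul_le_iff₀ hDpos]; exact q4
    linarith) hJb
  have hJz : J = fun _ => 0 := funext hz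
  have z0 : ∀ x, v0 x = 0 := by
    intro x
    have h1 : HasDerivAt J 0 x := by rw [hJz]; exact hasDerivAt_const x 0
    have h2 := (hdJ x).unique h1
    simp only [hJ'] at h2
    have h3 : k * (v0 x)^2 = 0 := by
      have := mul_nonneg hkpos.le (sq_nonneg (v0 x))
      nlinarith [sq_nonneg (v2 x + 10 * m * v0 x)]
    rcases mul_eq_zero.mp h3 with h | h
    · exact absurd h hkpos.ne'
    · exact pow_eq_zero_iff (two_ne_zero) |>.mp h
  have step : ∀ f g : ℝ → ℝ, (∀ x, HasDerivAt f (g x) x) → (∀ x, f x = 0) → ∀ x, g x = 0 := by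
    intro f g hfg hf x
    have hf' : f = fun _ => 0 := funext hf
    have h1 : HasDerivAt f 0 x := by rw [hf']; exact hasDerivAt_const x 0
    exact (hfg x).unique h1
  have z1 := step _ _ d0 z0
  have z2 := step _ _ d1 z1
  have z3 := step _ _ d2 z2
  exact fun x => ⟨z0 x, z1 x, z2 x, z3 x⟩

/-! ### Nonreal branch points -/

theorem lem_cplx_pos (a b a1 b1 a2 b2 q : ℝ → ℝ) (β C : ℝ) (hβ : 0 < β)
    (da : ∀ x, HasDerivAt a (a1 x) x) (db : ∀ x, HasDerivAt b (b1 x) x)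
    (da1 : ∀ x, HasDerivAt a1 (a2 x) x) (db1 : ∀ x, HasDerivAt b1 (b2 x) x)
    (hre : ∀ x, 2 * (a x * a2 x - b x * b2 x) - (a1 x ^ 2 - b1 x ^ 2)
      = 4 * (q x * (a x ^ 2 - b x ^ 2) - β * (2 * a x * b x)))
    (him : ∀ x, 2 * (a x * b2 x + b x * a2 x) - 2 * a1 x * b1 x
      = 4 * (q x * (2 * a x * b x) + β * (a x ^ 2 - b x ^ 2)))
    (Ba : ∀ x, |a x| ≤ C) (Bb : ∀ x, |b x| ≤ C) (Ba1 : ∀ x, |a1 x| ≤ C) (Bb1 : ∀ x, |b1 x| ≤ C)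
    (Ba2 : ∀ x, |a2 x| ≤ C) (Bb2 : ∀ x, |b2 x| ≤ C) (Bq : ∀ x, |q x| ≤ C) :
    ∀ x, a x * b1 x - b x * a1 x ≤ 0 := by
  have hC : 0 ≤ C := le_trans (abs_nonneg _) (Ba 0)
  set p := fun x => a x * b1 x - b x * a1 x with hp
  set n := fun x => a x ^ 2 + b x ^ 2 with hn
  set e := fun x => p x ^ 2 / n x with he
  have n0 : ∀ x, 0 ≤ n x := fun x => by positivity
  have npos : ∀ x, 0 < p x → 0 < n x := by
    intro x hx
    rcases (n0 x).lt_or_eq with h | h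
    · exact h
    · exfalso
      have h' : a x ^ 2 + b x ^ 2 = 0 := h.symm
      have ha : a x = 0 := by nlinarith [sq_nonneg (a x), sq_nonneg (b x)]
      have hb : b x = 0 := by nlinarith [sq_nonneg (a x), sq_nonneg (b x)]
      simp [hp, ha, hb] at hx
  have dp : ∀ x, HasDerivAt p (a x * b2 x - b x * a2 x) x := fun x =>
    (((da x).mul (db1 x)).sub ((db x).mul (da1 x))).congr_deriv (by ring)
  have dn : ∀ x, HasDerivAt n (2 * (a x * a1 x + b x * b1 x)) x := fun x =>
    (((da x).pow 2).add ((db x).pow 2)).congr_deriv (by simp; ring)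
  have key : ∀ x, n x * (a x * b2 x - b x * a2 x) =
      (a x * a1 x + b x * b1 x) * p x + 2 * β * n x ^ 2 := by
    intro x
    simp only [hn, hp]
    linear_combination (a x ^ 2 - b x ^ 2) / 2 * him x - (a x * b x) * hre x
  have de : ∀ x, 0 < p x → HasDerivAt e (4 * β * p x) x := by
    intro x hx
    have hnx := npos x hx
    refine (((dp x).pow 2).div (dn x) hnx.ne').congr_deriv ?_
    rw [div_eq_iff (by positivity)]
    simp only [Pi.pow_apply, Nat.cast_ofNat, Nat.add_one_sub_one, pow_one]
    linear_combination (2 * p x) * key x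
  have eb : ∀ x, e x ≤ a1 x ^ 2 + b1 x ^ 2 := by
    intro x
    rcases (n0 x).lt_or_eq with h | h
    · simp only [he]; rw [div_le_iff₀ h]
      simp only [hp, hn]
      nlinarith [sq_nonneg (a x * a1 x + b x * b1 x)]
    · simp only [he]; rw [← h]; simp; positivity
  have e0 : ∀ x, 0 ≤ e x := fun x => div_nonneg (sq_nonneg _) (n0 x)
  set L := 2 * C + 4 * C * C + 8 * β * C + 1 with hL
  have hLpos : 0 < L := by positivity
  have lin2 : ∀ x c1 c2 : ℝ, |c1| ≤ L → |c2| ≤ L → (a x * c1 + b x * c2)^2 ≤ 2 * L^2 * n x := by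
    intro x c1 c2 h1 h2
    have q1 : c1^2 ≤ L^2 := by rw [← sq_abs]; exact pow_le_pow_left₀ (abs_nonneg _) h1 2
    have q2 : c2^2 ≤ L^2 := by rw [← sq_abs]; exact pow_le_pow_left₀ (abs_nonneg _) h2 2
    simp only [hn]
    nlinarith [sq_nonneg (a x * c1 - b x * c2), mul_le_mul_of_nonneg_left q1 (sq_nonneg (a x)),
      mul_le_mul_of_nonneg_left q2 (sq_nonneg (b x))]
  have en : ∀ x, (e x)^2 ≤ 4 * L^2 * n x := by
    intro x
    have h1 : (e x)^2 ≤ (a1 x ^ 2 + b1 x ^ 2)^2 := pow_le_pow_left₀ (e0 x) (eb x) 2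
    have qa : |q x * a x| ≤ C * C := by
      rw [abs_mul]; exact mul_le_mul (Bq x) (Ba x) (abs_nonneg _) hC
    have qb : |q x * b x| ≤ C * C := by
      rw [abs_mul]; exact mul_le_mul (Bq x) (Bb x) (abs_nonneg _) hC
    have ba := abs_le.mp (Ba x)
    have bb := abs_le.mp (Bb x)
    have ba2 := abs_le.mp (Ba2 x)
    have bb2 := abs_le.mp (Bb2 x)
    rw [abs_le] at qa qb
    have t1 : β * b x ≤ β * C := mul_le_mul_of_nonneg_left bb.2 hβ.le
    have t2 : β * (-C) ≤ β * b x := mul_le_mul_of_nonneg_left bb.1 hβ.le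
    have t3 : β * a x ≤ β * C := mul_le_mul_of_nonneg_left ba.2 hβ.le
    have t4 : β * (-C) ≤ β * a x := mul_le_mul_of_nonneg_left ba.1 hβ.le
    have t5 : 0 ≤ β * C := by positivity
    have t6 : 0 ≤ C * C := by positivity
    have hX := lin2 x (2 * a2 x - 4 * (q x * a x) + 8 * (β * b x)) (-2 * b2 x + 4 * (q x * b x))
      (by rw [abs_le]; constructor <;> simp only [hL] <;> linarith)
      (by rw [abs_le]; constructor <;> simp only [hL] <;> linarith)
    have hY := lin2 x (2 * b2 x - 4 * (β * a x) - 8 * (q x * b x) + 4 * (q x * b x))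
      (2 * a2 x + 4 * (β * b x) - 4 * (q x * a x))
      (by rw [abs_le]; constructor <;> simp only [hL] <;> linarith)
      (by rw [abs_le]; constructor <;> simp only [hL] <;> linarith)
    have eX : a1 x ^ 2 - b1 x ^ 2 = a x * (2 * a2 x - 4 * (q x * a x) + 8 * (β * b x)) +
      b x * (-2 * b2 x + 4 * (q x * b x)) := by linear_combination - hre x
    have eY : 2 * a1 x * b1 x = a x * (2 * b2 x - 4 * (β * a x) - 8 * (q x * b x) + 4 * (q x * b x))
      + b x * (2 * a2 x + 4 * (β * b x) - 4 * (q x * a x)) := by linear_combination - him x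
    rw [← eX] at hX
    rw [← eY] at hY
    nlinarith
  by_contra hcon
  push Not at hcon
  obtain ⟨x1, hx1⟩ := hcon
  change 0 < p x1 at hx1
  have he1 : 0 < e x1 := div_pos (by positivity) (npos x1 hx1)
  set c := Real.sqrt (e x1 ^ 3 / (4 * L^2)) with hc
  have hcpos : 0 < c := Real.sqrt_pos.mpr (by positivity)
  have hcsq : c^2 = e x1 ^ 3 / (4 * L^2) := Real.sq_sqrt (by positivity)
  have pge : ∀ x, 0 < p x → e x1 ≤ e x → c ≤ p x := by
    intro x hx hex
    have hnx := npos x hx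
    have h1 : p x ^ 2 = e x * n x := by simp only [he]; field_simp
    have h2 : e x1 ^ 3 ≤ e x * (e x)^2 := by
      have := pow_le_pow_left₀ he1.le hex 3
      nlinarith
    have h3 : e x * (e x)^2 ≤ e x * (4 * L^2 * n x) := mul_le_mul_of_nonneg_left (en x) (e0 x)
    have h4 : c^2 ≤ p x ^2 := by
      rw [hcsq, div_le_iff₀ (by positivity), h1]; nlinarith
    exact (pow_le_pow_iff_left₀ hcpos.le hx.le two_ne_zero).mp h4
  have pcont : Continuous p := continuous_iff_continuousAt.mpr fun x => (dp x).continuousAt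
  have emono : ∀ y, x1 ≤ y → (∀ x ∈ Set.Icc x1 y, 0 < p x) → e x1 ≤ e y := by
    intro y hy hpos
    have : MonotoneOn e (Set.Icc x1 y) := by
      apply monotoneOn_of_deriv_nonneg (convex_Icc _ _)
      · exact fun x hx => (de x (hpos x hx)).continuousAt.continuousWithinAt
      · exact fun x hx => (de x (hpos x (interior_subset hx))).differentiableAt.differentiableWithinAt
      · intro x hx
        rw [(de x (hpos x (interior_subset hx))).deriv]
        have := hpos x (interior_subset hx)
        positivity
    exact this ⟨le_rfl, hy⟩ ⟨hy, le_rfl⟩ hy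
  have ppos : ∀ y, x1 ≤ y → 0 < p y := by
    by_contra hcon
    push Not at hcon
    obtain ⟨y, hy, hpy⟩ := hcon
    set S := {z | x1 ≤ z ∧ p z ≤ 0} with hS
    have hSc : IsClosed S := (isClosed_le continuous_const continuous_id).inter
      (isClosed_le pcont continuous_const)
    have hSb : BddBelow S := ⟨x1, fun z hz => hz.1⟩
    have hmem := hSc.csInf_mem ⟨y, hy, hpy⟩ hSb
    set y0 := sInf S
    have hbefore : ∀ z, x1 ≤ z → z < y0 → 0 < p z := by
      intro z hz hzy
      by_contra h
      exact absurd (csInf_le hSb (show z ∈ S from ⟨hz, not_lt.mp h⟩)) (not_le.mpr hzy)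
    have hge : ∀ z, x1 ≤ z → z < y0 → c ≤ p z := by
      intro z hz hzy
      exact pge z (hbefore z hz hzy) (emono z hz fun x hx => hbefore x hx.1 (lt_of_le_of_lt hx.2 hzy))
    have hx1y : x1 < y0 := by
      rcases hmem.1.lt_or_eq with h | h
      · exact h
      · have := hmem.2; rw [← h] at this; linarith
    have hv : c / 2 ∈ Set.Icc (p y0) (p x1) := by
      have := hge x1 le_rfl hx1y
      have := hmem.2
      constructor <;> linarith
    obtain ⟨z, hz, hpz⟩ := intermediate_value_Icc' hx1y.le pcont.continuousOn hv
    rcases hz.2.lt_or_eq with h | h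
    · have := hge z hz.1 h; linarith
    · have := hmem.2; rw [← h] at this; linarith
  have h2 : MonotoneOn (fun x => e x - 4 * β * c * x) (Set.Ici x1) := by
    have dd : ∀ x, x1 ≤ x → HasDerivAt (fun x => e x - 4 * β * c * x) (4 * β * p x - 4 * β * c) x :=
      fun x hx => ((de x (ppos x hx)).sub ((hasDerivAt_id x).const_mul (4 * β * c))).congr_deriv
        (by simp)
    apply monotoneOn_of_deriv_nonneg (convex_Ici _)
    · exact fun x hx => (dd x hx).continuousAt.continuousWithinAt
    · exact fun x hx => (dd x (interior_subset hx)).differentiableAt.differentiableWithinAt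
    · intro x hx
      have hx' : x1 ≤ x := interior_subset hx
      rw [(dd x hx').deriv]
      have := pge x (ppos x hx') (emono x hx' fun z hz => ppos z hz.1)
      nlinarith
  have hbc : 0 < 4 * β * c := by positivity
  have h5 := h2 (Set.mem_Ici.mpr le_rfl) (show x1 + (2 * C^2 + 1) / (4 * β * c) ∈ Set.Ici x1 by
    simp only [Set.mem_Ici, le_add_iff_nonneg_right]; positivity)
    (by simp only [le_add_iff_nonneg_right]; positivity)
  simp only at h5
  rw [mul_add, mul_div_cancel₀ _ hbc.ne'] at h5
  have h6 := eb (x1 + (2 * C^2 + 1) / (4 * β * c))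
  have h7 : ∀ f : ℝ → ℝ, (∀ x, |f x| ≤ C) → ∀ x, f x ^ 2 ≤ C^2 := fun f hf x => by
    rw [← sq_abs]; exact pow_le_pow_left₀ (abs_nonneg _) (hf x) 2
  have := h7 a1 Ba1 (x1 + (2 * C^2 + 1) / (4 * β * c))
  have := h7 b1 Bb1 (x1 + (2 * C^2 + 1) / (4 * β * c))
  linarith

theorem lem_cplx (a b a1 b1 a2 b2 q : ℝ → ℝ) (β C : ℝ) (hβ : 0 < β)
    (da : ∀ x, HasDerivAt a (a1 x) x) (db : ∀ x, HasDerivAt b (b1 x) x)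
    (da1 : ∀ x, HasDerivAt a1 (a2 x) x) (db1 : ∀ x, HasDerivAt b1 (b2 x) x)
    (hre : ∀ x, 2 * (a x * a2 x - b x * b2 x) - (a1 x ^ 2 - b1 x ^ 2)
      = 4 * (q x * (a x ^ 2 - b x ^ 2) - β * (2 * a x * b x)))
    (him : ∀ x, 2 * (a x * b2 x + b x * a2 x) - 2 * a1 x * b1 x
      = 4 * (q x * (2 * a x * b x) + β * (a x ^ 2 - b x ^ 2)))
    (Ba : ∀ x, |a x| ≤ C) (Bb : ∀ x, |b x| ≤ C) (Ba1 : ∀ x, |a1 x| ≤ C) (Bb1 : ∀ x, |b1 x| ≤ C)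
    (Ba2 : ∀ x, |a2 x| ≤ C) (Bb2 : ∀ x, |b2 x| ≤ C) (Bq : ∀ x, |q x| ≤ C) :
    ∀ x, b x = 0 := by
  have h1 := lem_cplx_pos a b a1 b1 a2 b2 q β C hβ da db da1 db1 hre him Ba Bb Ba1 Bb1 Ba2 Bb2 Bq
  have h2 := lem_cplx_pos (fun x => a (-x)) (fun x => b (-x)) (fun x => -a1 (-x))
    (fun x => -b1 (-x)) (fun x => a2 (-x)) (fun x => b2 (-x)) (fun x => q (-x)) β C hβ
    (fun x => lem_dneg (da (-x))) (fun x => lem_dneg (db (-x)))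
    (fun x => (lem_dneg (da1 (-x))).neg.congr_deriv (by simp))
    (fun x => (lem_dneg (db1 (-x))).neg.congr_deriv (by simp))
    (fun x => by linear_combination hre (-x)) (fun x => by linear_combination him (-x))
    (fun x => Ba (-x)) (fun x => Bb (-x)) (fun x => by simpa using Ba1 (-x))
    (fun x => by simpa using Bb1 (-x)) (fun x => Ba2 (-x)) (fun x => Bb2 (-x)) (fun x => Bq (-x))
  have hp : ∀ x, a x * b1 x - b x * a1 x = 0 := by
    intro x
    have := h1 x
    have h3 := h2 (-x)
    simp only [neg_neg] at h3
    linarith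
  intro x
  have dp : HasDerivAt (fun x => a x * b1 x - b x * a1 x) (a x * b2 x - b x * a2 x) x :=
    (((da x).mul (db1 x)).sub ((db x).mul (da1 x))).congr_deriv (by ring)
  have hf : (fun x => a x * b1 x - b x * a1 x) = fun _ => (0:ℝ) := funext hp
  rw [hf] at dp
  have h0 := dp.unique (hasDerivAt_const x 0)
  have key : (a x ^ 2 + b x ^ 2) * (a x * b2 x - b x * a2 x) =
      (a x * a1 x + b x * b1 x) * (a x * b1 x - b x * a1 x) + 2 * β * (a x ^ 2 + b x ^ 2) ^ 2 := by
    linear_combination (a x ^ 2 - b x ^ 2) / 2 * him x - (a x * b x) * hre x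
  rw [h0, hp x] at key
  have : (a x ^ 2 + b x ^ 2)^2 = 0 := by
    have : 2 * β * (a x ^ 2 + b x ^ 2)^2 = 0 := by linarith
    rcases mul_eq_zero.mp this with h | h
    · linarith
    · exact h
  have : a x ^ 2 + b x ^ 2 = 0 := pow_eq_zero_iff two_ne_zero |>.mp this
  nlinarith [sq_nonneg (a x), sq_nonneg (b x)]

/-! ### Roots of the spectral quintic -/

theorem lem_quintic (A B C D : ℝ) (hA : 0 ≤ A) :
    (∃ z : ℂ, 0 < z.im ∧ z^5 + A * z^3 + B * z^2 + C * z + D = 0) ∨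
      (A = 0 ∧ B = 0 ∧ C = 0 ∧ D = 0) := by
  by_cases hroot : ∃ z : ℂ, z.im ≠ 0 ∧ z^5 + A * z^3 + B * z^2 + C * z + D = 0
  · left
    obtain ⟨z, hz, h⟩ := hroot
    rcases lt_or_gt_of_ne hz with h1 | h1
    · refine ⟨(starRingEnd ℂ) z, by simpa using h1, ?_⟩
      have := congrArg (starRingEnd ℂ) h
      simpa using this
    · exact ⟨z, h1, h⟩
  · right
    push Not at hroot
    have hroot' : ∀ z : ℂ, z^5 + A * z^3 + B * z^2 + C * z + D = 0 → z.im = 0 := by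
      intro z hz
      by_contra h
      exact hroot z h hz
    set p : Polynomial ℂ := Polynomial.X^5 + (Polynomial.C (A:ℂ) * Polynomial.X^3 +
      Polynomial.C (B:ℂ) * Polynomial.X^2 + Polynomial.C (C:ℂ) * Polynomial.X +
      Polynomial.C (D:ℂ)) with hp
    have hdeg : (Polynomial.C (A:ℂ) * Polynomial.X^3 +
      Polynomial.C (B:ℂ) * Polynomial.X^2 + Polynomial.C (C:ℂ) * Polynomial.X +
      Polynomial.C (D:ℂ)).degree < 5 := lt_of_le_of_lt Polynomial.degree_cubic_le (by norm_num)
    have hm : p.Monic := Polynomial.monic_X_pow_add hdeg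
    have hnd : p.natDegree = 5 := by
      have : p.degree = 5 := by
        rw [hp, Polynomial.degree_add_eq_left_of_degree_lt] <;> simp
        exact hdeg
      exact Polynomial.natDegree_eq_of_degree_eq_some this
    have hsp := IsAlgClosed.splits p
    have hcard : p.roots.card = 5 := by
      rw [← hnd]; exact hsp.natDegree_eq_card_roots.symm
    have hprod := hsp.eq_prod_roots_of_monic hm
    obtain ⟨a, s1, hs1, hc1⟩ := Multiset.card_eq_succ_iff.mp hcard
    obtain ⟨b, c, d, e, rfl⟩ := Multiset.card_eq_four.mp hc1
    rw [← hs1] at hprod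
    have hfac : ∀ z : ℂ, z^5 + A * z^3 + B * z^2 + C * z + D =
        (z - a) * (z - b) * (z - c) * (z - d) * (z - e) := by
      intro z
      have h1 : p.eval z = z^5 + A * z^3 + B * z^2 + C * z + D := by
        simp [hp]; ring
      have h2 := congrArg (Polynomial.eval z) hprod
      rw [h1] at h2
      rw [h2]
      simp
      ring
    have ra : a.im = 0 := hroot' a (by rw [hfac]; ring)
    have rb : b.im = 0 := hroot' b (by rw [hfac]; ring)
    have rc : c.im = 0 := hroot' c (by rw [hfac]; ring)
    have rd : d.im = 0 := hroot' d (by rw [hfac]; ring)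
    have re : e.im = 0 := hroot' e (by rw [hfac]; ring)
    have ea : a = (a.re : ℂ) := Complex.ext (by simp) (by simp [ra])
    have eb : b = (b.re : ℂ) := Complex.ext (by simp) (by simp [rb])
    have ec : c = (c.re : ℂ) := Complex.ext (by simp) (by simp [rc])
    have ed : d = (d.re : ℂ) := Complex.ext (by simp) (by simp [rd])
    have ee : e = (e.re : ℂ) := Complex.ext (by simp) (by simp [re])
    rw [ea, eb, ec, ed, ee] at hfac
    have hr : ∀ z : ℝ, z^5 + A * z^3 + B * z^2 + C * z + D =
        (z - a.re) * (z - b.re) * (z - c.re) * (z - d.re) * (z - e.re) := by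
      intro z
      exact_mod_cast hfac z
    generalize a.re = a' at hr
    generalize b.re = b' at hr
    generalize c.re = c' at hr
    generalize d.re = d' at hr
    generalize e.re = e' at hr
    have e1 : a' + b' + c' + d' + e' = 0 := by
      linear_combination (hr 2 - 4 * hr 1 + 6 * hr 0 - 4 * hr (-1) + hr (-2)) / 24
    have e2 : A = a' * b' + a' * c' + a' * d' + a' * e' + b' * c' + b' * d' + b' * e' + c' * d' +
        c' * e' + d' * e' := by
      linear_combination (hr 2 - 2 * hr 1 + 2 * hr (-1) - hr (-2)) / 12
    have e3 : a'^2 + b'^2 + c'^2 + d'^2 + e'^2 = - 2 * A := by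
      rw [e2]; linear_combination (a' + b' + c' + d' + e') * e1
    have h : ∀ x : ℝ, x^2 ≤ 0 → x = 0 := fun x hx => by nlinarith
    have ha := h a' (by nlinarith [sq_nonneg b', sq_nonneg c', sq_nonneg d', sq_nonneg e'])
    have hb := h b' (by nlinarith [sq_nonneg a', sq_nonneg c', sq_nonneg d', sq_nonneg e'])
    have hc := h c' (by nlinarith [sq_nonneg b', sq_nonneg a', sq_nonneg d', sq_nonneg e'])
    have hd := h d' (by nlinarith [sq_nonneg b', sq_nonneg c', sq_nonneg a', sq_nonneg e'])
    have he := h e' (by nlinarith [sq_nonneg b', sq_nonneg c', sq_nonneg d', sq_nonneg a'])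
    subst ha hb hc hd he
    have h0 := hr 0
    have h1 := hr 1
    have h2 := hr (-1)
    norm_num at h0 h1 h2 e2
    refine ⟨e2, ?_, ?_, h0⟩ <;> linarith

set_option maxHeartbeats 1000000 in
/-- The case of a nonreal branch point. -/
theorem lem_liou_nonreal (U U1 r s : ℝ → ℝ) (τ c C p1 p0 : ℝ)
    (dU : ∀ x, HasDerivAt U (U1 x) x)
    (dU1 : ∀ x, HasDerivAt U1 (4 * r x - 6 * U x ^ 2 - 60 * τ) x)
    (dr : ∀ x, HasDerivAt r (s x) x)
    (ds : ∀ x, HasDerivAt s (U1 x ^ 2 / 2 - 8 * U x * r x + 2 * U x ^ 3 + 60 * τ * U x - 60 * c) x)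
    (bU : ∀ x, |U x| ≤ C) (bU1 : ∀ x, |U1 x| ≤ C) (br : ∀ x, |r x| ≤ C) (bs : ∀ x, |s x| ≤ C)
    (hp1 : ∀ x, p1 = 2 * U x * (U1 x ^ 2 / 2 - 8 * U x * r x + 2 * U x ^ 3 + 60 * τ * U x - 60 * c)
      + 2 * r x * (4 * r x - 6 * U x ^ 2 - 60 * τ) - 2 * U1 x * s x - 4 * r x ^ 2
      + 16 * U x ^ 2 * r x)
    (hp0 : ∀ x, p0 = 2 * r x * (U1 x ^ 2 / 2 - 8 * U x * r x + 2 * U x ^ 3 + 60 * τ * U x - 60 * c)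
      - s x ^ 2 + 8 * U x * r x ^ 2)
    (z : ℂ) (hz : 0 < z.im)
    (h : z^5 + (30 * τ : ℝ) * z^3 + (30 * c : ℝ) * z^2 + (-p1/4 : ℝ) * z + (-p0/4 : ℝ) = 0) :
    ∀ x, U1 x = 0 := by
  obtain ⟨α, β⟩ := z
  simp only at hz
  have hC : 0 ≤ C := le_trans (abs_nonneg _) (bU 0)
  have hRe := congrArg Complex.re h
  have hIm := congrArg Complex.im h
  simp [pow_succ] at hRe hIm
  have bnd : ∀ x, (|α^2 - β^2 + U x * α + r x| ≤ α^2 + β^2 + C * |α| + C) ∧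
    (|2 * α * β + U x * β| ≤ 2 * |α| * β + C * β) ∧
    (|U1 x * α + s x| ≤ C * |α| + C) ∧
    (|U1 x * β| ≤ C * β) ∧
    (|(4 * r x - 6 * U x ^ 2 - 60 * τ) * α +
      (U1 x ^ 2 / 2 - 8 * U x * r x + 2 * U x ^ 3 + 60 * τ * U x - 60 * c)| ≤
      (4 * C + 6 * C^2 + 60 * |τ|) * |α| + (C^2/2 + 8 * C * C + 2 * C^3 + 60 * |τ| * C + 60 * |c|)) ∧
    (|(4 * r x - 6 * U x ^ 2 - 60 * τ) * β| ≤ (4 * C + 6 * C^2 + 60 * |τ|) * β) ∧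
    (|α - 2 * U x| ≤ |α| + 2 * C) ∧
    0 ≤ α^2 + β^2 + C * |α| + C ∧
    0 ≤ 2 * |α| * β + C * β ∧
    0 ≤ C * |α| + C ∧
    0 ≤ C * β ∧
    0 ≤ (4 * C + 6 * C^2 + 60 * |τ|) * |α| + (C^2/2 + 8 * C * C + 2 * C^3 + 60 * |τ| * C + 60 * |c|) ∧
    0 ≤ (4 * C + 6 * C^2 + 60 * |τ|) * β ∧
    0 ≤ |α| + 2 * C := by
    intro x
    have hβ := abs_of_pos hz
    have g1 : |4 * r x - 6 * U x ^ 2 - 60 * τ| ≤ 4 * C + 6 * C^2 + 60 * |τ| := by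
      calc |4 * r x - 6 * U x ^ 2 - 60 * τ| ≤ |4 * r x| + |6 * U x ^ 2| + |60 * τ| := by
            refine (abs_sub _ _).trans ?_
            gcongr
            exact abs_sub _ _
        _ = 4 * |r x| + 6 * |U x|^2 + 60 * |τ| := by simp [abs_mul]
        _ ≤ _ := by gcongr <;> first | exact br x | exact bU x
    have g2 : |U1 x ^ 2 / 2 - 8 * U x * r x + 2 * U x ^ 3 + 60 * τ * U x - 60 * c| ≤
        C^2/2 + 8 * C * C + 2 * C^3 + 60 * |τ| * C + 60 * |c| := by
      calc |U1 x ^ 2 / 2 - 8 * U x * r x + 2 * U x ^ 3 + 60 * τ * U x - 60 * c| ≤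
          |U1 x ^ 2 / 2| + |8 * U x * r x| + |2 * U x ^ 3| + |60 * τ * U x| + |60 * c| := by
            refine (abs_sub _ _).trans ?_
            gcongr
            refine (abs_add_le _ _).trans ?_
            gcongr
            refine (abs_add_le _ _).trans ?_
            gcongr
            exact abs_sub _ _
        _ = |U1 x|^2/2 + 8 * |U x| * |r x| + 2 * |U x|^3 + 60 * |τ| * |U x| + 60 * |c| := by
            simp [abs_mul, abs_div, abs_pow]
        _ ≤ _ := by gcongr <;> first | exact br x | exact bU x | exact bU1 x
    have ga : |α^2 - β^2 + U x * α + r x| ≤ α^2 + β^2 + C * |α| + C := by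
      calc |α^2 - β^2 + U x * α + r x| ≤ |α^2| + |β^2| + |U x * α| + |r x| := by
            refine (abs_add_le _ _).trans ?_
            gcongr
            refine (abs_add_le _ _).trans ?_
            gcongr
            exact abs_sub _ _
        _ = α^2 + β^2 + |U x| * |α| + |r x| := by simp [abs_mul]
        _ ≤ _ := by gcongr <;> first | exact br x | exact bU x
    have gb : |2 * α * β + U x * β| ≤ 2 * |α| * β + C * β := by
      calc |2 * α * β + U x * β| ≤ |2 * α * β| + |U x * β| := abs_add_le _ _
        _ = 2 * |α| * β + |U x| * β := by simp [abs_mul, hβ]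
        _ ≤ _ := by gcongr; exact bU x
    have ga1 : |U1 x * α + s x| ≤ C * |α| + C := by
      calc |U1 x * α + s x| ≤ |U1 x * α| + |s x| := abs_add_le _ _
        _ = |U1 x| * |α| + |s x| := by simp [abs_mul]
        _ ≤ _ := by gcongr <;> first | exact bs x | exact bU1 x
    have gb1 : |U1 x * β| ≤ C * β := by
      rw [abs_mul, hβ]; gcongr; exact bU1 x
    have ga2 : |(4 * r x - 6 * U x ^ 2 - 60 * τ) * α +
      (U1 x ^ 2 / 2 - 8 * U x * r x + 2 * U x ^ 3 + 60 * τ * U x - 60 * c)| ≤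
      (4 * C + 6 * C^2 + 60 * |τ|) * |α| + (C^2/2 + 8 * C * C + 2 * C^3 + 60 * |τ| * C + 60 * |c|) := by
      refine (abs_add_le _ _).trans ?_
      rw [abs_mul]
      gcongr
    have gb2 : |(4 * r x - 6 * U x ^ 2 - 60 * τ) * β| ≤ (4 * C + 6 * C^2 + 60 * |τ|) * β := by
      rw [abs_mul, hβ]; gcongr
    have gq : |α - 2 * U x| ≤ |α| + 2 * C := by
      refine (abs_sub _ _).trans ?_
      rw [abs_mul, abs_two]
      gcongr
      exact bU x
    exact ⟨ga, gb, ga1, gb1, ga2, gb2, gq, (abs_nonneg _).trans ga, (abs_nonneg _).trans gb, (abs_nonneg _).trans ga1,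
      (abs_nonneg _).trans gb1, (abs_nonneg _).trans ga2, (abs_nonneg _).trans gb2, (abs_nonneg _).trans gq⟩
  have key := lem_cplx (fun x => α^2 - β^2 + U x * α + r x) (fun x => 2 * α * β + U x * β)
    (fun x => U1 x * α + s x) (fun x => U1 x * β)
    (fun x => (4 * r x - 6 * U x ^ 2 - 60 * τ) * α +
      (U1 x ^ 2 / 2 - 8 * U x * r x + 2 * U x ^ 3 + 60 * τ * U x - 60 * c))
    (fun x => (4 * r x - 6 * U x ^ 2 - 60 * τ) * β) (fun x => α - 2 * U x) β
    ((α^2 + β^2 + C * |α| + C) + (2 * |α| * β + C * β) + (C * |α| + C) + C * β +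
      ((4 * C + 6 * C^2 + 60 * |τ|) * |α| + (C^2/2 + 8 * C * C + 2 * C^3 + 60 * |τ| * C + 60 * |c|))
      + (4 * C + 6 * C^2 + 60 * |τ|) * β + (|α| + 2 * C)) hz
    (fun x => (((dU x).mul_const α).const_add (α^2 - β^2)).add (dr x))
    (fun x => ((dU x).mul_const β).const_add (2 * α * β))
    (fun x => ((dU1 x).mul_const α).add (ds x))
    (fun x => (dU1 x).mul_const β)
    (fun x => by
      have e1 := hp1 x
      have e0 := hp0 x
      rw [e1, e0] at hRe
      linear_combination (-4) * hRe)
    (fun x => by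
      have e1 := hp1 x
      rw [e1] at hIm
      linear_combination (-4) * hIm)
    ?_ ?_ ?_ ?_ ?_ ?_ ?_
  · intro x
    have h1 : (fun x => 2 * α * β + U x * β) = fun _ => (0:ℝ) := funext key
    have h2 := ((dU x).mul_const β).const_add (2 * α * β)
    rw [h1] at h2
    have h3 := h2.unique (hasDerivAt_const x 0)
    rcases mul_eq_zero.mp h3 with h4 | h4
    · exact h4
    · exact absurd h4 hz.ne'
  all_goals
    intro x
    obtain ⟨ga, gb, ga1, gb1, ga2, gb2, gq, n1, n2, n3, n4, n5, n6, n7⟩ := bnd x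
    linarith

/-! ### Degenerate spectral curve -/

theorem lem_const {f : ℝ → ℝ} (h : ∀ x, HasDerivAt f 0 x) (x y : ℝ) : f x = f y :=
  is_const_of_deriv_eq_zero (fun x => (h x).differentiableAt) (fun x => (h x).deriv) x y

theorem lem_poscubic (f f1 f2 : ℝ → ℝ) (c : ℝ) (hf : ∀ x, 0 < f x)
    (d0 : ∀ x, HasDerivAt f (f1 x) x) (d1 : ∀ x, HasDerivAt f1 (f2 x) x)
    (d2 : ∀ x, HasDerivAt f2 c x) :
    c = 0 ∧ ((∀ x, f2 x = 0) → ∀ x, f1 x = 0) := by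
  have e2 : ∀ x, f2 x = f2 0 + c * x := by
    intro x
    have := lem_const (f := fun x => f2 x - c * x)
      (fun x => ((d2 x).sub ((hasDerivAt_id x).const_mul c)).congr_deriv (by simp)) x 0
    simp only [mul_zero, sub_zero] at this
    linarith
  have e1 : ∀ x, f1 x = f1 0 + f2 0 * x + c * x^2 / 2 := by
    intro x
    have := lem_const (f := fun x => f1 x - (f2 0 * x + c / 2 * x^2))
      (fun x => ((d1 x).sub (((hasDerivAt_id x).const_mul (f2 0)).add
        ((hasDerivAt_pow 2 x).const_mul (c/2)))).congr_deriv (by rw [e2]; simp; ring)) x 0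
    simp only [mul_zero, sub_zero] at this
    linarith
  have e0 : ∀ x, f x = f 0 + f1 0 * x + f2 0 * x^2 / 2 + c * x^3 / 6 := by
    intro x
    have := lem_const (f := fun x => f x - (f1 0 * x + f2 0 / 2 * x^2 + c/6 * x^3))
      (fun x => ((d0 x).sub ((((hasDerivAt_id x).const_mul (f1 0)).add
        ((hasDerivAt_pow 2 x).const_mul (f2 0/2))).add
        ((hasDerivAt_pow 3 x).const_mul (c/6)))).congr_deriv (by rw [e1]; simp; ring)) x 0
    simp only [mul_zero, sub_zero] at this
    linarith
  have hc : c = 0 := by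
    by_contra hc
    have hc' : 0 < |c| := abs_pos.mpr hc
    set S := |f 0| + |f1 0| + |f2 0| with hS
    have hS0 : 0 ≤ S := by positivity
    set y := 1 + 6 / |c| * S with hy
    have y1 : 1 ≤ y := by rw [hy]; have : 0 ≤ 6 / |c| * S := by positivity
                          linarith
    have hcy : |c| * y / 6 = |c| / 6 + S := by rw [hy]; field_simp
    have a0 := abs_le.mp (le_refl |f 0|)
    have a1 := abs_le.mp (le_refl |f1 0|)
    have a2 := abs_le.mp (le_refl |f2 0|)
    have main : f 0 + |f1 0| * y + f2 0 * y^2/2 < |c| * y^3 / 6 := by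
      have : |c| * y^3/6 = y^2 * (|c| / 6 + S) := by rw [← hcy]; ring
      rw [this]
      have y2 : y ≤ y^2 := by nlinarith
      have y3 : 1 ≤ y^2 := by linarith
      have t1 : f 0 ≤ |f 0| * y^2 := by nlinarith [abs_nonneg (f 0)]
      have t2 : |f1 0| * y ≤ |f1 0| * y^2 := mul_le_mul_of_nonneg_left y2 (abs_nonneg _)
      have t3 : f2 0 * y^2/2 ≤ |f2 0| * y^2 := by nlinarith [abs_nonneg (f2 0)]
      have t4 : 0 < y^2 * (|c|/6) := by positivity
      simp only [hS]
      nlinarith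
    rcases lt_or_gt_of_ne hc with h | h
    · have p := hf y
      rw [e0, ] at p
      rw [abs_of_neg h] at main
      nlinarith
    · have p := hf (-y)
      rw [e0] at p
      rw [abs_of_pos h] at main
      nlinarith
  refine ⟨hc, fun h x => ?_⟩
  by_contra hx
  have h1 : f1 x = f1 0 := by rw [e1 x, h 0, hc]; ring
  rw [h1] at hx
  have p := hf (-(f 0 + 1) / f1 0)
  rw [e0, h 0, hc] at p
  have : f1 0 * (-(f 0 + 1) / f1 0) = -(f 0 + 1) := by field_simp
  rw [this] at p
  linarith

set_option maxHeartbeats 1000000 in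
theorem lem_liou_deg (U U1 r s : ℝ → ℝ) (C : ℝ)
    (dU : ∀ x, HasDerivAt U (U1 x) x)
    (dU1 : ∀ x, HasDerivAt U1 (4 * r x - 6 * U x ^ 2) x)
    (dr : ∀ x, HasDerivAt r (s x) x)
    (ds : ∀ x, HasDerivAt s (U1 x ^ 2 / 2 - 8 * U x * r x + 2 * U x ^ 3) x)
    (bU : ∀ x, |U x| ≤ C) (bU1 : ∀ x, |U1 x| ≤ C)
    (hA : ∀ x, U x * U1 x ^ 2 - 12 * U x ^ 2 * r x + 4 * U x ^ 4 + 4 * r x ^ 2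
      - 2 * U1 x * s x = 0)
    (hB : ∀ x, r x * U1 x ^ 2 - 8 * U x * r x ^ 2 + 4 * U x ^ 3 * r x - s x ^ 2 = 0) :
    ∀ x, U1 x = 0 := by
  have hC : 0 ≤ C := le_trans (abs_nonneg _) (bU 0)
  by_cases hr : ∀ x, r x = 0
  · have hs : ∀ x, s x = 0 := by
      intro x
      have h := dr x
      rw [show r = fun _ => 0 from funext hr] at h
      exact h.unique (hasDerivAt_const x 0)
    have h2 : ∀ x, U1 x ^ 2 = - 4 * U x ^ 3 := by
      intro x
      have h := ds x
      rw [show s = fun _ => 0 from funext hs] at h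
      have := h.unique (hasDerivAt_const x 0)
      rw [hr x] at this
      linarith
    refine lem_blow U1 _ (6 / (4 * (C + 1))) C (by positivity) dU1 ?_ bU1
    intro x
    rw [hr x, h2 x]
    have h3 := (abs_le.mp (bU x)).1
    have h4 : -4 * U x ^3 ≤ (4 * (C+1)) * U x ^2 := by nlinarith [sq_nonneg (U x)]
    have h5 : 6 / (4 * (C + 1)) * (-4 * U x ^3) ≤ 6 / (4 * (C + 1)) * ((4 * (C+1)) * U x ^2) :=
      mul_le_mul_of_nonneg_left h4 (by positivity)
    have h6 : 6 / (4 * (C + 1)) * ((4 * (C+1)) * U x ^2) = 6 * U x ^2 := by field_simp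
    linarith
  push Not at hr
  obtain ⟨x00, hx00⟩ := hr
  have dD : ∀ x, HasDerivAt (fun x => U1 x * r x - U x * s x)
      (6 * r x ^ 2 - 4 * U x ^2 * r x - U1 x * s x) x := fun x =>
    (((dU1 x).mul (dr x)).sub ((dU x).mul (ds x))).congr_deriv (by linear_combination (-1/2) * hA x)
  have hx0 : ∃ x0, r x0 ≠ 0 ∧ U1 x0 * r x0 - U x0 * s x0 ≠ 0 := by
    by_cases hD0 : U1 x00 * r x00 - U x00 * s x00 = 0
    · have hne : (6 * r x00 ^ 2 - 4 * U x00 ^2 * r x00 - U1 x00 * s x00) ≠ 0 := by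
        intro h0
        have : 2 * r x00 ^ 3 = 0 := by
          linear_combination r x00 * h0 - s x00 * hD0 + U x00 * hB x00 - r x00 * hA x00
        apply hx00
        have : r x00 ^ 3 = 0 := by linarith
        exact pow_eq_zero_iff (by norm_num) |>.mp this
      have h1 := (dD x00).eventually_ne hne (c := 0)
      have h2 : ∀ᶠ x in nhdsWithin x00 {x00}ᶜ, r x ≠ 0 :=
        ((dr x00).continuousAt.eventually_ne hx00).filter_mono nhdsWithin_le_nhds
      obtain ⟨x, hx⟩ := (h1.and h2).exists
      exact ⟨x, hx.2, hx.1⟩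
    · exact ⟨x00, hx00, hD0⟩
  obtain ⟨x0, hr0, hD0⟩ := hx0
  have hZ0 : ∃ Z : ℝ, Z^4 + 6 * U x0 * Z^2 + 4 * U1 x0 * Z + 4 * r x0 - 3 * U x0 ^2 = 0 ∧
      4 * s x0 - 2 * U x0 * U1 x0 + 16 * Z * r x0 - 12 * Z * U x0 ^2 + 6 * Z^2 * U1 x0 +
        4 * Z^3 * U x0 = 0 ∧
      Z^4 + 4 * Z^2 * U x0 - U x0 ^2 + 2 * Z * U1 x0 = 0 := by
    have A := hA x0
    have B := hB x0
    generalize U x0 = u at *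
    generalize U1 x0 = u1 at *
    generalize r x0 = r at *
    generalize s x0 = s at *
    obtain ⟨k, hk⟩ : ∃ k, s = 2 * r * k := ⟨s / (2 * r), by field_simp⟩
    obtain ⟨h, hh⟩ : ∃ h, u1 = 2 * h + 2 * k * u := ⟨(u1 - 2 * k * u)/2, by ring⟩
    have hh0 : h ≠ 0 := by
      rintro rfl
      apply hD0
      rw [hh, hk]; ring
    have B' : u1^2 - 8 * u * r + 4 * u^3 - 4 * r * k^2 = 0 := by
      apply mul_left_cancel₀ hr0
      rw [hk] at B
      linear_combination B
    have A' : r = u^2 + u * k^2 + 2 * h * k := by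
      have : 4 * r * (r - (u^2 + u * k^2 + 2 * h * k)) = 0 := by
        rw [hk] at A
        rw [hh] at A B'
        linear_combination A - u * B'
      rcases mul_eq_zero.mp this with h1 | h1
      · exact absurd h1 (by simpa using hr0)
      · linarith
    obtain ⟨w, hw⟩ : ∃ w, u = w - k^2 := ⟨u + k^2, by ring⟩
    have hw3 : (h - k * w)^2 = w^3 := by
      rw [hh, A', hw] at B'
      linear_combination B' / 4
    have hw0 : w ≠ 0 := by
      rintro rfl
      apply hh0
      have : h ^ 2 = 0 := by linear_combination hw3
      exact pow_eq_zero_iff two_ne_zero |>.mp this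
    obtain ⟨g, hg⟩ : ∃ g, h = k * w + g * w := ⟨(h - k*w)/w, by field_simp; ring⟩
    have hgw : w = g^2 := by
      apply mul_left_cancel₀ (pow_ne_zero 2 hw0)
      rw [hg] at hw3
      linear_combination -hw3
    refine ⟨-(g + k), ?_, ?_, ?_⟩ <;> rw [hh] <;> (try rw [hk]) <;> (try rw [A']) <;> rw [hg, hw, hgw] <;> ring
  obtain ⟨Z0, hE0, hE10, hK0⟩ := hZ0
  have cU : Continuous U := continuous_iff_continuousAt.mpr fun x => (dU x).continuousAt
  obtain ⟨Z, dZ, hZ⟩ : ∃ Z : ℝ → ℝ, (∀ x, HasDerivAt Z (U x) x) ∧ Z x0 = Z0 :=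
    ⟨fun x => Z0 + ∫ y in x0..x, U y,
      fun x => ((intervalIntegral.integral_hasDerivAt_right (cU.intervalIntegrable _ _)
        (cU.stronglyMeasurableAtFilter _ _) cU.continuousAt).const_add Z0), by simp⟩
  have cZ : Continuous Z := continuous_iff_continuousAt.mpr fun x => (dZ x).continuousAt
  obtain ⟨Q, dQ⟩ : ∃ Q : ℝ → ℝ, (∀ x, HasDerivAt Q (Z x) x) :=
    ⟨fun x => ∫ y in x0..x, Z y,
      fun x => (intervalIntegral.integral_hasDerivAt_right (cZ.intervalIntegrable _ _)
        (cZ.stronglyMeasurableAtFilter _ _) cZ.continuousAt)⟩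
  set E := fun x => Z x^4 + 6 * U x * Z x^2 + 4 * U1 x * Z x + 4 * r x - 3 * U x ^2 with hE
  set E1 := fun x => 4 * s x - 2 * U x * U1 x + 16 * Z x * r x - 12 * Z x * U x ^2
    + 6 * Z x^2 * U1 x + 4 * Z x^3 * U x with hE1
  set K := fun x => Z x^4 + 4 * Z x^2 * U x - U x ^2 + 2 * Z x * U1 x with hK
  have dE : ∀ x, HasDerivAt E (E1 x) x := fun x =>
    ((((((dZ x).pow 4).add (((dU x).const_mul 6).mul ((dZ x).pow 2))).add
      (((dU1 x).const_mul 4).mul (dZ x))).add ((dr x).const_mul 4)).sub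
      (((dU x).pow 2).const_mul 3)).congr_deriv (by simp [hE1]; ring)
  have dE1 : ∀ x, HasDerivAt E1 (4 * Z x * E1 x - (6 * U x + 10 * Z x^2) * E x
      + 10 * (U x + Z x^2) * K x) x := fun x =>
    (((((((ds x).const_mul 4).sub (((dU x).const_mul 2).mul (dU1 x))).add
      (((dZ x).const_mul 16).mul (dr x))).sub (((dZ x).const_mul 12).mul ((dU x).pow 2))).add
      ((((dZ x).pow 2).const_mul 6).mul (dU1 x))).add
      ((((dZ x).pow 3).const_mul 4).mul (dU x))).congr_deriv (by simp [hE1, hE, hK]; ring)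
  have dK : ∀ x, HasDerivAt K (-2 * Z x * K x + 2 * Z x * E x) x := fun x =>
    (((((dZ x).pow 4).add ((((dZ x).pow 2).const_mul 4).mul (dU x))).sub ((dU x).pow 2)).add
      (((dZ x).const_mul 2).mul (dU1 x))).congr_deriv (by simp [hE, hK]; ring)
  have hF := lem_gron (fun x => E x^2 + E1 x^2 + K x^2) _
    (fun x => 1 + 14 * |Z x| + |6 * U x + 10 * Z x^2| + 10 * |U x + Z x^2|)
    (by fun_prop) x0 (fun x => (((dE x).pow 2).add ((dE1 x).pow 2)).add ((dK x).pow 2)) ?_ ?_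
  · have z : ∀ x, E x = 0 ∧ K x = 0 := by
      intro x
      have h := hF x
      have q1 := sq_nonneg (E x)
      have q2 := sq_nonneg (E1 x)
      have q3 := sq_nonneg (K x)
      exact ⟨pow_eq_zero_iff two_ne_zero |>.mp (by linarith),
        pow_eq_zero_iff two_ne_zero |>.mp (by linarith)⟩
    have t0 : ∀ x, HasDerivAt (fun x => Real.exp (Q x)) (Z x * Real.exp (Q x)) x := fun x =>
      (dQ x).exp.congr_deriv (by ring)
    have t1 : ∀ x, HasDerivAt (fun x => Z x * Real.exp (Q x)) ((U x + Z x^2) * Real.exp (Q x)) x :=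
      fun x => ((dZ x).mul (t0 x)).congr_deriv (by ring)
    have t2 : ∀ x, HasDerivAt (fun x => (U x + Z x^2) * Real.exp (Q x))
        ((U1 x + 3 * U x * Z x + Z x^3) * Real.exp (Q x)) x :=
      fun x => (((dU x).add ((dZ x).pow 2)).mul (t0 x)).congr_deriv (by simp; ring)
    have t3 : ∀ x, HasDerivAt (fun x => (U1 x + 3 * U x * Z x + Z x^3) * Real.exp (Q x)) 0 x :=
      fun x => ((((dU1 x).add (((dU x).const_mul 3).mul (dZ x))).add ((dZ x).pow 3)).mul
        (t0 x)).congr_deriv (by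
          have := (z x).1
          simp only [hE] at this
          simp
          linear_combination Real.exp (Q x) * this)
    have c3 := lem_poscubic _ _ _ ((U1 0 + 3 * U 0 * Z 0 + Z 0^3) * Real.exp (Q 0))
      (fun x => Real.exp_pos (Q x)) t0 t1 (fun x => (t2 x).congr_deriv (lem_const t3 x 0))
    have t3z : ∀ x, U1 x + 3 * U x * Z x + Z x^3 = 0 := by
      intro x
      have := (lem_const t3 x 0).trans c3.1
      simpa [Real.exp_ne_zero] using this
    have t2z : ∀ x, U x + Z x^2 = 0 := by
      intro x
      have h1 := (z x).2
      have h2 := t3z x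
      simp only [hK] at h1
      have : (U x + Z x^2)^2 = 0 := by linear_combination -h1 + 2 * Z x * h2
      exact pow_eq_zero_iff two_ne_zero |>.mp this
    have t1z := c3.2 (fun x => by rw [t2z]; ring)
    have hZz : ∀ x, Z x = 0 := fun x => by simpa [Real.exp_ne_zero] using t1z x
    intro x
    have h1 := t3z x
    rw [hZz x] at h1
    linarith
  · intro x
    have q1 := sq_nonneg (E x)
    have q2 := sq_nonneg (E1 x)
    have q3 := sq_nonneg (K x)
    simp only [Nat.cast_ofNat, Nat.add_one_sub_one, pow_one]
    rw [abs_of_nonneg (show 0 ≤ E x^2 + E1 x^2 + K x^2 by positivity)]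
    generalize 6 * U x + 10 * Z x^2 = a
    generalize U x + Z x^2 = b
    have yg : ∀ p q : ℝ, 2 * |p * q| ≤ p^2 + q^2 := fun p q => by
      rw [abs_mul, ← sq_abs p, ← sq_abs q]; nlinarith [sq_nonneg (|p| - |q|)]
    have i1 := yg (E x) (E1 x)
    have i2 := yg (E1 x) (K x)
    have i3 := yg (K x) (E x)
    have e : 2 * E x * E1 x + 2 * E1 x * (4 * Z x * E1 x - a * E x + 10 * b * K x)
        + 2 * K x * (-2 * Z x * K x + 2 * Z x * E x) =
        2 * (E x * E1 x) + (8 * Z x) * E1 x^2 - (2 * a) * (E x * E1 x) + (20 * b) * (E1 x * K x)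
        - (4 * Z x) * K x^2 + (4 * Z x) * (K x * E x) := by ring
    rw [e]
    have : |2 * (E x * E1 x) + (8 * Z x) * E1 x^2 - (2 * a) * (E x * E1 x) + (20 * b) * (E1 x * K x)
        - (4 * Z x) * K x^2 + (4 * Z x) * (K x * E x)| ≤
        |2 * (E x * E1 x)| + |(8 * Z x) * E1 x^2| + |(2 * a) * (E x * E1 x)|
        + |(20 * b) * (E1 x * K x)| + |(4 * Z x) * K x^2| + |(4 * Z x) * (K x * E x)| := by
      refine (abs_add_le _ _).trans ?_
      gcongr
      refine (abs_sub _ _).trans ?_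
      gcongr
      refine (abs_add_le _ _).trans ?_
      gcongr
      refine (abs_sub _ _).trans ?_
      gcongr
      exact abs_add_le _ _
    refine this.trans ?_
    simp only [abs_mul, Nat.abs_ofNat, abs_pow, sq_abs] at i1 i2 i3 ⊢
    have z0 := abs_nonneg (Z x)
    have a0 := abs_nonneg a
    have b0 := abs_nonneg b
    have m1 := mul_le_mul_of_nonneg_left i1 a0
    have m2 := mul_le_mul_of_nonneg_left i2 b0
    have m3 := mul_le_mul_of_nonneg_left i3 z0
    linarith [mul_nonneg z0 q1, mul_nonneg z0 q2, mul_nonneg z0 q3, mul_nonneg a0 q3,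
      mul_nonneg b0 q1]
  · simp only [hE, hE1, hK, hZ]
    rw [hE0, hE10, hK0]
    norm_num

/-- Nonlinear Liouville theorem. -/
theorem lem_liou (U U1 r s : ℝ → ℝ) (τ c C : ℝ) (hτ : 0 ≤ τ)
    (dU : ∀ x, HasDerivAt U (U1 x) x)
    (dU1 : ∀ x, HasDerivAt U1 (4 * r x - 6 * U x ^ 2 - 60 * τ) x)
    (dr : ∀ x, HasDerivAt r (s x) x)
    (ds : ∀ x, HasDerivAt s (U1 x ^ 2 / 2 - 8 * U x * r x + 2 * U x ^ 3 + 60 * τ * U x - 60 * c) x)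
    (bU : ∀ x, |U x| ≤ C) (bU1 : ∀ x, |U1 x| ≤ C) (br : ∀ x, |r x| ≤ C) (bs : ∀ x, |s x| ≤ C) :
    ∀ x, U1 x = 0 := by
  have dp1 : ∀ x, HasDerivAt (fun x => U x * U1 x ^ 2 - 12 * U x ^2 * r x + 4 * U x ^4 +
      120 * τ * U x ^2 - 120 * c * U x + 4 * r x ^2 - 120 * τ * r x - 2 * U1 x * s x) 0 x := fun x =>
    (((((((((dU x).mul ((dU1 x).pow 2)).sub ((((dU x).pow 2).const_mul 12).mul (dr x))).add
      (((dU x).pow 4).const_mul 4)).add (((dU x).pow 2).const_mul (120 * τ))).sub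
      ((dU x).const_mul (120 * c))).add (((dr x).pow 2).const_mul 4)).sub
      ((dr x).const_mul (120 * τ))).sub (((dU1 x).const_mul 2).mul (ds x))).congr_deriv
      (by simp; ring)
  have dp0 : ∀ x, HasDerivAt (fun x => r x * U1 x ^2 - 8 * U x * r x ^2 + 4 * U x ^3 * r x +
      120 * τ * U x * r x - 120 * c * r x - s x ^2) 0 x := fun x =>
    (((((((dr x).mul ((dU1 x).pow 2)).sub (((dU x).const_mul 8).mul ((dr x).pow 2))).add
      ((((dU x).pow 3).const_mul 4).mul (dr x))).add
      (((dU x).const_mul (120 * τ)).mul (dr x))).sub ((dr x).const_mul (120 * c))).sub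
      ((ds x).pow 2)).congr_deriv (by simp; ring)
  obtain ⟨p1, hp1⟩ : ∃ p1, ∀ x, p1 = U x * U1 x ^ 2 - 12 * U x ^2 * r x + 4 * U x ^4 +
      120 * τ * U x ^2 - 120 * c * U x + 4 * r x ^2 - 120 * τ * r x - 2 * U1 x * s x :=
    ⟨_, fun x => lem_const dp1 0 x⟩
  obtain ⟨p0, hp0⟩ : ∃ p0, ∀ x, p0 = r x * U1 x ^2 - 8 * U x * r x ^2 + 4 * U x ^3 * r x +
      120 * τ * U x * r x - 120 * c * r x - s x ^2 := ⟨_, fun x => lem_const dp0 0 x⟩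
  rcases lem_quintic (30 * τ) (30 * c) (-p1/4) (-p0/4) (by positivity) with ⟨z, hz, h⟩ | ⟨h1, h2, h3, h4⟩
  · exact lem_liou_nonreal U U1 r s τ c C p1 p0 dU dU1 dr ds bU bU1 br bs
      (fun x => by rw [hp1 x]; ring) (fun x => by rw [hp0 x]; ring) z hz h
  · have hτ0 : τ = 0 := by linarith
    have hc0 : c = 0 := by linarith
    subst hτ0 hc0
    exact lem_liou_deg U U1 r s C dU (fun x => (dU1 x).congr_deriv (by ring)) dr
      (fun x => (ds x).congr_deriv (by ring)) bU bU1
      (fun x => by linarith [hp1 x]) (fun x => by linarith [hp0 x])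

/-! ### Limits along ultrafilters -/
open Filter Topology in
theorem ul_lim (l : Ultrafilter ℕ) (f : ℕ → ℝ) (C : ℝ) (h : ∀ᶠ n in (l : Filter ℕ), |f n| ≤ C) :
    ∃ a, Tendsto f l (𝓝 a) := by
  have h1 : (l.map f : Filter ℝ) ≤ 𝓟 (Set.Icc (-C) C) := by
    rw [le_principal_iff, Ultrafilter.coe_map, mem_map]
    filter_upwards [h] with n hn
    exact abs_le.mp hn
  obtain ⟨a, _, ha⟩ := isCompact_Icc.ultrafilter_le_nhds (l.map f) h1
  exact ⟨a, ha⟩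

theorem taylor_bd (f f1 f2 : ℝ → ℝ) (s h C : ℝ) (d0 : ∀ x, HasDerivAt f (f1 x) x)
    (d1 : ∀ x, HasDerivAt f1 (f2 x) x) (hb : ∀ x, |x - s| ≤ |h| → |f2 x| ≤ C) :
    |f (s + h) - f s - h * f1 s| ≤ C * |h| * |h| := by
  have conv : Convex ℝ (Metric.closedBall s |h|) := convex_closedBall _ _
  have mem : s + h ∈ Metric.closedBall s |h| := by simp [Real.dist_eq]
  have mem0 : s ∈ Metric.closedBall s |h| := by simp
  have b1 : ∀ y ∈ Metric.closedBall s |h|, ‖f1 y - f1 s‖ ≤ C * |h| := by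
    intro y hy
    have := conv.norm_image_sub_le_of_norm_hasDerivWithin_le (f := f1) (f' := f2) (C := C)
      (fun x _ => (d1 x).hasDerivWithinAt) (fun x hx => hb x (by simpa [Real.dist_eq] using hx)) mem0 hy
    refine this.trans ?_
    have hC : 0 ≤ C := (abs_nonneg _).trans (hb s (by simp))
    gcongr
    simpa [Real.dist_eq] using hy
  have := conv.norm_image_sub_le_of_norm_hasDerivWithin_le (f := fun y => f y - y * f1 s)
      (f' := fun y => f1 y - f1 s) (C := C * |h|)
      (fun x _ => (((d0 x).sub ((hasDerivAt_id x).mul_const (f1 s))).congr_deriv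
        (by simp)).hasDerivWithinAt) b1 mem0 mem
  simp only [Real.norm_eq_abs] at this
  rw [show f (s + h) - (s + h) * f1 s - (f s - s * f1 s) = f (s+h) - f s - h * f1 s by ring,
    show s + h - s = h by ring] at this
  exact this

open Filter Topology in
theorem deriv_of_quad (g : ℝ → ℝ) (g1 s C : ℝ)
    (h : ∀ t, |t| ≤ 1 → |g (s + t) - g s - t * g1| ≤ C * |t| * |t|) : HasDerivAt g g1 s := by
  rw [hasDerivAt_iff_isLittleO_nhds_zero]
  have h1 : (fun t => g (s + t) - g s - t • g1) =O[𝓝 0] fun t : ℝ => t^2 := by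
    apply Asymptotics.IsBigO.of_bound C
    have : ∀ᶠ t : ℝ in 𝓝 0, |t| ≤ 1 := by
      filter_upwards [Metric.ball_mem_nhds (0:ℝ) one_pos] with t ht
      have : |t| < 1 := by simpa using ht
      exact this.le
    filter_upwards [this] with t ht
    have := h t ht
    simp only [smul_eq_mul, Real.norm_eq_abs, abs_pow]
    linarith [sq |t|]
  have h2 : (fun t : ℝ => t^2) =o[𝓝 0] fun t : ℝ => t := by
    simpa using Asymptotics.isLittleO_pow_pow (𝕜 := ℝ) (m := 1) (n := 2) (by norm_num)
  exact h1.trans_isLittleO h2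

open Filter Topology in
theorem ul_deriv (l : Filter ℕ) [l.NeBot] (f f1 f2 : ℕ → ℝ → ℝ) (g g1 : ℝ → ℝ)
    (d0 : ∀ n x, HasDerivAt (f n) (f1 n x) x) (d1 : ∀ n x, HasDerivAt (f1 n) (f2 n x) x)
    (t0 : ∀ s, Tendsto (fun n => f n s) l (𝓝 (g s)))
    (t1 : ∀ s, Tendsto (fun n => f1 n s) l (𝓝 (g1 s)))
    (hb : ∀ R : ℝ, ∃ C, ∀ᶠ n in l, ∀ s, |s| ≤ R → |f2 n s| ≤ C) :
    ∀ s, HasDerivAt g (g1 s) s := by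
  intro s
  obtain ⟨C, hC⟩ := hb (|s| + 1)
  apply deriv_of_quad g (g1 s) s C
  intro t ht
  have h1 : Tendsto (fun n => |f n (s + t) - f n s - t * f1 n s|) l
      (𝓝 |g (s + t) - g s - t * g1 s|) :=
    (((t0 (s+t)).sub (t0 s)).sub ((t1 s).const_mul t)).abs
  refine le_of_tendsto h1 ?_
  filter_upwards [hC] with n hn
  apply taylor_bd (f n) (f1 n) (f2 n) s t C (d0 n) (d1 n)
  intro x hx
  apply hn
  have : |x| ≤ |x - s| + |s| := by simpa using abs_add_le (x - s) s
  linarith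

open Filter Topology in
theorem ul_chain (l : Ultrafilter ℕ) (z : ℕ → ℕ → ℝ → ℝ)
    (d : ∀ n k, k ≤ 4 → ∀ s, HasDerivAt (z n k) (z n (k+1) s) s)
    (hb : ∀ R : ℝ, ∃ C, ∀ᶠ n in (l : Filter ℕ), ∀ s, |s| ≤ R → ∀ k, k ≤ 5 → |z n k s| ≤ C) :
    ∃ y : ℕ → ℝ → ℝ, (∀ k ≤ 4, ∀ s, Tendsto (fun n => z n k s) l (𝓝 (y k s))) ∧
      ∀ k ≤ 3, ∀ s, HasDerivAt (y k) (y (k+1) s) s := by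
  have : ∀ k s, ∃ a, k ≤ 5 → Tendsto (fun n => z n k s) l (𝓝 a) := by
    intro k s
    obtain ⟨C, hC⟩ := hb |s|
    by_cases hk : k ≤ 5
    · obtain ⟨a, ha⟩ := ul_lim l (fun n => z n k s) C (by
        filter_upwards [hC] with n hn using hn s le_rfl k hk)
      exact ⟨a, fun _ => ha⟩
    · exact ⟨0, fun h => absurd h hk⟩
  choose y hy using this
  refine ⟨y, fun k hk s => hy k s (by omega), fun k hk => ?_⟩
  apply ul_deriv l (fun n => z n k) (fun n => z n (k+1)) (fun n => z n (k+2)) (y k) (y (k+1))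
    (fun n => d n k (by omega)) (fun n => d n (k+1) (by omega))
    (fun s => hy k s (by omega)) (fun s => hy (k+1) s (by omega))
  intro R
  obtain ⟨C, hC⟩ := hb R
  exact ⟨C, by filter_upwards [hC] with n hn s hs using hn s hs (k+2) (by omega)⟩

theorem bd_add {a b A B : ℝ} (ha : |a| ≤ A) (hb : |b| ≤ B) : |a + b| ≤ A + B :=
  (abs_add_le _ _).trans (add_le_add ha hb)
theorem bd_sub {a b A B : ℝ} (ha : |a| ≤ A) (hb : |b| ≤ B) : |a - b| ≤ A + B :=
  (abs_sub _ _).trans (add_le_add ha hb)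
theorem bd_mul {a b A B : ℝ} (ha : |a| ≤ A) (hb : |b| ≤ B) : |a * b| ≤ A * B := by
  rw [abs_mul]; exact mul_le_mul ha hb (abs_nonneg _) ((abs_nonneg _).trans ha)
theorem bd_c {a A : ℝ} (c : ℝ) (hc : 0 ≤ c) (ha : |a| ≤ A) : |c * a| ≤ c * A := by
  rw [abs_mul, abs_of_nonneg hc]; exact mul_le_mul_of_nonneg_left ha hc

open Filter Topology in
/-- Rescaling limits of solutions are constant. -/
theorem lem_lim (u : ℕ → ℝ → ℝ → ℝ) (hu : ∀ k X T, HasDerivAt (fun x => u k x T) (u (k+1) X T) X)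
    (h4 : ∀ X T, u 4 X T = -10 * u 1 X T^2 - 20 * u 0 X T * u 2 X T - 40 * u 0 X T^3
      + 240 * T * u 0 X T - 240 * X)
    (h5 : ∀ X T, u 5 X T = -40 * u 1 X T * u 2 X T - 20 * u 0 X T * u 3 X T
      - 120 * u 0 X T^2 * u 1 X T + 240 * T * u 1 X T - 240)
    (l : Ultrafilter ℕ) (x t m : ℕ → ℝ) (τ c C : ℝ) (hτ : 0 ≤ τ) (hm0 : ∀ n, 0 < m n)
    (hm : Tendsto m l atTop) (ht : Tendsto (fun n => t n / m n^4) l (𝓝 (-τ)))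
    (hx : Tendsto (fun n => x n / m n^6) l (𝓝 c))
    (hb : ∀ R : ℝ, ∀ᶠ n in (l : Filter ℕ), ∀ s, |s| ≤ R → ∀ k ≤ 3,
      |u k (x n + s / m n) (t n)| ≤ C * m n^(k+2)) :
    ∃ a, 40 * a^3 + 240 * τ * a + 240 * c = 0 ∧
      (∀ s, Tendsto (fun n => u 0 (x n + s / m n) (t n) / m n^2) l (𝓝 a)) ∧
      ∀ k, 1 ≤ k → k ≤ 3 → ∀ s, Tendsto (fun n => u k (x n + s / m n) (t n) / m n^(k+2)) l (𝓝 0) := by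
  set z : ℕ → ℕ → ℝ → ℝ := fun n k s => u k (x n + s / m n) (t n) / m n^(k+2) with hz
  have dz : ∀ n k, k ≤ 4 → ∀ s, HasDerivAt (z n k) (z n (k+1) s) s := by
    intro n k _ s
    have hmn := (hm0 n).ne'
    have h1 : HasDerivAt (fun s => x n + s / m n) (1 / m n) s :=
      ((hasDerivAt_id s).div_const (m n)).const_add (x n)
    have h2 := ((hu k (x n + s / m n) (t n)).comp s h1).div_const (m n^(k+2))
    refine h2.congr_deriv ?_
    simp only [hz]
    field_simp
    ring
  have z4 : ∀ n s, z n 4 s = -10 * (z n 1 s * z n 1 s) - 20 * (z n 0 s * z n 2 s)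
      - 40 * (z n 0 s * (z n 0 s * z n 0 s)) + 240 * ((t n / m n^4) * z n 0 s)
      - 240 * (x n / m n^6 + s / m n * (1 / m n^6)) := by
    intro n s
    have hmn := (hm0 n).ne'
    simp only [hz]
    rw [h4]
    field_simp
    ring
  have z5 : ∀ n s, z n 5 s = -40 * (z n 1 s * z n 2 s) - 20 * (z n 0 s * z n 3 s)
      - 120 * ((z n 0 s * z n 0 s) * z n 1 s) + 240 * ((t n / m n^4) * z n 1 s)
      - 240 * (1 / m n * (1 / m n^6)) := by
    intro n s
    have hmn := (hm0 n).ne'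
    simp only [hz]
    rw [h5]
    field_simp
    ring
  have hm1 : ∀ᶠ n in (l : Filter ℕ), 1 ≤ m n := hm.eventually_ge_atTop 1
  have zb : ∀ R : ℝ, ∀ᶠ n in (l : Filter ℕ), ∀ s, |s| ≤ R → ∀ k ≤ 3, |z n k s| ≤ C := by
    intro R
    filter_upwards [hb R] with n hn s hs k hk
    simp only [hz]
    rw [abs_div, abs_of_pos (pow_pos (hm0 n) _), div_le_iff₀ (pow_pos (hm0 n) _)]
    exact hn s hs k hk
  have hC0 : 0 ≤ C := by
    obtain ⟨n, hn⟩ := (zb 0).exists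
    exact (abs_nonneg _).trans (hn 0 (by simp) 0 (by norm_num))
  have tb : ∀ᶠ n in (l : Filter ℕ), |t n / m n^4| ≤ τ + 1 := by
    have := ht.abs.eventually_le_const (show |-τ| < τ + 1 by rw [abs_neg, abs_of_nonneg hτ]; linarith)
    exact this
  have xb : ∀ᶠ n in (l : Filter ℕ), |x n / m n^6| ≤ |c| + 1 :=
    hx.abs.eventually_le_const (by linarith)
  obtain ⟨y, hy, dy⟩ := ul_chain l z dz (by
    intro R
    refine ⟨C + (10 * (C * C) + 20 * (C * C) + 40 * (C * (C * C)) + 240 * ((τ + 1) * C)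
      + 240 * (|c| + 1 + |R| * 1)) + (40 * (C * C) + 20 * (C * C) + 120 * ((C * C) * C)
      + 240 * ((τ+1) * C) + 240 * (1 * 1)), ?_⟩
    filter_upwards [zb R, tb, xb, hm1] with n h1 h2 h3 h4 s hs k hk
    have hmi : |1 / m n^6| ≤ 1 := by
      rw [abs_of_pos (by positivity)]
      rw [div_le_one (by positivity)]
      exact one_le_pow₀ h4
    have hmi1 : |1 / m n| ≤ 1 := by
      rw [abs_of_pos (by positivity)]
      rw [div_le_one (by positivity)]
      exact h4
    have hsm : |s / m n| ≤ |R| := by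
      rw [abs_div, abs_of_pos (hm0 n)]
      exact (div_le_self (abs_nonneg _) h4).trans (hs.trans (le_abs_self _))
    have q0 := h1 s hs 0 (by norm_num)
    have q1 := h1 s hs 1 (by norm_num)
    have q2 := h1 s hs 2 (by norm_num)
    have q3 := h1 s hs 3 (by norm_num)
    have P4 : |z n 4 s| ≤ 10 * (C * C) + 20 * (C * C) + 40 * (C * (C * C)) + 240 * ((τ + 1) * C)
      + 240 * (|c| + 1 + |R| * 1) := by
      rw [z4, neg_mul]
      refine bd_sub (bd_add (bd_sub (bd_sub ?_ (bd_c _ (by norm_num) (bd_mul q0 q2)))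
        (bd_c _ (by norm_num) (bd_mul q0 (bd_mul q0 q0)))) (bd_c _ (by norm_num) (bd_mul h2 q0)))
        (bd_c _ (by norm_num) (bd_add h3 (bd_mul hsm hmi)))
      rw [abs_neg]
      exact bd_c _ (by norm_num) (bd_mul q1 q1)
    have P5 : |z n 5 s| ≤ 40 * (C * C) + 20 * (C * C) + 120 * ((C * C) * C)
      + 240 * ((τ+1) * C) + 240 * (1 * 1) := by
      rw [z5, neg_mul]
      refine bd_sub (bd_add (bd_sub (bd_sub ?_ (bd_c _ (by norm_num) (bd_mul q0 q3)))
        (bd_c _ (by norm_num) (bd_mul (bd_mul q0 q0) q1))) (bd_c _ (by norm_num) (bd_mul h2 q1)))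
        (bd_c _ (by norm_num) (bd_mul hmi1 hmi))
      rw [abs_neg]
      exact bd_c _ (by norm_num) (bd_mul q1 q2)
    have n4 := (abs_nonneg _).trans P4
    have n5 := (abs_nonneg _).trans P5
    rcases Nat.lt_or_ge k 4 with h | h
    · have := h1 s hs k (by omega)
      linarith
    · have : k = 4 ∨ k = 5 := by omega
      rcases this with rfl | rfl <;> linarith)
  have inv0 : Tendsto (fun n => 1 / m n) l (𝓝 0) := by
    have := hm.inv_tendsto_atTop
    exact this.congr (fun n => by simp)
  have y4 : ∀ s, y 4 s = -10 * (y 1 s * y 1 s) - 20 * (y 0 s * y 2 s)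
      - 40 * (y 0 s * (y 0 s * y 0 s)) + 240 * (-τ * y 0 s) - 240 * (c + (s * 0) * 0^6) := by
    intro s
    have h0 := hy 0 (by norm_num) s
    have h1 := hy 1 (by norm_num) s
    have h2 := hy 2 (by norm_num) s
    refine tendsto_nhds_unique (hy 4 (by norm_num) s) ?_
    have := (((((h1.mul h1).const_mul (-10)).sub ((h0.mul h2).const_mul 20)).sub
      ((h0.mul (h0.mul h0)).const_mul 40)).add ((ht.mul h0).const_mul 240)).sub
      ((hx.add ((inv0.const_mul s).mul (inv0.pow 6))).const_mul 240)
    refine this.congr (fun n => ?_)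
    rw [z4]
    simp [div_eq_mul_inv]
  have yb : ∀ k ≤ 3, ∀ s, |y k s| ≤ C := by
    intro k hk s
    refine le_of_tendsto (hy k (by omega) s).abs ?_
    filter_upwards [zb |s|] with n hn using hn s le_rfl k hk
  have hy1 := lem_liou (y 0) (y 1) (fun s => y 2 s / 4 + 3 / 2 * (y 0 s * y 0 s) + 15 * τ)
    (fun s => y 3 s / 4 + 3 * (y 0 s * y 1 s)) τ c (C + (C/4 + 3/2 * (C * C) + 15 * τ) +
      (C/4 + 3 * (C * C))) hτ (dy 0 (by norm_num))
    (fun s => (dy 1 (by norm_num) s).congr_deriv (by ring))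
    (fun s => ((((dy 2 (by norm_num) s).div_const 4).add
      (((dy 0 (by norm_num) s).mul (dy 0 (by norm_num) s)).const_mul (3/2))).add_const (15 * τ)
      ).congr_deriv (by simp; ring))
    (fun s => (((dy 3 (by norm_num) s).div_const 4).add
      (((dy 0 (by norm_num) s).mul (dy 1 (by norm_num) s)).const_mul 3)).congr_deriv (by
        simp only [zero_add, Nat.reduceAdd]; rw [y4]; ring))
    (fun s => (yb 0 (by norm_num) s).trans (by nlinarith))
    (fun s => (yb 1 (by norm_num) s).trans (by nlinarith))
    (fun s => by
      have q4 : |y 2 s / 4| ≤ C/4 := by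
        rw [abs_div]; have := yb 2 (by norm_num) s; norm_num; linarith
      refine (bd_add (bd_add q4 (bd_c _ (by norm_num) (bd_mul (yb 0 (by norm_num) s)
        (yb 0 (by norm_num) s)))) (abs_of_nonneg (show 0 ≤ 15 * τ by positivity)).le).trans ?_
      nlinarith)
    (fun s => by
      have q4 : |y 3 s / 4| ≤ C/4 := by
        rw [abs_div]; have := yb 3 (by norm_num) s; norm_num; linarith
      refine (bd_add q4 (bd_c _ (by norm_num) (bd_mul (yb 0 (by norm_num) s)
        (yb 1 (by norm_num) s)))).trans ?_
      nlinarith)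
  have nxt : ∀ k ≤ 3, (∀ s, y k s = 0) → ∀ s, y (k+1) s = 0 := by
    intro k hk h s
    have h1 := dy k hk s
    rw [show y k = fun _ => 0 from funext h] at h1
    exact h1.unique (hasDerivAt_const s 0)
  have hy2 := nxt 1 (by norm_num) hy1
  have hy3 := nxt 2 (by norm_num) hy2
  have hy4 := nxt 3 (by norm_num) hy3
  have hy0 : ∀ s, y 0 s = y 0 0 := fun s =>
    lem_const (f := y 0) (fun x => (dy 0 (by norm_num) x).congr_deriv (hy1 x)) s 0
  refine ⟨y 0 0, ?_, fun s => ?_, ?_⟩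
  · have e := y4 0
    have e4 : y 4 0 = 0 := hy4 0
    rw [e4, hy1 0] at e
    have e2 : y 2 0 = 0 := hy2 0
    rw [e2] at e
    linarith
  · have := hy 0 (by norm_num) s
    rw [hy0 s] at this
    exact this
  · intro k hk1 hk3 s
    have hk : k = 1 ∨ k = 2 ∨ k = 3 := by omega
    rcases hk with rfl | rfl | rfl
    · have := hy 1 (by norm_num) s
      rw [hy1 s] at this
      exact this
    · have := hy 2 (by norm_num) s
      rw [hy2 s] at this
      exact this
    · have := hy 3 (by norm_num) s
      rw [hy3 s] at this
      exact this

/-! ### The scale function and the a priori bound -/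

noncomputable def muf (X T : ℝ) : ℝ := (1 + X^2 + |T|^3) ^ (((12:ℕ):ℝ)⁻¹)

theorem muf_pow (X T : ℝ) : muf X T ^ 12 = 1 + X^2 + |T|^3 :=
  Real.rpow_inv_natCast_pow (by positivity) (by norm_num)

theorem muf_pos (X T : ℝ) : 0 < muf X T := Real.rpow_pos_of_pos (by positivity) _

theorem muf_ge_one (X T : ℝ) : 1 ≤ muf X T := by
  apply Real.one_le_rpow _ (by positivity)
  have : 0 ≤ X^2 + |T|^3 := by positivity
  linarith

theorem muf_X (X T : ℝ) : |X| ≤ muf X T ^ 6 := by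
  have h := muf_pow X T
  have h2 : |X|^2 ≤ (muf X T^6)^2 := by
    rw [← pow_mul, h, sq_abs]; have : 0 ≤ |T|^3 := by positivity
    linarith
  exact (pow_le_pow_iff_left₀ (abs_nonneg _) (pow_pos (muf_pos X T) 6).le two_ne_zero).mp h2

theorem muf_T (X T : ℝ) : |T| ≤ muf X T ^ 4 := by
  have h := muf_pow X T
  have h2 : |T|^3 ≤ (muf X T^4)^3 := by
    rw [← pow_mul, h]; have : 0 ≤ X^2 := by positivity
    linarith
  exact (pow_le_pow_iff_left₀ (abs_nonneg _) (pow_pos (muf_pos X T) 4).le three_ne_zero).mp h2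

theorem muf_near (X y T : ℝ) (hy : |y| ≤ 1) : muf (X + y) T ≤ 2 * muf X T := by
  have h : muf (X + y) T ^ 12 ≤ (2 * muf X T)^12 := by
    rw [mul_pow, muf_pow, muf_pow]
    have h1 : y^2 ≤ 1 := by rw [← sq_abs]; nlinarith [abs_nonneg y]
    have h2 : 0 ≤ |T|^3 := by positivity
    nlinarith [sq_nonneg (X - y), sq_nonneg X]
  exact (pow_le_pow_iff_left₀ (muf_pos _ _).le (by have := muf_pos X T; positivity)
    (by norm_num)).mp h

theorem muf_cont : Continuous (fun p : ℝ × ℝ => muf p.1 p.2) := by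
  unfold muf
  apply Continuous.rpow_const (by fun_prop)
  intro p; right; positivity

noncomputable def Mf (u : ℕ → ℝ → ℝ → ℝ) (X T : ℝ) : ℝ :=
  ∑ k ∈ Finset.range 4, |u k X T| ^ (((k+2:ℕ):ℝ)⁻¹)

theorem Mf_bd (u : ℕ → ℝ → ℝ → ℝ) (X T : ℝ) (k : ℕ) (hk : k ≤ 3) : |u k X T| ≤ Mf u X T ^ (k+2) := by
  have h1 : |u k X T| ^ (((k+2:ℕ):ℝ)⁻¹) ≤ Mf u X T :=
    Finset.single_le_sum (f := fun k => |u k X T| ^ (((k+2:ℕ):ℝ)⁻¹))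
      (fun i _ => by positivity) (Finset.mem_range.mpr (by omega))
  have h2 := pow_le_pow_left₀ (by positivity) h1 (k+2)
  rwa [Real.rpow_inv_natCast_pow (abs_nonneg _) (by omega)] at h2

theorem Mf_nonneg (u : ℕ → ℝ → ℝ → ℝ) (X T : ℝ) : 0 ≤ Mf u X T :=
  Finset.sum_nonneg (fun i _ => by positivity)

open Filter Topology in
theorem lem_apriori (u : ℕ → ℝ → ℝ → ℝ) (hu : ∀ k X T, HasDerivAt (fun x => u k x T) (u (k+1) X T) X)
    (h4 : ∀ X T, u 4 X T = -10 * u 1 X T^2 - 20 * u 0 X T * u 2 X T - 40 * u 0 X T^3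
      + 240 * T * u 0 X T - 240 * X)
    (h5 : ∀ X T, u 5 X T = -40 * u 1 X T * u 2 X T - 20 * u 0 X T * u 3 X T
      - 120 * u 0 X T^2 * u 1 X T + 240 * T * u 1 X T - 240) :
    ∃ C, 0 < C ∧ ∀ X T, ∀ k ≤ 3, |u k X T| ≤ C * muf X T ^ (k+2) := by
  suffices h : ∃ n : ℕ, ∀ X T, Mf u X T ≤ n * muf X T by
    obtain ⟨n, hn⟩ := h
    refine ⟨((n:ℝ)+1)^5, by positivity, fun X T k hk => ?_⟩
    have hmu := muf_pos X T
    calc |u k X T| ≤ Mf u X T ^ (k+2) := Mf_bd u X T k hk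
      _ ≤ (((n:ℝ)+1) * muf X T)^(k+2) := by
          apply pow_le_pow_left₀ (Mf_nonneg _ _ _)
          have := hn X T
          nlinarith
      _ = ((n:ℝ)+1)^(k+2) * muf X T^(k+2) := mul_pow _ _ _
      _ ≤ _ := by
          gcongr
          · have : (0:ℝ) ≤ n := Nat.cast_nonneg n
            linarith
          · omega
  by_contra hcon
  push Not at hcon
  choose X T hXT using hcon
  have cu : ∀ k T, Continuous (fun x => u k x T) := fun k T =>
    continuous_iff_continuousAt.mpr fun x => (hu k x T).continuousAt
  have cM : ∀ T, Continuous (fun x => Mf u x T) := by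
    intro T
    unfold Mf
    apply continuous_finsetSum
    intro k _
    exact (cu k T).abs.rpow_const (fun _ => Or.inr (by positivity))
  have hmax : ∀ n, ∃ x, 0 ≤ 1 - |x - X n| ∧ ∀ y, 0 ≤ 1 - |y - X n| →
      (1 - |y - X n|) * Mf u y (T n) ≤ (1 - |x - X n|) * Mf u x (T n) := by
    intro n
    obtain ⟨x, hx, hm⟩ := (isCompact_closedBall (X n) 1).exists_isMaxOn ⟨X n, by simp⟩
      (f := fun y => (1 - |y - X n|) * Mf u y (T n)) (by
        have := cM (T n)
        fun_prop)
    refine ⟨x, ?_, fun y hy => hm ?_⟩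
    · have : |x - X n| ≤ 1 := by simpa [Real.dist_eq] using hx
      linarith
    · have : |y - X n| ≤ 1 := by linarith
      simpa [Real.dist_eq] using this
  choose x hx0 hx using hmax
  set m := fun n => Mf u (x n) (T n) with hm
  have hdm : ∀ n : ℕ, (n:ℝ) * muf (X n) (T n) < (1 - |x n - X n|) * m n := by
    intro n
    have := hx n (X n) (by simp)
    simp only [sub_self, abs_zero, sub_zero, one_mul] at this
    exact (hXT n).trans_le this
  have hmn : ∀ n : ℕ, (n:ℝ) * muf (X n) (T n) < m n := by
    intro n
    have h1 := hdm n
    have h2 := abs_nonneg (x n - X n)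
    have h3 : 0 ≤ m n := Mf_nonneg _ _ _
    nlinarith
  have hm0 : ∀ n, 0 < m n := fun n =>
    lt_of_le_of_lt (mul_nonneg (Nat.cast_nonneg n) (muf_pos _ _).le) (hmn n)
  have hnm : ∀ n : ℕ, (n:ℝ) ≤ m n := fun n => by
    have h1 := hmn n
    have h2 := muf_ge_one (X n) (T n)
    have h3 : (0:ℝ) ≤ n := Nat.cast_nonneg n
    nlinarith
  set l : Ultrafilter ℕ := Filter.hyperfilter ℕ with hl
  have hle : (l : Filter ℕ) ≤ atTop := Nat.hyperfilter_le_atTop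
  have hmt : Tendsto m l atTop := (tendsto_atTop_mono hnm tendsto_natCast_atTop_atTop).mono_left hle
  have sq0 : ∀ (f : ℕ → ℝ) (C : ℝ), (∀ n : ℕ, 1 ≤ n → |f n| * n ≤ C) → Tendsto f l (𝓝 0) := by
    intro f C h
    have h1 : Tendsto (fun n : ℕ => C / (n:ℝ)) atTop (𝓝 0) := tendsto_const_div_atTop_nhds_zero_nat C
    refine (squeeze_zero_norm' ?_ h1).mono_left hle
    filter_upwards [eventually_ge_atTop 1] with n hn
    rw [le_div_iff₀ (by exact_mod_cast hn)]
    exact h n hn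
  have npow : ∀ (n : ℕ) (k : ℕ), 1 ≤ n → 1 ≤ k → (n:ℝ) * muf (X n) (T n)^k ≤ m n^k := by
    intro n k hn hk
    have h1 : (1:ℝ) ≤ n := by exact_mod_cast hn
    calc (n:ℝ) * muf (X n) (T n)^k ≤ (n:ℝ)^k * muf (X n) (T n)^k := by
          gcongr
          · have := muf_pos (X n) (T n); positivity
          · exact le_self_pow₀ h1 (by omega)
      _ = ((n:ℝ) * muf (X n) (T n))^k := (mul_pow _ _ _).symm
      _ ≤ _ := pow_le_pow_left₀ (mul_nonneg (Nat.cast_nonneg n) (muf_pos _ _).le) (hmn n).le k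
  obtain ⟨a, ha, h0, hk⟩ := lem_lim u hu h4 h5 l x T m 0 0 32 le_rfl hm0 hmt
    (by
      rw [neg_zero]
      apply sq0 _ 1
      intro n hn
      rw [abs_div, abs_of_pos (pow_pos (hm0 n) 4), div_mul_eq_mul_div,
        div_le_one (pow_pos (hm0 n) 4)]
      have h1 := muf_T (X n) (T n)
      have h2 := npow n 4 hn (by norm_num)
      have h3 : (0:ℝ) ≤ n := Nat.cast_nonneg n
      nlinarith)
    (by
      apply sq0 _ 2
      intro n hn
      rw [abs_div, abs_of_pos (pow_pos (hm0 n) 6), div_mul_eq_mul_div,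
        div_le_iff₀ (pow_pos (hm0 n) 6)]
      have h1 := muf_X (X n) (T n)
      have h2 := npow n 6 hn (by norm_num)
      have h3 : (0:ℝ) ≤ n := Nat.cast_nonneg n
      have h4 : |x n| ≤ |x n - X n| + |X n| := by simpa using abs_add_le (x n - X n) (X n)
      have h5 := hx0 n
      have h6 : 1 ≤ muf (X n) (T n)^6 := one_le_pow₀ (muf_ge_one _ _)
      nlinarith)
    (by
      intro R
      have : ∀ᶠ n : ℕ in (l : Filter ℕ), 2 * R ≤ n :=
        (tendsto_natCast_atTop_atTop.mono_left hle).eventually_ge_atTop (2 * R)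
      filter_upwards [this] with n hn s hs k hk
      set y := s / m n with hy
      have hym : |y| * m n ≤ R := by
        rw [hy, abs_div, abs_of_pos (hm0 n), div_mul_cancel₀ _ (hm0 n).ne']; exact hs
      set dd := 1 - |x n - X n| with hdd
      have h1 : 2 * R ≤ dd * m n := by
        have h1 := hdm n
        have h2 := muf_ge_one (X n) (T n)
        have h3 : (0:ℝ) ≤ n := Nat.cast_nonneg n
        nlinarith
      have h2 : |y| ≤ dd / 2 := by
        have : |y| * m n ≤ (dd / 2) * m n := by linarith
        exact le_of_mul_le_mul_right this (hm0 n)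
      have h3 : dd / 2 ≤ 1 - |x n + y - X n| := by
        have : |x n + y - X n| ≤ |x n - X n| + |y| := by
          rw [show x n + y - X n = (x n - X n) + y by ring]; exact abs_add_le _ _
        rw [hdd] at h2 ⊢
        linarith
      have hdpos : 0 < dd := by
        have h1 := hdm n
        have h2 : 0 ≤ (n:ℝ) * muf (X n) (T n) := mul_nonneg (Nat.cast_nonneg n) (muf_pos _ _).le
        have h3 : 0 < dd * m n := lt_of_le_of_lt h2 h1
        exact (pos_iff_pos_of_mul_pos h3).mpr (hm0 n)
      have h4 := hx n (x n + y) (by linarith)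
      have hM0 := Mf_nonneg u (x n + y) (T n)
      have h5 : dd / 2 * Mf u (x n + y) (T n) ≤ dd / 2 * (2 * m n) := by
        have : dd / 2 * Mf u (x n + y) (T n) ≤ (1 - |x n + y - X n|) * Mf u (x n + y) (T n) :=
          mul_le_mul_of_nonneg_right h3 hM0
        calc _ ≤ _ := this
          _ ≤ _ := h4
          _ = _ := by simp only [hm, hdd]; ring
      have h6 : Mf u (x n + y) (T n) ≤ 2 * m n := le_of_mul_le_mul_left h5 (by linarith)
      calc |u k (x n + y) (T n)| ≤ Mf u (x n + y) (T n)^(k+2) := Mf_bd _ _ _ _ hk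
        _ ≤ (2 * m n)^(k+2) := pow_le_pow_left₀ hM0 h6 _
        _ = 2^(k+2) * m n^(k+2) := mul_pow _ _ _
        _ ≤ 2^5 * m n^(k+2) := by
            have := hm0 n
            gcongr
            · norm_num
            · omega
        _ = 32 * m n^(k+2) := by norm_num)
  have ha0 : a = 0 := by
    have : a^3 = 0 := by linarith
    exact pow_eq_zero_iff three_ne_zero |>.mp this
  have hall : ∀ k ≤ 3, Tendsto (fun n => u k (x n) (T n) / m n^(k+2)) l (𝓝 0) := by
    intro k hk3
    rcases Nat.eq_zero_or_pos k with rfl | hk1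
    · have := h0 0
      simpa [ha0] using this
    · have := hk k hk1 hk3 0
      simpa using this
  have hsum : Tendsto (fun n => ∑ k ∈ Finset.range 4,
      |u k (x n) (T n) / m n^(k+2)| ^ (((k+2:ℕ):ℝ)⁻¹)) l (𝓝 (∑ k ∈ Finset.range 4, 0)) := by
    apply tendsto_finsetSum
    intro k hk
    have h1 := (hall k (by have := Finset.mem_range.mp hk; omega)).abs
    have h2 := h1.rpow_const (p := (((k+2:ℕ):ℝ)⁻¹)) (Or.inr (by positivity))
    rwa [abs_zero, Real.zero_rpow (by positivity)] at h2
  have heq : ∀ n, ∑ k ∈ Finset.range 4,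
      |u k (x n) (T n) / m n^(k+2)| ^ (((k+2:ℕ):ℝ)⁻¹) = 1 := by
    intro n
    have : ∀ k ∈ Finset.range 4, |u k (x n) (T n) / m n^(k+2)| ^ (((k+2:ℕ):ℝ)⁻¹) =
        |u k (x n) (T n)| ^ (((k+2:ℕ):ℝ)⁻¹) / m n := by
      intro k _
      rw [abs_div, abs_of_pos (pow_pos (hm0 n) _), Real.div_rpow (abs_nonneg _) (pow_pos (hm0 n) _).le,
        Real.pow_rpow_inv_natCast (hm0 n).le (by omega)]
    rw [Finset.sum_congr rfl this, ← Finset.sum_div]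
    exact div_self (hm0 n).ne'
  simp only [heq, Finset.sum_const_zero] at hsum
  exact one_ne_zero (tendsto_nhds_unique tendsto_const_nhds hsum)

/-! ### Linearized equation -/

structure USol (u : ℕ → ℝ → ℝ → ℝ) : Prop where
  hu : ∀ k X T, HasDerivAt (fun x => u k x T) (u (k+1) X T) X
  h4 : ∀ X T, u 4 X T = -10 * u 1 X T^2 - 20 * u 0 X T * u 2 X T - 40 * u 0 X T^3
      + 240 * T * u 0 X T - 240 * X
  h5 : ∀ X T, u 5 X T = -40 * u 1 X T * u 2 X T - 20 * u 0 X T * u 3 X T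
      - 120 * u 0 X T^2 * u 1 X T + 240 * T * u 1 X T - 240

structure LinSol (u : ℕ → ℝ → ℝ → ℝ) (t t' ε : ℝ) (v : ℕ → ℝ → ℝ) : Prop where
  hd : ∀ k ≤ 4, ∀ X, HasDerivAt (v k) (v (k+1) X) X
  h4 : ∀ X, v 4 X = -10 * ((u 1 X t' + u 1 X t) * v 1 X)
    - 20 * (u 0 X t' * v 2 X + u 2 X t * v 0 X)
    - 40 * ((u 0 X t' * u 0 X t' + u 0 X t' * u 0 X t + u 0 X t * u 0 X t) * v 0 X)
    + 240 * (t * v 0 X) + 240 * (ε * u 0 X t')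
  h5 : ∀ X, v 5 X = -40 * (u 1 X t' * v 2 X + u 2 X t * v 1 X)
    - 20 * (u 0 X t' * v 3 X + u 3 X t * v 0 X)
    - 120 * (u 0 X t' * u 0 X t' * v 1 X + (u 0 X t' + u 0 X t) * u 1 X t * v 0 X)
    + 240 * (t * v 1 X) + 240 * (ε * u 1 X t')

noncomputable def Nv (v : ℕ → ℝ → ℝ) (T X : ℝ) : ℝ :=
  ∑ k ∈ Finset.range 4, |v k X| / muf X T ^ k

theorem Nv_nonneg (v : ℕ → ℝ → ℝ) (T X : ℝ) : 0 ≤ Nv v T X :=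
  Finset.sum_nonneg fun k _ => div_nonneg (abs_nonneg _) (pow_pos (muf_pos _ _) _).le

theorem Nv_bd (v : ℕ → ℝ → ℝ) (T X : ℝ) (k : ℕ) (hk : k ≤ 3) :
    |v k X| ≤ Nv v T X * muf X T ^ k := by
  have h := Finset.single_le_sum (f := fun k => |v k X| / muf X T ^ k) (s := Finset.range 4)
    (fun k _ => div_nonneg (abs_nonneg _) (pow_pos (muf_pos _ _) _).le)
    (Finset.mem_range.mpr (show k < 4 by omega))
  rwa [div_le_iff₀ (pow_pos (muf_pos _ _) _)] at h

theorem muf_near_T (X T T' : ℝ) (h : |T' - T| ≤ 1) : muf X T' ≤ 2 * muf X T := by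
  have h1 : |T'| ≤ |T| + 1 := by
    have : |T'| ≤ |T' - T| + |T| := by simpa using abs_add_le (T' - T) T
    linarith
  have h : muf X T' ^ 12 ≤ (2 * muf X T)^12 := by
    rw [mul_pow, muf_pow, muf_pow]
    have h2 : |T'|^3 ≤ (|T| + 1)^3 := pow_le_pow_left₀ (abs_nonneg _) h1 3
    have h3 := abs_nonneg T
    nlinarith [sq_nonneg X, sq_nonneg (|T| - 1), mul_nonneg h3 (sq_nonneg (|T| - 1)), pow_nonneg h3 3]
  exact (pow_le_pow_iff_left₀ (muf_pos _ _).le (by have := muf_pos X T; positivity)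
    (by norm_num)).mp h

theorem cubic_inj (τ a b : ℝ) (hτ : 0 ≤ τ) (h : 40 * a^3 + 240 * τ * a = 40 * b^3 + 240 * τ * b) :
    a = b := by
  by_contra hne
  have h1 : (a - b) * (40 * (a^2 + a * b + b^2) + 240 * τ) = 0 := by linear_combination h
  rcases mul_eq_zero.mp h1 with h2 | h2
  · exact hne (by linarith)
  · have hs : a^2 + a * b + b^2 = 0 := by nlinarith [sq_nonneg (a + b), sq_nonneg a, sq_nonneg b]
    have ha : a^2 ≤ 0 := by nlinarith [sq_nonneg (a + b), sq_nonneg a, sq_nonneg b]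
    have hb : b^2 ≤ 0 := by nlinarith [sq_nonneg (a + b), sq_nonneg a, sq_nonneg b]
    have ha0 : a = 0 := by nlinarith
    have hb0 : b = 0 := by nlinarith
    exact hne (by rw [ha0, hb0])

set_option maxHeartbeats 1000000 in
open Filter Topology in
theorem lem_P (u : ℕ → ℝ → ℝ → ℝ) (hU : USol u) (l : Ultrafilter ℕ) (t t' ε : ℕ → ℝ)
    (v : ℕ → ℕ → ℝ → ℝ) (X : ℕ → ℝ) (B K C : ℝ)
    (hv : ∀ n, LinSol u (t n) (t' n) (ε n) (v n)) (ht : ∀ n, t n ≤ B)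
    (htt : ∀ n, |t' n - t n| ≤ 1) (hN : ∀ n, 0 < Nv (v n) (t n) (X n))
    (hε : ∀ n, |ε n| ≤ K * Nv (v n) (t n) (X n))
    (hmu : Tendsto (fun n => muf (X n) (t n)) l atTop)
    (hnear : ∀ n y, |y| ≤ 1 → Nv (v n) (t n) (X n + y) ≤ C * Nv (v n) (t n) (X n)) : False := by
  obtain ⟨C0, hC0, hb0⟩ := lem_apriori u hU.hu hU.h4 hU.h5
  set m := fun n => muf (X n) (t n) with hm
  have hm0 : ∀ n, 0 < m n := fun n => muf_pos _ _
  have hm1 : ∀ n, 1 ≤ m n := fun n => muf_ge_one _ _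
  obtain ⟨τ', hτ'⟩ := ul_lim l (fun n => t n / m n^4) 1 (Eventually.of_forall fun n => by
    rw [abs_div, abs_of_pos (pow_pos (hm0 n) 4), div_le_one (pow_pos (hm0 n) 4)]
    exact muf_T _ _)
  obtain ⟨c, hc⟩ := ul_lim l (fun n => X n / m n^6) 1 (Eventually.of_forall fun n => by
    rw [abs_div, abs_of_pos (pow_pos (hm0 n) 6), div_le_one (pow_pos (hm0 n) 6)]
    exact muf_X _ _)
  have inv0 : Tendsto (fun n => 1 / m n) l (𝓝 0) := by
    have := hmu.inv_tendsto_atTop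
    exact this.congr (fun n => by simp [hm])
  have invk : ∀ k, k ≠ 0 → Tendsto (fun n => 1 / m n^k) l (𝓝 0) := by
    intro k hk
    have := inv0.pow k
    rw [zero_pow hk] at this
    exact this.congr (fun n => by simp)
  obtain ⟨τ, rfl⟩ : ∃ τ, τ' = -τ := ⟨-τ', by ring⟩
  have hτ : 0 ≤ τ := by
    have h1 : Tendsto (fun n => B * (1 / m n^4)) l (𝓝 (B * 0)) := (invk 4 (by norm_num)).const_mul B
    have h2 := le_of_tendsto_of_tendsto' hτ' h1 (fun n => by
      rw [mul_one_div]
      exact div_le_div_of_nonneg_right (ht n) (pow_pos (hm0 n) 4).le)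
    linarith
  have hτt' : Tendsto (fun n => t' n / m n^4) l (𝓝 (-τ)) := by
    have h1 : Tendsto (fun n => t' n / m n^4 - t n / m n^4) l (𝓝 0) := by
      refine squeeze_zero_norm (fun n => ?_) (invk 4 (by norm_num))
      rw [← sub_div, Real.norm_eq_abs, abs_div, abs_of_pos (pow_pos (hm0 n) 4)]
      exact div_le_div_of_nonneg_right (htt n) (pow_pos (hm0 n) 4).le
    have h2 := h1.add hτ'
    simp only [sub_add_cancel, zero_add] at h2
    exact h2
  have hsphere : c^2 + τ^3 = 1 := by
    have h1 : Tendsto (fun n => 1 / m n^12 + (X n / m n^6)^2 + |t n / m n^4|^3) l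
        (𝓝 (0 + c^2 + |-τ|^3)) := ((invk 12 (by norm_num)).add (hc.pow 2)).add (hτ'.abs.pow 3)
    have h2 : ∀ n, 1 / m n^12 + (X n / m n^6)^2 + |t n / m n^4|^3 = 1 := by
      intro n
      have h3 := muf_pow (X n) (t n)
      change m n^12 = _ at h3
      have h4 := (hm0 n).ne'
      rw [abs_div, abs_of_pos (pow_pos (hm0 n) 4), div_pow, div_pow, ← pow_mul, ← pow_mul,
        ← add_div, ← add_div, ← h3]
      exact div_self (pow_ne_zero _ h4)
    simp only [h2] at h1
    have := tendsto_nhds_unique h1 tendsto_const_nhds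
    rw [abs_neg, abs_of_nonneg hτ] at this
    linarith
  have hwin : ∀ R : ℝ, ∀ᶠ n in (l : Filter ℕ), ∀ s, |s| ≤ R → |s / m n| ≤ 1 := by
    intro R
    filter_upwards [hmu.eventually_ge_atTop R] with n hn s hs
    rw [abs_div, abs_of_pos (hm0 n), div_le_one (hm0 n)]
    exact hs.trans hn
  have key1 : ∀ n y k, k ≤ 3 → |y| ≤ 1 → ∀ T, |T - t n| ≤ 1 →
      |u k (X n + y) T| ≤ (C0 * 1024) * m n^(k+2) := by
    intro n y k hk hy T hT
    have h1 : muf (X n + y) T ≤ 4 * m n := by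
      have h1 := muf_near_T (X n + y) (t n) T hT
      have h2 := muf_near (X n) y (t n) hy
      change _ ≤ 2 * m n at h2
      linarith
    have hmn := hm0 n
    calc |u k (X n + y) T| ≤ C0 * muf (X n + y) T^(k+2) := hb0 _ _ k hk
      _ ≤ C0 * (4 * m n)^(k+2) := by
          gcongr
          exact (muf_pos _ _).le
      _ = C0 * 4^(k+2) * m n^(k+2) := by rw [mul_pow]; ring
      _ ≤ C0 * 4^5 * m n^(k+2) := by
          gcongr
          · norm_num
          · omega
      _ = _ := by norm_num
  have hq : ∀ n, |t n - t n| ≤ 1 := fun n => by simp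
  obtain ⟨a, ha, hu0, huk⟩ := lem_lim u hU.hu hU.h4 hU.h5 l X t m τ c (C0 * 1024) hτ hm0 hmu hτ' hc
    (fun R => by
      filter_upwards [hwin R] with n hn s hs k hk
      exact key1 n _ k hk (hn s hs) _ (hq n))
  obtain ⟨a', ha', hu0', huk'⟩ := lem_lim u hU.hu hU.h4 hU.h5 l X t' m τ c (C0 * 1024) hτ hm0 hmu
    hτt' hc (fun R => by
      filter_upwards [hwin R] with n hn s hs k hk
      exact key1 n _ k hk (hn s hs) _ (htt n))
  obtain rfl : a = a' := cubic_inj τ a a' hτ (by linarith)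
  have hpos : 0 < a^2 + τ := by
    rcases hτ.lt_or_eq with h | h
    · positivity
    · have : a ≠ 0 := by
        rintro rfl
        rw [← h] at hsphere ha
        have : c = 0 := by linarith
        rw [this] at hsphere
        norm_num at hsphere
      positivity
  set N := fun n => Nv (v n) (t n) (X n) with hNdef
  have hN0 : ∀ n, 0 < N n := hN
  have hC : 0 ≤ C := by
    have := hnear 0 0 (by simp)
    simp only [add_zero] at this
    have h2 := hN 0
    by_contra h
    push Not at h
    nlinarith
  set z : ℕ → ℕ → ℝ → ℝ := fun n k s => v n k (X n + s / m n) / (m n^k * N n) with hz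
  set w : ℕ → ℕ → ℝ → ℝ := fun n k s => u k (X n + s / m n) (t n) / m n^(k+2) with hw
  set w' : ℕ → ℕ → ℝ → ℝ := fun n k s => u k (X n + s / m n) (t' n) / m n^(k+2) with hw'
  have dz : ∀ n k, k ≤ 4 → ∀ s, HasDerivAt (z n k) (z n (k+1) s) s := by
    intro n k hk s
    have hmn := (hm0 n).ne'
    have hNn := (hN0 n).ne'
    have h1 : HasDerivAt (fun s => X n + s / m n) (1 / m n) s :=
      ((hasDerivAt_id s).div_const (m n)).const_add (X n)
    have h2 := (((hv n).hd k hk (X n + s / m n)).comp s h1).div_const (m n^k * N n)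
    refine h2.congr_deriv ?_
    simp only [hz]
    field_simp
    try ring
  have z4 : ∀ n s, z n 4 s = -10 * ((w' n 1 s + w n 1 s) * z n 1 s)
      - 20 * (w' n 0 s * z n 2 s + w n 2 s * z n 0 s)
      - 40 * ((w' n 0 s * w' n 0 s + w' n 0 s * w n 0 s + w n 0 s * w n 0 s) * z n 0 s)
      + 240 * ((t n / m n^4) * z n 0 s) + 240 * ((ε n / N n) * (w' n 0 s * (1 / m n^2))) := by
    intro n s
    have hmn := (hm0 n).ne'
    have hNn := (hN0 n).ne'
    simp only [hz, hw, hw']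
    rw [(hv n).h4]
    field_simp
    ring
  have z5 : ∀ n s, z n 5 s = -40 * (w' n 1 s * z n 2 s + w n 2 s * z n 1 s)
      - 20 * (w' n 0 s * z n 3 s + w n 3 s * z n 0 s)
      - 120 * (w' n 0 s * w' n 0 s * z n 1 s + (w' n 0 s + w n 0 s) * w n 1 s * z n 0 s)
      + 240 * ((t n / m n^4) * z n 1 s) + 240 * ((ε n / N n) * (w' n 1 s * (1 / m n^2))) := by
    intro n s
    have hmn := (hm0 n).ne'
    have hNn := (hN0 n).ne'
    simp only [hz, hw, hw']
    rw [(hv n).h5]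
    field_simp
    ring
  have bm : ∀ n, |1 / m n^2| ≤ 1 := by
    intro n
    have := hm0 n
    rw [abs_of_pos (by positivity), div_le_one (by positivity)]
    exact one_le_pow₀ (hm1 n)
  have bε : ∀ n, |ε n / N n| ≤ K := by
    intro n
    rw [abs_div, abs_of_pos (hN0 n), div_le_iff₀ (hN0 n)]
    exact hε n
  have bt : ∀ n, |t n / m n^4| ≤ 1 := fun n => by
    rw [abs_div, abs_of_pos (pow_pos (hm0 n) 4), div_le_one (pow_pos (hm0 n) 4)]
    exact muf_T _ _
  have bz : ∀ n s, |s / m n| ≤ 1 → ∀ k ≤ 3, |z n k s| ≤ 8 * C := by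
    intro n s hs k hk
    have hmn := hm0 n
    have hNn := hN0 n
    simp only [hz]
    rw [abs_div, abs_of_pos (show 0 < m n^k * N n by positivity), div_le_iff₀ (by positivity)]
    have h1 := Nv_bd (v n) (t n) (X n + s / m n) k hk
    have h2 := hnear n _ hs
    have h3 := muf_near (X n) _ (t n) hs
    calc _ ≤ _ := h1
      _ ≤ (C * N n) * (2 * m n)^k := by
          apply mul_le_mul h2 (pow_le_pow_left₀ (muf_pos _ _).le h3 k)
            (pow_pos (muf_pos _ _) _).le (by positivity)
      _ = 2^k * C * (m n^k * N n) := by rw [mul_pow]; ring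
      _ ≤ 2^3 * C * (m n^k * N n) := by
          gcongr
          norm_num
      _ = _ := by norm_num
  have bw : ∀ n s, |s / m n| ≤ 1 → ∀ k ≤ 3, |w n k s| ≤ C0 * 1024 := by
    intro n s hs k hk
    simp only [hw]
    rw [abs_div, abs_of_pos (pow_pos (hm0 n) _), div_le_iff₀ (pow_pos (hm0 n) _)]
    exact key1 n _ k hk hs _ (hq n)
  have bw' : ∀ n s, |s / m n| ≤ 1 → ∀ k ≤ 3, |w' n k s| ≤ C0 * 1024 := by
    intro n s hs k hk
    simp only [hw']
    rw [abs_div, abs_of_pos (pow_pos (hm0 n) _), div_le_iff₀ (pow_pos (hm0 n) _)]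
    exact key1 n _ k hk hs _ (htt n)
  obtain ⟨y, hy, dy⟩ := ul_chain l z dz (by
    intro R
    set D := C0 * 1024 with hD
    set F := 8 * C with hF
    refine ⟨F + (10 * ((D + D) * F) + 20 * (D * F + D * F) + 40 * ((D * D + D * D + D * D) * F)
      + 240 * (1 * F) + 240 * (K * (D * 1))) + (40 * (D * F + D * F) + 20 * (D * F + D * F)
      + 120 * (D * D * F + (D + D) * D * F) + 240 * (1 * F) + 240 * (K * (D * 1))), ?_⟩
    filter_upwards [hwin R] with n hn s hs k hk
    have q := bz n s (hn s hs)
    have p := bw n s (hn s hs)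
    have p' := bw' n s (hn s hs)
    have q0 := q 0 (by norm_num)
    have q1 := q 1 (by norm_num)
    have q2 := q 2 (by norm_num)
    have q3 := q 3 (by norm_num)
    have P4 : |z n 4 s| ≤ 10 * ((D + D) * F) + 20 * (D * F + D * F)
      + 40 * ((D * D + D * D + D * D) * F) + 240 * (1 * F) + 240 * (K * (D * 1)) := by
      rw [z4, neg_mul]
      have p0 := p 0 (by norm_num)
      have p1 := p 1 (by norm_num)
      have p2 := p 2 (by norm_num)
      have p0' := p' 0 (by norm_num)
      have p1' := p' 1 (by norm_num)
      refine bd_add (bd_add (bd_sub (bd_sub ?_ (bd_c _ (by norm_num)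
        (bd_add (bd_mul p0' q2) (bd_mul p2 q0)))) (bd_c _ (by norm_num)
        (bd_mul (bd_add (bd_add (bd_mul p0' p0') (bd_mul p0' p0)) (bd_mul p0 p0)) q0)))
        (bd_c _ (by norm_num) (bd_mul (bt n) q0))) (bd_c _ (by norm_num)
        (bd_mul (bε n) (bd_mul p0' (bm n))))
      rw [abs_neg]
      exact bd_c _ (by norm_num) (bd_mul (bd_add p1' p1) q1)
    have P5 : |z n 5 s| ≤ 40 * (D * F + D * F) + 20 * (D * F + D * F)
      + 120 * (D * D * F + (D + D) * D * F) + 240 * (1 * F) + 240 * (K * (D * 1)) := by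
      rw [z5, neg_mul]
      have p0 := p 0 (by norm_num)
      have p1 := p 1 (by norm_num)
      have p2 := p 2 (by norm_num)
      have p3 := p 3 (by norm_num)
      have p0' := p' 0 (by norm_num)
      have p1' := p' 1 (by norm_num)
      refine bd_add (bd_add (bd_sub (bd_sub ?_ (bd_c _ (by norm_num)
        (bd_add (bd_mul p0' q3) (bd_mul p3 q0)))) (bd_c _ (by norm_num)
        (bd_add (bd_mul (bd_mul p0' p0') q1) (bd_mul (bd_mul (bd_add p0' p0) p1) q0))))
        (bd_c _ (by norm_num) (bd_mul (bt n) q1))) (bd_c _ (by norm_num)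
        (bd_mul (bε n) (bd_mul p1' (bm n))))
      rw [abs_neg]
      exact bd_c _ (by norm_num) (bd_add (bd_mul p1' q2) (bd_mul p2 q1))
    have n4 := (abs_nonneg _).trans P4
    have n5 := (abs_nonneg _).trans P5
    have nF := (abs_nonneg _).trans q0
    rcases Nat.lt_or_ge k 4 with h | h
    · have := q k (by omega)
      linarith
    · have : k = 4 ∨ k = 5 := by omega
      rcases this with rfl | rfl <;> linarith)
  obtain ⟨e, he⟩ := ul_lim l (fun n => ε n / N n) K (Eventually.of_forall bε)
  have y4 : ∀ s, y 4 s = -10 * ((0 + 0) * y 1 s) - 20 * (a * y 2 s + 0 * y 0 s)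
      - 40 * ((a * a + a * a + a * a) * y 0 s) + 240 * (-τ * y 0 s) + 240 * (e * (a * 0)) := by
    intro s
    have h0 := hy 0 (by norm_num) s
    have h1 := hy 1 (by norm_num) s
    have h2 := hy 2 (by norm_num) s
    refine tendsto_nhds_unique (hy 4 (by norm_num) s) ?_
    have W0 : Tendsto (fun n => w n 0 s) l (𝓝 a) := hu0 s
    have W0' : Tendsto (fun n => w' n 0 s) l (𝓝 a) := hu0' s
    have W1 : Tendsto (fun n => w n 1 s) l (𝓝 0) := huk 1 (by norm_num) (by norm_num) s
    have W1' : Tendsto (fun n => w' n 1 s) l (𝓝 0) := huk' 1 (by norm_num) (by norm_num) s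
    have W2 : Tendsto (fun n => w n 2 s) l (𝓝 0) := huk 2 (by norm_num) (by norm_num) s
    have := ((((((W1'.add W1).mul h1).const_mul (-10)).sub
      (((W0'.mul h2).add (W2.mul h0)).const_mul 20)).sub
      (((((W0'.mul W0').add (W0'.mul W0)).add (W0.mul W0)).mul h0).const_mul 40)).add
      ((hτ'.mul h0).const_mul 240)).add ((he.mul (W0'.mul (invk 2 (by norm_num)))).const_mul 240)
    refine this.congr (fun n => ?_)
    rw [z4]
  have yb : ∀ k ≤ 3, ∀ s, |y k s| ≤ 8 * C := by
    intro k hk s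
    refine le_of_tendsto (hy k (by omega) s).abs ?_
    filter_upwards [hwin |s|] with n hn using bz n s (hn s le_rfl) k hk
  have hzero := lem_linLiou (y 0) (y 1) (y 2) (y 3) a τ (8 * C) hτ hpos (dy 0 (by norm_num))
    (dy 1 (by norm_num)) (dy 2 (by norm_num))
    (fun s => (dy 3 (by norm_num) s).congr_deriv (by
      simp only [Nat.reduceAdd]; rw [y4]; ring))
    (yb 0 (by norm_num)) (yb 1 (by norm_num)) (yb 2 (by norm_num)) (yb 3 (by norm_num)) 0
  have hyz : ∀ k ∈ Finset.range 4, y k 0 = 0 := by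
    intro k hk
    have hk := Finset.mem_range.mp hk
    interval_cases k
    · exact hzero.1
    · exact hzero.2.1
    · exact hzero.2.2.1
    · exact hzero.2.2.2
  have hsum : Tendsto (fun n => ∑ k ∈ Finset.range 4, |z n k 0|) l
      (𝓝 (∑ k ∈ Finset.range 4, 0)) := by
    apply tendsto_finsetSum
    intro k hk
    have h1 := (hy k (by have := Finset.mem_range.mp hk; omega) 0).abs
    rwa [hyz k hk, abs_zero] at h1
  have heq : ∀ n, ∑ k ∈ Finset.range 4, |z n k 0| = 1 := by
    intro n
    have : ∀ k ∈ Finset.range 4, |z n k 0| = |v n k (X n)| / m n^k / N n := by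
      intro k _
      have hmn := hm0 n
      have hNn := hN0 n
      simp only [hz, zero_div, add_zero]
      rw [abs_div, abs_of_pos (show 0 < m n^k * N n by positivity), div_div]
    rw [Finset.sum_congr rfl this, ← Finset.sum_div]
    exact div_self (hN0 n).ne'
  simp only [heq, Finset.sum_const_zero] at hsum
  exact one_ne_zero (tendsto_nhds_unique tendsto_const_nhds hsum)

open Filter Topology in
/-- Uniform version: near-maximum points stay in a bounded region. -/
theorem lem_P' (u : ℕ → ℝ → ℝ → ℝ) (hU : USol u) (B K C : ℝ) :
    ∃ M : ℝ, 1 ≤ M ∧ ∀ t t' ε v X, LinSol u t t' ε v → t ≤ B → |t' - t| ≤ 1 → 0 < Nv v t X →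
      |ε| ≤ K * Nv v t X → (∀ y, |y| ≤ 1 → Nv v t (X + y) ≤ C * Nv v t X) → muf X t ≤ M := by
  by_contra hcon
  push Not at hcon
  have h := fun n : ℕ => hcon ((n:ℝ) + 1) (by have : (0:ℝ) ≤ n := Nat.cast_nonneg n
                                              linarith)
  choose t t' ε v X h1 h2 h3 h4 h5 h6 h7 using h
  refine lem_P u hU (Filter.hyperfilter ℕ) t t' ε v X B K C h1 h2 h3 h4 h5 ?_ h6
  refine Tendsto.mono_left ?_ Nat.hyperfilter_le_atTop
  exact tendsto_atTop_mono (fun n => (by linarith [h7 n] : (n:ℝ) ≤ muf (X n) (t n)))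
    tendsto_natCast_atTop_atTop

/-- near-maximum lemma -/
theorem lem_nm (f g : ℝ → ℝ) (Λ C x1 : ℝ) (hg : ∀ x y, |g x - g y| ≤ Λ * |x - y|)
    (hC : ∀ x, f x * Real.exp (-g x) ≤ C) (h1 : 0 < f x1) (hΛ : 0 ≤ Λ) :
    ∃ x, 0 < f x ∧ (∀ y, f y * Real.exp (-g y) ≤ 2 * (f x * Real.exp (-g x))) ∧
      ∀ y, |y| ≤ 1 → f (x + y) ≤ (2 * Real.exp Λ) * f x := by
  set S := sSup (Set.range fun x => f x * Real.exp (-g x)) with hS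
  have hbdd : BddAbove (Set.range fun x => f x * Real.exp (-g x)) := by
    refine ⟨C, ?_⟩
    rintro _ ⟨x, rfl⟩
    exact hC x
  have hle : ∀ y, f y * Real.exp (-g y) ≤ S := fun y => le_csSup hbdd ⟨y, rfl⟩
  have hSpos : 0 < S := lt_of_lt_of_le (mul_pos h1 (Real.exp_pos _)) (hle x1)
  obtain ⟨_, ⟨x, rfl⟩, hx⟩ := exists_lt_of_lt_csSup (Set.range_nonempty _) (half_lt_self hSpos)
  simp only at hx
  have hfx : 0 < f x := by
    have : 0 < f x * Real.exp (-g x) := by linarith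
    exact (pos_iff_pos_of_mul_pos this).mpr (Real.exp_pos _)
  have hA : ∀ y, f y * Real.exp (-g y) ≤ 2 * (f x * Real.exp (-g x)) := fun y => by
    have := hle y; linarith
  refine ⟨x, hfx, hA, fun y hy => ?_⟩
  have h2 := hA (x + y)
  have h3 : g (x + y) - g x ≤ Λ := by
    have := (abs_le.mp (hg (x + y) x)).2
    rw [show x + y - x = y by ring] at this
    nlinarith
  have h4 : f (x + y) = f (x + y) * Real.exp (-g (x + y)) * Real.exp (g (x + y)) := by
    rw [mul_assoc, ← Real.exp_add]; simp
  rw [h4]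
  calc _ ≤ 2 * (f x * Real.exp (-g x)) * Real.exp (g (x+y)) :=
        mul_le_mul_of_nonneg_right h2 (Real.exp_pos _).le
    _ = 2 * f x * Real.exp (g (x + y) - g x) := by rw [Real.exp_sub, Real.exp_neg]; field_simp
    _ ≤ 2 * f x * Real.exp Λ := by
        apply mul_le_mul_of_nonneg_left (Real.exp_le_exp.mpr h3) (by positivity)
    _ = _ := by ring


theorem LinSol.cont {u : ℕ → ℝ → ℝ → ℝ} {t t' ε : ℝ} {v : ℕ → ℝ → ℝ} (h : LinSol u t t' ε v)
    (k : ℕ) (hk : k ≤ 4) : Continuous (v k) :=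
  continuous_iff_continuousAt.mpr fun x => (h.hd k hk x).continuousAt

theorem LinSol.contN {u : ℕ → ℝ → ℝ → ℝ} {t t' ε : ℝ} {v : ℕ → ℝ → ℝ} (h : LinSol u t t' ε v)
    (T : ℝ) : Continuous (fun X => Nv v T X) := by
  unfold Nv
  refine continuous_finsetSum _ fun k hk => ?_
  have hk4 : k ≤ 4 := by have := Finset.mem_range.mp hk; omega
  have hm : Continuous (fun X => muf X T) := muf_cont.comp (continuous_id.prodMk continuous_const)
  exact ((h.cont k hk4).abs).div₀ (hm.pow k) fun x => (pow_pos (muf_pos _ _) _).ne'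

theorem bdd_on (f : ℝ → ℝ) (hf : Continuous f) (R : ℝ) : ∃ D, 0 ≤ D ∧ ∀ x, |x| ≤ R → |f x| ≤ D := by
  obtain ⟨D, hD⟩ := (isCompact_Icc (a := -R) (b := R)).exists_bound_of_continuousOn hf.continuousOn
  exact ⟨max D 0, le_max_right _ _, fun x hx => (hD x (abs_le.mp hx)).trans (le_max_left _ _)⟩

theorem bdd_on2 (f : ℝ → ℝ → ℝ) (hf : Continuous (fun p : ℝ × ℝ => f p.1 p.2)) (R a b : ℝ) :
    ∃ D, 0 ≤ D ∧ ∀ x t, |x| ≤ R → a ≤ t → t ≤ b → |f x t| ≤ D := by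
  obtain ⟨D, hD⟩ := ((isCompact_Icc (a := -R) (b := R)).prod
    (isCompact_Icc (a := a) (b := b))).exists_bound_of_continuousOn hf.continuousOn
  exact ⟨max D 0, le_max_right _ _, fun x t hx h1 h2 =>
    (hD (x, t) ⟨abs_le.mp hx, h1, h2⟩).trans (le_max_left _ _)⟩

theorem mu_X6 {X T M : ℝ} (h : muf X T ≤ M) : |X| ≤ M^6 :=
  (muf_X X T).trans (pow_le_pow_left₀ (muf_pos _ _).le h 6)

theorem k_to_1 (u : ℕ → ℝ → ℝ → ℝ) (hU : USol u) (T : ℝ) (v : ℕ → ℝ → ℝ)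
    (hL : LinSol u T T 0 v) (K C : ℝ) (hK : 0 ≤ K)
    (h : ∀ X, Nv v T X ≤ C * Real.exp (K * |X|)) : ∃ C', ∀ X, Nv v T X ≤ C' * Real.exp |X| := by
  obtain ⟨M, hM1, hM⟩ := lem_P' u hU T 0 (2 * Real.exp (K+1))
  obtain ⟨D, hD0, hD⟩ := bdd_on _ (hL.contN T) (M^6)
  have hC0 : 0 ≤ C := by
    have := (Nv_nonneg v T 0).trans (h 0)
    simpa using this
  refine ⟨2 * D, fun Y => ?_⟩
  rcases (Nv_nonneg v T Y).eq_or_lt with h0 | h0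
  · rw [← h0]; positivity
  obtain ⟨x, hx0, hx1, hx2⟩ := lem_nm (Nv v T) (fun x => |x| + K * max (|x| - |Y|) 0) (K+1)
    (C * Real.exp (K * |Y|)) Y (by
      intro a b
      have h1 : |(|a| - |b|)| ≤ |a - b| := abs_abs_sub_abs_le a b
      have h2 : |max (|a| - |Y|) 0 - max (|b| - |Y|) 0| ≤ |(|a| - |Y|) - (|b| - |Y|)| := by
        simpa using abs_max_sub_max_le_max (|a| - |Y|) 0 (|b| - |Y|) 0
      rw [sub_sub_sub_cancel_right] at h2
      have e : |a| + K * max (|a| - |Y|) 0 - (|b| + K * max (|b| - |Y|) 0)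
        = (|a| - |b|) + K * (max (|a| - |Y|) 0 - max (|b| - |Y|) 0) := by ring
      calc _ = |(|a| - |b|) + K * (max (|a| - |Y|) 0 - max (|b| - |Y|) 0)| := by rw [← e]
        _ ≤ |(|a| - |b|)| + |K * (max (|a| - |Y|) 0 - max (|b| - |Y|) 0)| := abs_add_le _ _
        _ = |(|a| - |b|)| + K * |(max (|a| - |Y|) 0 - max (|b| - |Y|) 0)| := by
            rw [abs_mul, abs_of_nonneg hK]
        _ ≤ |a - b| + K * |a - b| := by
            have := mul_le_mul_of_nonneg_left (h2.trans h1) hK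
            linarith
        _ = _ := by ring)
    (by
      intro x
      calc Nv v T x * Real.exp (-(|x| + K * max (|x| - |Y|) 0))
          ≤ (C * Real.exp (K * |x|)) * Real.exp (-(|x| + K * max (|x| - |Y|) 0)) := by
            gcongr; exact h x
        _ = C * Real.exp (K * |x| -(|x| + K * max (|x| - |Y|) 0)) := by
            rw [mul_assoc, ← Real.exp_add]; rfl
        _ ≤ C * Real.exp (K * |Y|) := by
            gcongr
            have h1 : K * (|x| - |Y|) ≤ K * max (|x| - |Y|) 0 := by
              gcongr; exact le_max_left _ _
            have := abs_nonneg x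
            nlinarith) h0 (by linarith)
  have hm := hM T T 0 v x hL le_rfl (by simp) hx0 (by simp) hx2
  have hxD := hD x (mu_X6 hm)
  have hY := hx1 Y
  have e1 : Real.exp (-(|x| + K * max (|x| - |Y|) 0)) ≤ 1 := by
    apply Real.exp_le_one_iff.mpr
    have : 0 ≤ max (|x| - |Y|) 0 := le_max_right _ _
    have := abs_nonneg x
    nlinarith [mul_nonneg hK (le_max_right (|x| - |Y|) 0)]
  simp only [sub_self, max_self, mul_zero, add_zero] at hY
  have h3 : Nv v T Y * Real.exp (-|Y|) ≤ 2 * D := by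
    have : Nv v T x * Real.exp (-(|x| + K * max (|x| - |Y|) 0)) ≤ D := by
      have h5 := (abs_le.mp hxD).2
      calc _ ≤ Nv v T x * 1 := by gcongr; 
        _ ≤ D := by simpa using h5
    linarith
  calc Nv v T Y = Nv v T Y * Real.exp (-|Y|) * Real.exp |Y| := by
        rw [mul_assoc, ← Real.exp_add]; simp
    _ ≤ _ := by gcongr

/-- trivial kernel at T -/
def Triv (u : ℕ → ℝ → ℝ → ℝ) (T : ℝ) : Prop :=
  ∀ v, LinSol u T T 0 v → (∃ C, ∀ X, Nv v T X ≤ C * Real.exp |X|) → ∀ X, Nv v T X = 0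

theorem nm_abs (f : ℝ → ℝ) (C x1 : ℝ) (hC : ∀ x, f x ≤ C * Real.exp |x|) (h1 : 0 < f x1) :
    ∃ x, 0 < f x ∧ (∀ y, f y * Real.exp (-|y|) ≤ 2 * (f x * Real.exp (-|x|))) ∧
      ∀ y, |y| ≤ 1 → f (x + y) ≤ (2 * Real.exp 1) * f x := by
  refine lem_nm f (fun x => |x|) 1 C x1 (fun a b => by
    rw [one_mul]; exact abs_abs_sub_abs_le a b) (fun x => ?_) h1 zero_le_one
  calc f x * Real.exp (-|x|) ≤ (C * Real.exp |x|) * Real.exp (-|x|) := by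
        gcongr; exact hC x
    _ = C := by rw [mul_assoc, ← Real.exp_add]; simp

theorem triv_neg (u : ℕ → ℝ → ℝ → ℝ) (hU : USol u) : ∃ T0, ∀ T ≤ T0, Triv u T := by
  obtain ⟨M, hM1, hM⟩ := lem_P' u hU 0 0 (2 * Real.exp 1)
  refine ⟨-(M^4+1), fun T hT v hL ⟨C, hC⟩ X => ?_⟩
  by_contra hne
  have h0 : 0 < Nv v T X := lt_of_le_of_ne (Nv_nonneg _ _ _) (Ne.symm hne)
  obtain ⟨x, hx0, hx1, hx2⟩ := nm_abs (Nv v T) C X hC h0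
  have hM4 : 0 ≤ M^4 := by positivity
  have hm := hM T T 0 v x hL (by linarith) (by simp) hx0 (by simp) hx2
  have h4 := (muf_T x T).trans (pow_le_pow_left₀ (muf_pos _ _).le hm 4)
  rw [abs_of_nonpos (by linarith)] at h4
  linarith

/-- build a kernel element from its first four components -/
theorem mkLin (u : ℕ → ℝ → ℝ → ℝ) (hU : USol u) (T : ℝ) (y : ℕ → ℝ → ℝ)
    (hd : ∀ k ≤ 3, ∀ X, HasDerivAt (y k) (y (k+1) X) X)
    (h4 : ∀ X, y 4 X = -20 * u 1 X T * y 1 X - 20 * u 0 X T * y 2 X - 20 * u 2 X T * y 0 X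
      - 120 * u 0 X T^2 * y 0 X + 240 * T * y 0 X) :
    ∃ v, LinSol u T T 0 v ∧ ∀ k ≤ 4, v k = y k := by
  set F : ℝ → ℝ := fun X => -40 * u 1 X T * y 2 X - 40 * u 2 X T * y 1 X - 20 * u 0 X T * y 3 X
     - 20 * u 3 X T * y 0 X - 120 * u 0 X T^2 * y 1 X - 240 * u 0 X T * u 1 X T * y 0 X
     + 240 * T * y 1 X with hF
  have hy4 : ∀ X, HasDerivAt (y 4) (F X) X := by
    intro X
    have e : y 4 = fun X => -20 * u 1 X T * y 1 X - 20 * u 0 X T * y 2 X - 20 * u 2 X T * y 0 X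
      - 120 * u 0 X T^2 * y 0 X + 240 * T * y 0 X := funext h4
    rw [e]
    have d0 := hd 0 (by norm_num) X
    have d1 := hd 1 (by norm_num) X
    have d2 := hd 2 (by norm_num) X
    have u0 := hU.hu 0 X T
    have u1 := hU.hu 1 X T
    have u2 := hU.hu 2 X T
    have h := ((((u1.const_mul (-20)).mul d1).sub ((u0.const_mul 20).mul d2)).sub
      ((u2.const_mul 20).mul d0)).sub (((u0.pow 2).const_mul 120).mul d0)|>.add (d0.const_mul (240*T))
    refine h.congr_deriv ?_
    simp [hF]
    ring
  refine ⟨fun k => if k = 5 then F else y k, ⟨?_, ?_, ?_⟩, ?_⟩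
  · intro k hk X
    rcases Nat.lt_or_ge k 4 with h | h
    · have e1 : k ≠ 5 := by omega
      have e2 : k + 1 ≠ 5 := by omega
      simp only [e1, e2, if_false]
      exact hd k (by omega) X
    · have : k = 4 := by omega
      subst this
      simp only [show (4:ℕ) ≠ 5 by norm_num, if_false, if_true]
      exact hy4 X
  · intro X
    simp [h4]; ring
  · intro X
    simp [hF]; ring
  · intro k hk
    have e1 : k ≠ 5 := by omega
    simp [e1]


theorem norm_exists (u : ℕ → ℝ → ℝ → ℝ) (hU : USol u) (b : ℝ) : ∃ M : ℝ, ∀ T ≤ b, ¬ Triv u T →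
    ∃ v x, LinSol u T T 0 v ∧ |x| ≤ M ∧ 1 ≤ Nv v T x ∧ ∀ Y, Nv v T Y ≤ 2 * Real.exp |Y| := by
  obtain ⟨M, hM1, hM⟩ := lem_P' u hU b 0 (2 * Real.exp 1)
  refine ⟨M^6, fun T hT hnt => ?_⟩
  unfold Triv at hnt
  push Not at hnt
  obtain ⟨v, hL, ⟨C, hC⟩, X, hX⟩ := hnt
  have h0 : 0 < Nv v T X := lt_of_le_of_ne (Nv_nonneg _ _ _) (Ne.symm hX)
  obtain ⟨x, hx0, hx1, hx2⟩ := nm_abs (Nv v T) C X hC h0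
  have hm := hM T T 0 v x hL hT (by simp) hx0 (by simp) hx2
  set c : ℝ := (Nv v T x * Real.exp (-|x|))⁻¹ with hc
  have hcp : 0 < c := by positivity
  have hN : ∀ Y, Nv (fun k X => c * v k X) T Y = c * Nv v T Y := by
    intro Y
    unfold Nv
    rw [Finset.mul_sum]
    refine Finset.sum_congr rfl fun k _ => ?_
    rw [abs_mul, abs_of_pos hcp]; ring
  refine ⟨fun k X => c * v k X, x, ⟨?_, ?_, ?_⟩, mu_X6 hm, ?_, ?_⟩
  · intro k hk X
    exact (hL.hd k hk X).const_mul c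
  · intro X
    simp only [hL.h4 X]; ring
  · intro X
    simp only [hL.h5 X]; ring
  · rw [hN, hc, mul_inv, mul_right_comm, inv_mul_cancel₀ hx0.ne', one_mul, ← Real.exp_neg, neg_neg]
    exact Real.one_le_exp (abs_nonneg x)
  · intro Y
    rw [hN]
    have h1 := hx1 Y
    have h2 : c * (Nv v T Y * Real.exp (-|Y|)) ≤ 2 := by
      calc _ ≤ c * (2 * (Nv v T x * Real.exp (-|x|))) := by gcongr
        _ = 2 * ((Nv v T x * Real.exp (-|x|))⁻¹ * (Nv v T x * Real.exp (-|x|))) := by rw [hc]; ring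
        _ = 2 := by rw [inv_mul_cancel₀ (by positivity)]; ring
    calc c * Nv v T Y = c * (Nv v T Y * Real.exp (-|Y|)) * Real.exp |Y| := by
          rw [mul_assoc, mul_assoc, ← Real.exp_add]; simp
      _ ≤ _ := by gcongr

theorem ms_abs {a b A B : ℝ} (h1 : |a| ≤ A) (h2 : |b| ≤ B) : |a * b| ≤ A * B := by
  rw [abs_mul]; exact mul_le_mul h1 h2 (abs_nonneg _) ((abs_nonneg _).trans h1)

/-- local bound for kernel elements -/
theorem ker_loc_bd (u : ℕ → ℝ → ℝ → ℝ) (cu : ∀ k, Continuous (fun p : ℝ × ℝ => u k p.1 p.2))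
    (a b R E : ℝ) (hE : 0 ≤ E) : ∃ C, ∀ T v, a ≤ T → T ≤ b → LinSol u T T 0 v →
      (∀ Y, Nv v T Y ≤ E * Real.exp |Y|) → ∀ s, |s| ≤ R → ∀ k ≤ 5, |v k s| ≤ C := by
  obtain ⟨m, hm0, hm⟩ := bdd_on2 _ muf_cont R a b
  obtain ⟨U0, h00, hU0⟩ := bdd_on2 _ (cu 0) R a b
  obtain ⟨U1, h10, hU1⟩ := bdd_on2 _ (cu 1) R a b
  obtain ⟨U2, h20, hU2⟩ := bdd_on2 _ (cu 2) R a b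
  obtain ⟨U3, h30, hU3⟩ := bdd_on2 _ (cu 3) R a b
  set e := E * Real.exp R with he
  have he0 : 0 ≤ e := by positivity
  set t := |a| + |b| with ht
  have ht0 : 0 ≤ t := by positivity
  set V := e * (1+m)^3 with hV
  have hV0 : 0 ≤ V := by positivity
  set C4 := 10 * ((U1 + U1) * V) + 20 * (U0 * V + U2 * V)
    + 40 * ((U0 * U0 + U0 * U0 + U0 * U0) * V) + 240 * (t * V) with hC4
  set C5 := 40 * (U1 * V + U2 * V) + 20 * (U0 * V + U3 * V)
    + 120 * (U0 * U0 * V + (U0 + U0) * U1 * V) + 240 * (t * V) with hC5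
  have hC40 : 0 ≤ C4 := by positivity
  have hC50 : 0 ≤ C5 := by positivity
  refine ⟨V + C4 + C5, fun T v h1 h2 hL hN s hs k hk => ?_⟩
  have hT : |T| ≤ t := abs_le.mpr ⟨by
    have := neg_abs_le a; have := abs_nonneg b; linarith, by
    have := le_abs_self b; have := abs_nonneg a; linarith⟩
  have hv : ∀ k ≤ 3, |v k s| ≤ V := by
    intro k hk
    have hmm : muf s T ≤ m := (le_abs_self _).trans (hm s T hs h1 h2)
    have hp := muf_pos s T
    calc |v k s| ≤ Nv v T s * muf s T ^ k := Nv_bd v T s k hk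
      _ ≤ (E * Real.exp |s|) * (1+m)^k := by
          gcongr
          · exact hN s
          · linarith
      _ ≤ e * (1+m)^3 := by
          rw [he]
          gcongr
          · linarith
  have b0 := hU0 s T hs h1 h2
  have b1 := hU1 s T hs h1 h2
  have b2 := hU2 s T hs h1 h2
  have b3 := hU3 s T hs h1 h2
  have v0 := hv 0 (by norm_num)
  have v1 := hv 1 (by norm_num)
  have v2 := hv 2 (by norm_num)
  have v3 := hv 3 (by norm_num)
  rcases Nat.lt_or_ge k 4 with h | h
  · have := hv k (by omega); linarith
  rcases h.eq_or_lt with h | h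
  · subst h
    have : |v 4 s| ≤ C4 := by
      rw [hL.h4]
      simp only [zero_mul, mul_zero, add_zero]
      rw [hC4, show -10 * ((u 1 s T + u 1 s T) * v 1 s) = -(10 * ((u 1 s T + u 1 s T) * v 1 s)) by ring]
      refine bd_add (bd_sub (bd_sub ?_ (bd_c 20 (by norm_num) (bd_add (bd_mul b0 v2) (bd_mul b2 v0)))) (bd_c 40 (by norm_num) (bd_mul (bd_add (bd_add (bd_mul b0 b0) (bd_mul b0 b0)) (bd_mul b0 b0)) v0))) (bd_c 240 (by norm_num) (bd_mul hT v0))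
      rw [abs_neg]
      exact bd_c 10 (by norm_num) (bd_mul (bd_add b1 b1) v1)
    linarith
  · have h : k = 5 := by omega
    subst h
    have : |v 5 s| ≤ C5 := by
      rw [hL.h5]
      simp only [zero_mul, mul_zero, add_zero]
      rw [hC5, show -40 * (u 1 s T * v 2 s + u 2 s T * v 1 s) = -(40 * (u 1 s T * v 2 s + u 2 s T * v 1 s)) by ring]
      refine bd_add (bd_sub (bd_sub ?_ (bd_c 20 (by norm_num) (bd_add (bd_mul b0 v3) (bd_mul b3 v0)))) (bd_c 120 (by norm_num) (bd_add (bd_mul (bd_mul b0 b0) v1) (bd_mul (bd_mul (bd_add b0 b0) b1) v0)))) (bd_c 240 (by norm_num) (bd_mul hT v1))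
      rw [abs_neg]
      exact bd_c 40 (by norm_num) (bd_add (bd_mul b1 v2) (bd_mul b2 v1))
    linarith


theorem tendsto_Nv (l : Filter ℕ) (z : ℕ → ℕ → ℝ → ℝ) (y : ℕ → ℝ → ℝ) (T : ℕ → ℝ) (b Y : ℝ)
    (hT : Tendsto T l (𝓝 b)) (h : ∀ k ≤ 3, Tendsto (fun n => z n k Y) l (𝓝 (y k Y))) :
    Tendsto (fun n => Nv (z n) (T n) Y) l (𝓝 (Nv y b Y)) := by
  unfold Nv
  refine tendsto_finsetSum (f := fun k n => |z n k Y| / muf Y (T n) ^ k)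
    (a := fun k => |y k Y| / muf Y b ^ k) _ fun k hk' => ?_
  have hk : k ≤ 3 := by have := Finset.mem_range.mp hk'; omega
  have hm : Tendsto (fun n => muf Y (T n)) l (𝓝 (muf Y b)) := by
    have c : Continuous (fun t => muf Y t) :=
      muf_cont.comp (Continuous.prodMk continuous_const continuous_id)
    exact (c.tendsto b).comp hT
  have h1 : Tendsto (fun n => |z n k Y|) l (𝓝 |y k Y|) := (h k hk).abs
  have h2 : Tendsto (fun n => muf Y (T n) ^ k) l (𝓝 (muf Y b ^ k)) := hm.pow k
  have h3 : muf Y b ^ k ≠ 0 := (pow_pos (muf_pos _ _) _).ne'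
  exact Tendsto.div h1 h2 h3

theorem Nv_congr (v y : ℕ → ℝ → ℝ) (h : ∀ k ≤ 4, v k = y k) (T X : ℝ) : Nv v T X = Nv y T X := by
  unfold Nv
  refine Finset.sum_congr rfl fun k hk => ?_
  rw [h k (by have := Finset.mem_range.mp hk; omega)]

theorem Nv_zero (v : ℕ → ℝ → ℝ) (T X : ℝ) (h : Nv v T X = 0) (k : ℕ) (hk : k ≤ 3) : v k X = 0 := by
  have := Nv_bd v T X k hk
  rw [h, zero_mul] at this
  exact abs_nonpos_iff.mp this

theorem Nv_le_sum (v : ℕ → ℝ → ℝ) (T X : ℝ) : Nv v T X ≤ ∑ k ∈ Finset.range 4, |v k X| := by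
  unfold Nv
  refine Finset.sum_le_sum fun k _ => ?_
  exact div_le_self (abs_nonneg _) (one_le_pow₀ (muf_ge_one _ _))

theorem triv_open (u : ℕ → ℝ → ℝ → ℝ) (hU : USol u)
    (cu : ∀ k, Continuous (fun p : ℝ × ℝ => u k p.1 p.2)) (b : ℝ) (hb : Triv u b) :
    ∃ δ > 0, ∀ T, |T - b| < δ → Triv u T := by
  by_contra hcon
  push Not at hcon
  obtain ⟨M, hM⟩ := norm_exists u hU (b+1)
  have hpos : ∀ n : ℕ, (0:ℝ) < 1 / ((n:ℝ) + 1) := fun n => Nat.one_div_pos_of_nat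
  choose T hT1 hT2 using fun n : ℕ => hcon (1 / ((n:ℝ) + 1)) (hpos n)
  have hT1' : ∀ n, |T n - b| ≤ 1 := fun n => (hT1 n).le.trans (by
    rw [div_le_one (by positivity)]
    have : (0:ℝ) ≤ n := Nat.cast_nonneg n
    linarith)
  choose z x hz hx hz1 hz2 using fun n => hM (T n) (by
    have := (abs_le.mp (hT1' n)).2; linarith) (hT2 n)
  set l : Ultrafilter ℕ := Filter.hyperfilter ℕ with hl
  have hTb : Tendsto T l (𝓝 b) := by
    refine Tendsto.mono_left ?_ Nat.hyperfilter_le_atTop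
    rw [tendsto_iff_norm_sub_tendsto_zero]
    exact squeeze_zero (fun n => norm_nonneg _) (fun n => (hT1 n).le)
      tendsto_one_div_add_atTop_nhds_zero_nat
  have hbd : ∀ R : ℝ, ∃ C, ∀ n s, |s| ≤ R → ∀ k, k ≤ 5 → |z n k s| ≤ C := by
    intro R
    obtain ⟨C, hC⟩ := ker_loc_bd u cu (b-1) (b+1) R 2 (by norm_num)
    refine ⟨C, fun n => hC (T n) (z n) ?_ ?_ (hz n) (hz2 n)⟩
    · have := (abs_le.mp (hT1' n)).1; linarith
    · have := (abs_le.mp (hT1' n)).2; linarith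
  obtain ⟨y, hy, hyd⟩ := ul_chain l z (fun n k hk s => (hz n).hd k hk s) (fun R => by
    obtain ⟨C, hC⟩ := hbd R
    exact ⟨C, Eventually.of_forall hC⟩)
  have hul : ∀ k s, Tendsto (fun n => u k s (T n)) l (𝓝 (u k s b)) := fun k s =>
    ((cu k).tendsto (s, b)).comp (tendsto_const_nhds.prodMk_nhds hTb)
  have hy4 : ∀ X, y 4 X = -20 * u 1 X b * y 1 X - 20 * u 0 X b * y 2 X - 20 * u 2 X b * y 0 X
      - 120 * u 0 X b^2 * y 0 X + 240 * b * y 0 X := by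
    intro X
    refine tendsto_nhds_unique (hy 4 le_rfl X) ?_
    have t0 := hy 0 (by norm_num) X
    have t1 := hy 1 (by norm_num) X
    have t2 := hy 2 (by norm_num) X
    have h := (((((hul 1 X).const_mul (-20)).mul t1).sub (((hul 0 X).const_mul 20).mul t2)).sub
      (((hul 2 X).const_mul 20).mul t0)).sub ((((hul 0 X).pow 2).const_mul 120).mul t0)|>.add
      ((hTb.const_mul 240).mul t0)
    refine h.congr fun n => ?_
    rw [(hz n).h4]; ring
  obtain ⟨v, hv, hvy⟩ := mkLin u hU b y hyd hy4
  have hNy : ∀ Y, Nv y b Y ≤ 2 * Real.exp |Y| := fun Y =>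
    le_of_tendsto (tendsto_Nv l z y T b Y hTb fun k hk => hy k (by omega) Y)
      (Eventually.of_forall fun n => hz2 n Y)
  have h0 : ∀ X, ∀ k ≤ 3, y k X = 0 := by
    intro X k hk
    have h := hb v hv ⟨2, fun X => by rw [Nv_congr v y hvy]; exact hNy X⟩ X
    rw [Nv_congr v y hvy] at h
    exact Nv_zero _ _ _ h k hk
  obtain ⟨xs, hxs⟩ := ul_lim l x M (Eventually.of_forall hx)
  obtain ⟨C, hC⟩ := hbd (max M |xs|)
  have hC0 : 0 ≤ C := (abs_nonneg _).trans (hC 0 xs (le_max_right _ _) 0 (by norm_num))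
  have hlip : ∀ n, ∀ k ≤ 3, |z n k (x n) - z n k xs| ≤ C * |x n - xs| := by
    intro n k hk
    have := Convex.norm_image_sub_le_of_norm_hasDerivWithin_le (f := z n k)
      (f' := z n (k+1)) (C := C) (s := Set.Icc (-(max M |xs|)) (max M |xs|)) (x := xs) (y := x n)
      (fun s _ => ((hz n).hd k (by omega) s).hasDerivWithinAt)
      (fun s hs => hC n s (abs_le.mpr hs) (k+1) (by omega)) (convex_Icc _ _)
      (abs_le.mp (le_max_right _ _)) (abs_le.mp ((hx n).trans (le_max_left _ _)))
    simpa [Real.norm_eq_abs] using this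
  have hzx : ∀ k ≤ 3, Tendsto (fun n => |z n k (x n)|) l (𝓝 0) := by
    intro k hk
    have h1 : Tendsto (fun n => C * |x n - xs| + |z n k xs|) l (𝓝 0) := by
      have a1 := ((hxs.sub_const xs).abs).const_mul C
      have a2 := (hy k (by omega) xs).abs
      have := a1.add a2
      simpa [h0 xs k hk] using this
    refine squeeze_zero (fun n => abs_nonneg _) (fun n => ?_) h1
    have := abs_sub_abs_le_abs_sub (z n k (x n)) (z n k xs)
    linarith [hlip n k hk]
  have hs : Tendsto (fun n => ∑ k ∈ Finset.range 4, |z n k (x n)|) l (𝓝 0) := by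
    have := tendsto_finsetSum (f := fun k n => |z n k (x n)|) (a := fun _ => (0:ℝ)) (x := (l : Filter ℕ)) (Finset.range 4) fun k hk =>
      hzx k (by have := Finset.mem_range.mp hk; omega)
    simpa using this
  have := ge_of_tendsto hs (Eventually.of_forall fun n => (hz1 n).trans (Nv_le_sum _ _ _))
  linarith


structure UTSol (u ut : ℕ → ℝ → ℝ → ℝ) : Prop extends USol u where
  hut : ∀ k X T, HasDerivAt (fun t => u k X t) (ut k X T) T
  hutx : ∀ k X T, HasDerivAt (fun x => ut k x T) (ut (k+1) X T) X
  cu : ∀ k, Continuous (fun p : ℝ × ℝ => u k p.1 p.2)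
  cut : ∀ k, Continuous (fun p : ℝ × ℝ => ut k p.1 p.2)

theorem poly_exp (X T : ℝ) : muf X T^12 ≤ (2 + |T|^3) * Real.exp |X| := by
  rw [muf_pow]
  have h1 := Real.quadratic_le_exp_of_nonneg (abs_nonneg X)
  have h2 : 1 ≤ Real.exp |X| := Real.one_le_exp (abs_nonneg X)
  have h3 : 0 ≤ |T|^3 := by positivity
  have h4 := abs_nonneg X
  rw [sq_abs] at h1
  nlinarith

theorem mu_le12 (X T : ℝ) (j : ℕ) (hj : j ≤ 12) : muf X T^j ≤ muf X T^12 :=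
  pow_le_pow_right₀ (muf_ge_one _ _) hj

theorem dq_lin (u : ℕ → ℝ → ℝ → ℝ) (hU : USol u) (T h : ℝ) (hh : h ≠ 0) :
    LinSol u T (T+h) 1 (fun k X => (u k X (T+h) - u k X T) / h) := by
  refine ⟨fun k _ X => ((hU.hu k X (T+h)).sub (hU.hu k X T)).div_const h, fun X => ?_, fun X => ?_⟩
  · simp only [hU.h4]; field_simp; ring
  · simp only [hU.h5]; field_simp; ring

theorem dq_growth (u : ℕ → ℝ → ℝ → ℝ) (hU : USol u) (T h : ℝ) (hh : h ≠ 0) (h1 : |h| ≤ 1) :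
    ∃ C, ∀ X, Nv (fun k X => (u k X (T+h) - u k X T) / h) T X ≤ C * Real.exp |X| := by
  obtain ⟨C, hC, hb⟩ := lem_apriori u hU.hu hU.h4 hU.h5
  have hhp : 0 < |h| := abs_pos.mpr hh
  refine ⟨4 * ((C * 32 + C) / |h| * (2 + |T|^3)), fun X => ?_⟩
  have key : ∀ k ∈ Finset.range 4, |(u k X (T+h) - u k X T) / h| / muf X T^k ≤
      (C * 32 + C) / |h| * (2 + |T|^3) * Real.exp |X| := by
    intro k hk
    have hk : k ≤ 3 := by have := Finset.mem_range.mp hk; omega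
    have hp := muf_pos X T
    have a1 := hb X (T+h) k hk
    have a2 := hb X T k hk
    have a3 : muf X (T+h) ^ (k+2) ≤ 32 * muf X T^(k+2) := by
      calc muf X (T+h) ^ (k+2) ≤ (2 * muf X T)^(k+2) :=
            pow_le_pow_left₀ (muf_pos _ _).le (muf_near_T X T (T+h) (by simpa using h1)) _
        _ = 2^(k+2) * muf X T^(k+2) := mul_pow _ _ _
        _ ≤ 2^5 * muf X T^(k+2) := by
            gcongr
            · norm_num
            · omega
        _ = _ := by norm_num
    have a4 : |u k X (T+h) - u k X T| ≤ (C * 32 + C) * muf X T^(k+2) := by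
      refine (bd_sub a1 a2).trans ?_
      have := mul_le_mul_of_nonneg_left a3 hC.le
      linarith
    have a5 := (mu_le12 X T 2 (by norm_num)).trans (poly_exp X T)
    rw [abs_div]
    calc _ ≤ (C * 32 + C) * muf X T^(k+2) / |h| / muf X T^k := by gcongr
      _ = (C * 32 + C) / |h| * muf X T^2 := by rw [pow_add]; field_simp
      _ ≤ (C * 32 + C) / |h| * ((2 + |T|^3) * Real.exp |X|) := by gcongr
      _ = _ := by ring
  unfold Nv
  calc _ ≤ ∑ k ∈ Finset.range 4, (C * 32 + C) / |h| * (2 + |T|^3) * Real.exp |X| :=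
        Finset.sum_le_sum key
    _ = _ := by simp; ring

theorem dq_unif (u ut : ℕ → ℝ → ℝ → ℝ) (hU : UTSol u ut) (T : ℝ) :
    ∃ C, ∀ h, h ≠ 0 → |h| ≤ 1 → ∀ Y,
      Nv (fun k X => (u k X (T+h) - u k X T) / h) T Y ≤ C * Real.exp |Y| := by
  obtain ⟨M, hM1, hM⟩ := lem_P' u hU.toUSol T 1 (2 * Real.exp 1)
  choose D hD0 hD using fun k => bdd_on2 _ (hU.cut k) (M^6) (T-1) (T+1)
  set S := ∑ k ∈ Finset.range 4, D k with hS
  have hS0 : 0 ≤ S := Finset.sum_nonneg fun k _ => hD0 k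
  refine ⟨2 * (1 + S), fun h hh h1 Y => ?_⟩
  set v : ℕ → ℝ → ℝ := fun k X => (u k X (T+h) - u k X T) / h with hv
  have hL : LinSol u T (T+h) 1 v := dq_lin u hU.toUSol T h hh
  obtain ⟨C, hC⟩ := dq_growth u hU.toUSol T h hh h1
  rcases (Nv_nonneg v T Y).eq_or_lt with h0 | h0
  · rw [← h0]; positivity
  obtain ⟨x, hx0, hx1, hx2⟩ := nm_abs (Nv v T) C Y hC h0
  have hx : Nv v T x ≤ 1 + S := by
    rcases le_or_gt (Nv v T x) 1 with h3 | h3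
    · linarith
    have hm := hM T (T+h) 1 v x hL le_rfl (by simpa using h1) hx0 (by rw [abs_one]; linarith) hx2
    have hx6 := mu_X6 hm
    have : Nv v T x ≤ S := by
      refine (Nv_le_sum v T x).trans (Finset.sum_le_sum fun k _ => ?_)
      have := Convex.norm_image_sub_le_of_norm_hasDerivWithin_le (f := fun t => u k x t)
        (f' := fun t => ut k x t) (C := D k) (s := Set.Icc (T-1) (T+1)) (x := T) (y := T+h)
        (fun s _ => (hU.hut k x s).hasDerivWithinAt)
        (fun s hs => hD k x s hx6 hs.1 hs.2) (convex_Icc _ _)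
        ⟨by linarith, by linarith⟩ ⟨by linarith [(abs_le.mp h1).1], by linarith [(abs_le.mp h1).2]⟩
      simp only [Real.norm_eq_abs, add_sub_cancel_left] at this
      simp only [hv]
      rw [abs_div, div_le_iff₀ (abs_pos.mpr hh)]
      exact this
    linarith
  have e1 : Real.exp (-|x|) ≤ 1 := Real.exp_le_one_iff.mpr (by simp)
  have h2 : Nv v T x * Real.exp (-|x|) ≤ 1 + S := by
    calc _ ≤ Nv v T x * 1 := by gcongr
      _ ≤ _ := by linarith
  have h3 := hx1 Y
  calc Nv v T Y = Nv v T Y * Real.exp (-|Y|) * Real.exp |Y| := by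
        rw [mul_assoc, ← Real.exp_add]; simp
    _ ≤ _ := mul_le_mul_of_nonneg_right (by linarith) (Real.exp_pos _).le

theorem ut_growth (u ut : ℕ → ℝ → ℝ → ℝ) (hU : UTSol u ut) (T : ℝ) :
    ∃ C, ∀ Y, Nv (fun k X => ut k X T) T Y ≤ C * Real.exp |Y| := by
  obtain ⟨C, hC⟩ := dq_unif u ut hU T
  refine ⟨C, fun Y => ?_⟩
  have hpos : ∀ n : ℕ, (0:ℝ) < 1 / ((n:ℝ) + 1) := fun n => Nat.one_div_pos_of_nat
  have h1 : ∀ n : ℕ, |1 / ((n:ℝ) + 1)| ≤ 1 := fun n => by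
    rw [abs_of_pos (hpos n), div_le_one (by positivity)]
    have : (0:ℝ) ≤ n := Nat.cast_nonneg n
    linarith
  have ht : Tendsto (fun n : ℕ => Nv (fun k X => (u k X (T+1 / ((n:ℝ) + 1)) - u k X T) / (1 / ((n:ℝ) + 1))) T Y)
      atTop (𝓝 (Nv (fun k X => ut k X T) T Y)) := by
    refine tendsto_Nv atTop (fun n k X => (u k X (T+1 / ((n:ℝ) + 1)) - u k X T) / (1 / ((n:ℝ) + 1))) (fun k X => ut k X T) (fun _ => T) T Y tendsto_const_nhds
      fun k _ => ?_
    have hs := (hU.hut k Y T).tendsto_slope_zero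
    have h0 : Tendsto (fun n : ℕ => 1 / ((n:ℝ) + 1)) atTop (𝓝[≠] 0) :=
      tendsto_nhdsWithin_iff.mpr ⟨tendsto_one_div_add_atTop_nhds_zero_nat,
        Eventually.of_forall fun n => (hpos n).ne'⟩
    refine (hs.comp h0).congr fun n => ?_
    simp only [Function.comp, smul_eq_mul]
    exact (div_eq_inv_mul _ _).symm
  exact le_of_tendsto ht (Eventually.of_forall fun n => hC _ (hpos n).ne' (h1 n) Y)


theorem USol.h6 {u : ℕ → ℝ → ℝ → ℝ} (hU : USol u) (X T : ℝ) :
    u 6 X T = -40 * u 2 X T * u 2 X T - 60 * u 1 X T * u 3 X T - 20 * u 0 X T * u 4 X T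
      - 240 * u 0 X T * u 1 X T^2 - 120 * u 0 X T^2 * u 2 X T + 240 * T * u 2 X T := by
  have e : (fun x => u 5 x T) = fun X => -40 * u 1 X T * u 2 X T - 20 * u 0 X T * u 3 X T
      - 120 * u 0 X T^2 * u 1 X T + 240 * T * u 1 X T - 240 := funext fun x => hU.h5 x T
  have h := hU.hu 5 X T
  rw [e] at h
  have u0 := hU.hu 0 X T
  have u1 := hU.hu 1 X T
  have u2 := hU.hu 2 X T
  have u3 := hU.hu 3 X T
  have h' := (((((u1.const_mul (-40)).mul u2).sub ((u0.const_mul 20).mul u3)).sub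
    (((u0.pow 2).const_mul 120).mul u1)).add (u1.const_mul (240*T))).sub_const 240
  rw [h.unique h']
  simp
  ring

theorem USol.h7 {u : ℕ → ℝ → ℝ → ℝ} (hU : USol u) (X T : ℝ) :
    u 7 X T = -140 * u 2 X T * u 3 X T - 80 * u 1 X T * u 4 X T - 20 * u 0 X T * u 5 X T
      - 240 * u 1 X T^3 - 720 * u 0 X T * u 1 X T * u 2 X T - 120 * u 0 X T^2 * u 3 X T
      + 240 * T * u 3 X T := by
  have e : (fun x => u 6 x T) = fun X => -40 * u 2 X T * u 2 X T - 60 * u 1 X T * u 3 X T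
      - 20 * u 0 X T * u 4 X T
      - 240 * u 0 X T * u 1 X T^2 - 120 * u 0 X T^2 * u 2 X T + 240 * T * u 2 X T :=
    funext fun x => hU.h6 x T
  have h := hU.hu 6 X T
  rw [e] at h
  have u0 := hU.hu 0 X T
  have u1 := hU.hu 1 X T
  have u2 := hU.hu 2 X T
  have u3 := hU.hu 3 X T
  have u4 := hU.hu 4 X T
  have h' := ((((((u2.const_mul (-40)).mul u2).sub ((u1.const_mul 60).mul u3)).sub
    ((u0.const_mul 20).mul u4)).sub ((u0.const_mul 240).mul (u1.pow 2))).sub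
    (((u0.pow 2).const_mul 120).mul u2)).add (u2.const_mul (240*T))
  rw [h.unique h']
  simp
  ring

theorem UTSol.ht4 {u ut : ℕ → ℝ → ℝ → ℝ} (hU : UTSol u ut) (X T : ℝ) :
    ut 4 X T = -20 * u 1 X T * ut 1 X T - 20 * ut 0 X T * u 2 X T - 20 * u 0 X T * ut 2 X T
      - 120 * u 0 X T^2 * ut 0 X T + 240 * u 0 X T + 240 * T * ut 0 X T := by
  have e : (fun t => u 4 X t) = fun T => -10 * u 1 X T^2 - 20 * u 0 X T * u 2 X T - 40 * u 0 X T^3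
      + 240 * T * u 0 X T - 240 * X := funext fun t => hU.h4 X t
  have h := hU.hut 4 X T
  rw [e] at h
  have u0 := hU.hut 0 X T
  have u1 := hU.hut 1 X T
  have u2 := hU.hut 2 X T
  have h' := (((((u1.pow 2).const_mul (-10)).sub ((u0.const_mul 20).mul u2)).sub
    ((u0.pow 3).const_mul 40)).add (((hasDerivAt_id T).const_mul 240).mul u0)).sub_const (240 * X)
  rw [h.unique h']
  simp
  ring

/-- the non-T part of the KdV operator and its X-derivatives -/
noncomputable def qk (u : ℕ → ℝ → ℝ → ℝ) (T : ℝ) : ℕ → ℝ → ℝ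
  | 0, X => u 0 X T * u 1 X T + u 3 X T / 12
  | 1, X => u 1 X T * u 1 X T + u 0 X T * u 2 X T + u 4 X T / 12
  | 2, X => 3 * (u 1 X T * u 2 X T) + u 0 X T * u 3 X T + u 5 X T / 12
  | 3, X => 3 * (u 2 X T * u 2 X T) + 4 * (u 1 X T * u 3 X T) + u 0 X T * u 4 X T + u 6 X T / 12
  | _, X => 10 * (u 2 X T * u 3 X T) + 5 * (u 1 X T * u 4 X T) + u 0 X T * u 5 X T + u 7 X T / 12

theorem qk_deriv {u : ℕ → ℝ → ℝ → ℝ} (hU : USol u) (T : ℝ) (k : ℕ) (hk : k ≤ 3) (X : ℝ) :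
    HasDerivAt (qk u T k) (qk u T (k+1) X) X := by
  have d0 := hU.hu 0 X T
  have d1 := hU.hu 1 X T
  have d2 := hU.hu 2 X T
  have d3 := hU.hu 3 X T
  have d4 := hU.hu 4 X T
  have d5 := hU.hu 5 X T
  have d6 := hU.hu 6 X T
  interval_cases k
  · exact ((d0.mul d1).add (d3.div_const 12)).congr_deriv (by simp only [qk])
  · exact (((d1.mul d1).add (d0.mul d2)).add (d4.div_const 12)).congr_deriv (by simp only [qk]; ring)
  · exact ((((d1.mul d2).const_mul 3).add (d0.mul d3)).add (d5.div_const 12)).congr_deriv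
      (by simp only [qk]; ring)
  · exact (((((d2.mul d2).const_mul 3).add ((d1.mul d3).const_mul 4)).add (d0.mul d4)).add
      (d6.div_const 12)).congr_deriv (by simp only [qk]; ring)

theorem qk_growth {u : ℕ → ℝ → ℝ → ℝ} (hU : USol u) :
    ∃ D, ∀ X T, ∀ k ≤ 3, |qk u T k X| ≤ D * muf X T^(k+5) := by
  obtain ⟨C, hC, hb⟩ := lem_apriori u hU.hu hU.h4 hU.h5
  set D4 := 30 * C^2 + 40 * C^3 + 240 * C + 240 with hD4
  set D5 := 60 * C^2 + 120 * C^3 + 240 * C + 240 with hD5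
  set D6 := 100 * C^2 + 20 * C * D4 + 360 * C^3 + 240 * C with hD6
  have p4 : 0 ≤ D4 := by positivity
  have p5 : 0 ≤ D5 := by positivity
  have p6 : 0 ≤ D6 := by positivity
  refine ⟨(C^2 + C/12) + (2 * C^2 + D4/12) + (4 * C^2 + D5/12) + (7 * C^2 + C * D4 + D6/12),
    fun X T k hk => ?_⟩
  have b0 := hb X T 0 (by norm_num)
  have b1 := hb X T 1 (by norm_num)
  have b2 := hb X T 2 (by norm_num)
  have b3 := hb X T 3 (by norm_num)
  have bT := muf_T X T
  have bX := muf_X X T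
  have hm1 := muf_ge_one X T
  set m := muf X T with hm
  have hm0 : 0 < m := muf_pos X T
  norm_num at b0 b1 b2 b3
  have b4 : |u 4 X T| ≤ D4 * m^6 := by
    rw [hU.h4, show -10 * u 1 X T^2 - 20 * u 0 X T * u 2 X T - 40 * u 0 X T^3
      + 240 * T * u 0 X T - 240 * X = 240 * (T * u 0 X T) - 10 * (u 1 X T * u 1 X T)
       - 20 * (u 0 X T * u 2 X T) - 40 * (u 0 X T * u 0 X T * u 0 X T) - 240 * X by ring]
    refine (bd_sub (bd_sub (bd_sub (bd_sub (bd_c 240 (by norm_num) (bd_mul bT b0))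
      (bd_c 10 (by norm_num) (bd_mul b1 b1))) (bd_c 20 (by norm_num) (bd_mul b0 b2)))
      (bd_c 40 (by norm_num) (bd_mul (bd_mul b0 b0) b0))) (bd_c 240 (by norm_num) bX)).trans_eq ?_
    rw [hD4]; ring
  have b5 : |u 5 X T| ≤ D5 * m^7 := by
    rw [hU.h5, show -40 * u 1 X T * u 2 X T - 20 * u 0 X T * u 3 X T
      - 120 * u 0 X T^2 * u 1 X T + 240 * T * u 1 X T - 240 = 240 * (T * u 1 X T)
       - 40 * (u 1 X T * u 2 X T) - 20 * (u 0 X T * u 3 X T) - 120 * (u 0 X T * u 0 X T * u 1 X T)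
       - 240 by ring]
    have b240 : |(240:ℝ)| ≤ 240 * m^7 := by
      rw [abs_of_pos (by norm_num)]
      have : 1 ≤ m^7 := one_le_pow₀ hm1
      linarith
    refine (bd_sub (bd_sub (bd_sub (bd_sub (bd_c 240 (by norm_num) (bd_mul bT b1))
      (bd_c 40 (by norm_num) (bd_mul b1 b2))) (bd_c 20 (by norm_num) (bd_mul b0 b3)))
      (bd_c 120 (by norm_num) (bd_mul (bd_mul b0 b0) b1))) b240).trans_eq ?_
    rw [hD5]; ring
  have b6 : |u 6 X T| ≤ D6 * m^8 := by
    rw [hU.h6, show -40 * u 2 X T * u 2 X T - 60 * u 1 X T * u 3 X T - 20 * u 0 X T * u 4 X T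
      - 240 * u 0 X T * u 1 X T^2 - 120 * u 0 X T^2 * u 2 X T + 240 * T * u 2 X T =
      240 * (T * u 2 X T) - 40 * (u 2 X T * u 2 X T) - 60 * (u 1 X T * u 3 X T)
      - 20 * (u 0 X T * u 4 X T) - 240 * (u 0 X T * u 1 X T * u 1 X T)
      - 120 * (u 0 X T * u 0 X T * u 2 X T) by ring]
    refine (bd_sub (bd_sub (bd_sub (bd_sub (bd_sub (bd_c 240 (by norm_num) (bd_mul bT b2))
      (bd_c 40 (by norm_num) (bd_mul b2 b2))) (bd_c 60 (by norm_num) (bd_mul b1 b3)))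
      (bd_c 20 (by norm_num) (bd_mul b0 b4))) (bd_c 240 (by norm_num) (bd_mul (bd_mul b0 b1) b1)))
      (bd_c 120 (by norm_num) (bd_mul (bd_mul b0 b0) b2))).trans_eq ?_
    rw [hD6]; ring
  have bdiv : ∀ a A : ℝ, |a| ≤ A → |a / 12| ≤ A / 12 := fun a A h => by
    rw [abs_div, abs_of_pos (show (0:ℝ) < 12 by norm_num)]; linarith
  have e0 : 0 ≤ C^2 + C/12 := by positivity
  have e1 : 0 ≤ 2 * C^2 + D4/12 := by positivity
  have e2 : 0 ≤ 4 * C^2 + D5/12 := by positivity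
  have e3 : 0 ≤ 7 * C^2 + C * D4 + D6/12 := by positivity
  have hmk : 0 < m^(k+5) := by positivity
  suffices h : |qk u T k X| ≤ (C^2 + C/12) * m^(k+5) ∨ |qk u T k X| ≤ (2 * C^2 + D4/12) * m^(k+5) ∨
     |qk u T k X| ≤ (4 * C^2 + D5/12) * m^(k+5) ∨ |qk u T k X| ≤ (7 * C^2 + C * D4 + D6/12) * m^(k+5) by
    rcases h with h | h | h | h <;> refine h.trans (mul_le_mul_of_nonneg_right ?_ hmk.le) <;> linarith
  interval_cases k
  · left
    refine (bd_add (bd_mul b0 b1) (bdiv _ _ b3)).trans_eq ?_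
    ring
  · right; left
    refine (bd_add (bd_add (bd_mul b1 b1) (bd_mul b0 b2)) (bdiv _ _ b4)).trans_eq ?_
    ring
  · right; right; left
    refine (bd_add (bd_add (bd_c 3 (by norm_num) (bd_mul b1 b2)) (bd_mul b0 b3)) (bdiv _ _ b5)).trans_eq ?_
    ring
  · right; right; right
    refine (bd_add (bd_add (bd_add (bd_c 3 (by norm_num) (bd_mul b2 b2)) (bd_c 4 (by norm_num) (bd_mul b1 b3))) (bd_mul b0 b4)) (bdiv _ _ b6)).trans_eq ?_
    ring

noncomputable def Wk (u ut : ℕ → ℝ → ℝ → ℝ) (T : ℝ) (k : ℕ) (X : ℝ) : ℝ := ut k X T + qk u T k X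

theorem W_zero {u ut : ℕ → ℝ → ℝ → ℝ} (hU : UTSol u ut) (T : ℝ) (hT : Triv u T) :
    ∀ k ≤ 3, ∀ X, ut k X T + qk u T k X = 0 := by
  obtain ⟨C, hC⟩ := ut_growth u ut hU T
  obtain ⟨D, hD⟩ := qk_growth hU.toUSol
  have hD0 : 0 ≤ D := by
    have := (abs_nonneg _).trans (hD 0 0 0 (by norm_num))
    have h2 := pow_pos (muf_pos 0 0) 5
    by_contra hh
    push Not at hh
    have h3 := mul_neg_of_neg_of_pos hh h2
    rw [zero_add] at this
    linarith
  obtain ⟨v, hv, hvW⟩ := mkLin u hU.toUSol T (Wk u ut T)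
    (fun k hk X => (hU.hutx k X T).add (qk_deriv hU.toUSol T k hk X)) (by
      intro X
      simp only [Wk, qk]
      rw [hU.ht4, hU.h7, hU.h5, hU.h4]
      ring)
  have hN : ∀ X, Nv v T X ≤ (C + 4 * (D * (2 + |T|^3))) * Real.exp |X| := by
    intro X
    rw [Nv_congr v _ hvW]
    have h1 : Nv (Wk u ut T) T X ≤ Nv (fun k X => ut k X T) T X +
        ∑ k ∈ Finset.range 4, D * (2 + |T|^3) * Real.exp |X| := by
      unfold Nv
      rw [← Finset.sum_add_distrib]
      refine Finset.sum_le_sum fun k hk => ?_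
      have hk : k ≤ 3 := by have := Finset.mem_range.mp hk; omega
      have hp := muf_pos X T
      have a1 : |Wk u ut T k X| ≤ |ut k X T| + |qk u T k X| := abs_add_le _ _
      have a2 : |qk u T k X| / muf X T^k ≤ D * (2 + |T|^3) * Real.exp |X| := by
        calc _ ≤ D * muf X T^(k+5) / muf X T^k := by gcongr; exact hD X T k hk
          _ = D * muf X T^5 := by rw [pow_add]; field_simp
          _ ≤ D * ((2 + |T|^3) * Real.exp |X|) := by
              gcongr
              exact (mu_le12 X T 5 (by norm_num)).trans (poly_exp X T)
          _ = _ := by ring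
      calc _ ≤ (|ut k X T| + |qk u T k X|) / muf X T^k := by gcongr
        _ = |ut k X T| / muf X T^k + |qk u T k X| / muf X T^k := add_div _ _ _
        _ ≤ _ := by linarith
    have h2 := hC X
    simp at h1
    linarith
  intro k hk X
  have h := hT v hv ⟨_, hN⟩ X
  have := Nv_zero v T X h k hk
  rw [hvW k (by omega)] at this
  exact this


section
variable {E : Type*} [NormedAddCommGroup E] [NormedSpace ℝ E] [CompleteSpace E]

noncomputable def picY (L : ℝ → E →L[ℝ] E) (b : ℝ) (y0 : E) : ℕ → ℝ → E
  | 0 => fun _ => y0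
  | n+1 => fun t => ∫ s in b..t, L s (picY L b y0 n s)

theorem picY_cont (L : ℝ → E →L[ℝ] E) (hL : Continuous L) (b : ℝ) (y0 : E) (n : ℕ) :
    Continuous (picY L b y0 n) := by
  induction n with
  | zero => exact continuous_const
  | succ n ih =>
    have : Continuous fun s => L s (picY L b y0 n s) := hL.clm_apply ih
    exact intervalIntegral.continuous_primitive (fun a b => this.intervalIntegrable a b) b

theorem picY_deriv (L : ℝ → E →L[ℝ] E) (hL : Continuous L) (b : ℝ) (y0 : E) (n : ℕ) (t : ℝ) :
    HasDerivAt (picY L b y0 (n+1)) (L t (picY L b y0 n t)) t := by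
  have : Continuous fun s => L s (picY L b y0 n s) := hL.clm_apply (picY_cont L hL b y0 n)
  exact intervalIntegral.integral_hasDerivAt_right (this.intervalIntegrable _ _)
    this.aestronglyMeasurable.stronglyMeasurableAtFilter this.continuousAt

theorem picY_bd (L : ℝ → E →L[ℝ] E) (hL : Continuous L) (b : ℝ) (y0 : E) (M R : ℝ) (hM : 0 ≤ M)
    (hb : ∀ t, |t - b| ≤ R → ‖L t‖ ≤ M) (n : ℕ) (t : ℝ) (ht : |t - b| ≤ R) :
    ‖picY L b y0 n t‖ ≤ ‖y0‖ * (M * |t - b|)^n / n.factorial := by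
  induction n generalizing t with
  | zero => simp [picY]
  | succ n ih =>
    have hc : Continuous fun s => L s (picY L b y0 n s) := hL.clm_apply (picY_cont L hL b y0 n)
    calc ‖picY L b y0 (n+1) t‖ ≤ ∫ s in Set.uIoc b t, ‖L s (picY L b y0 n s)‖ :=
          intervalIntegral.norm_integral_le_integral_norm_uIoc
      _ ≤ ∫ s in Set.uIoc b t, (‖y0‖ * M^(n+1) / n.factorial) * |s - b|^n := by
          refine MeasureTheory.setIntegral_mono_on ?_ ?_ measurableSet_uIoc ?_
          · exact (intervalIntegrable_iff.mp (hc.norm.intervalIntegrable b t))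
          · exact (intervalIntegrable_iff.mp ((by fun_prop : Continuous fun s : ℝ => (‖y0‖ * M^(n+1) / n.factorial) * |s - b|^n).intervalIntegrable b t))
          · intro s hs
            have hsR : |s - b| ≤ R := by
              refine le_trans ?_ ht
              exact Set.abs_sub_left_of_mem_uIcc (Set.uIoc_subset_uIcc hs)
            calc ‖L s (picY L b y0 n s)‖ ≤ ‖L s‖ * ‖picY L b y0 n s‖ := (L s).le_opNorm _
              _ ≤ M * (‖y0‖ * (M * |s - b|)^n / n.factorial) := by
                  gcongr
                  · exact hb s hsR
                  · exact ih s hsR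
              _ = _ := by rw [mul_pow, pow_succ]; ring
      _ = (‖y0‖ * M^(n+1) / n.factorial) * (|t - b|^(n+1) / (n+1)) := by
          rw [MeasureTheory.integral_const_mul, integral_pow_abs_sub_uIoc]
      _ = _ := by
          rw [Nat.factorial_succ, mul_pow]; push_cast; field_simp

theorem lin_ode (L : ℝ → E →L[ℝ] E) (hL : Continuous L) (b : ℝ) (y0 : E) :
    ∃ y : ℝ → E, y b = y0 ∧ ∀ t, HasDerivAt y (L t (y t)) t := by
  have hloc : ∀ R : ℝ, ∃ M, 0 ≤ M ∧ ∀ t, |t - b| ≤ R → ‖L t‖ ≤ M := by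
    intro R
    obtain ⟨D, hD⟩ := (isCompact_Icc (a := b-R) (b := b+R)).exists_bound_of_continuousOn hL.continuousOn
    refine ⟨max D 0, le_max_right _ _, fun t ht => (hD t ?_).trans (le_max_left _ _)⟩
    have := abs_le.mp ht
    constructor <;> linarith
  have hb0 : ∀ n, picY L b y0 (n+1) b = 0 := fun n => by simp [picY]
  have hsum : ∀ t, Summable fun n => picY L b y0 n t := by
    intro t
    obtain ⟨M, hM0, hM⟩ := hloc |t - b|
    refine Summable.of_norm_bounded (g := fun n => ‖y0‖ * ((M * |t - b|)^n / n.factorial))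
      ((Real.summable_pow_div_factorial _).mul_left _) fun n => ?_
    have := picY_bd L hL b y0 M _ hM0 hM n t le_rfl
    rwa [mul_div_assoc] at this
  refine ⟨fun t => ∑' n, picY L b y0 n t, ?_, fun t => ?_⟩
  · dsimp only
    rw [(hsum b).tsum_eq_zero_add]
    simp [hb0, picY]
  · set R := |t - b| + 1 with hR
    obtain ⟨M, hM0, hM⟩ := hloc R
    have hR0 : 0 ≤ R := by positivity
    have hd := hasDerivAt_tsum_of_isPreconnected (g := fun n => picY L b y0 (n+1))
      (g' := fun n t => L t (picY L b y0 n t))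
      (u := fun n => M * (‖y0‖ * ((M * R)^n / n.factorial))) (t := Metric.ball b R) (y₀ := b) (y := t)
      (((Real.summable_pow_div_factorial _).mul_left _).mul_left _) Metric.isOpen_ball
      (convex_ball b R).isPreconnected (fun n y _ => picY_deriv L hL b y0 n y)
      (fun n y hy => by
        rw [Metric.mem_ball, Real.dist_eq] at hy
        calc ‖L y (picY L b y0 n y)‖ ≤ ‖L y‖ * ‖picY L b y0 n y‖ := (L y).le_opNorm _
          _ ≤ M * (‖y0‖ * ((M * R)^n / n.factorial)) := by
            refine mul_le_mul (hM y hy.le) ?_ (norm_nonneg _) hM0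
            refine (picY_bd L hL b y0 M R hM0 hM n y hy.le).trans ?_
            rw [mul_div_assoc]
            gcongr)
      (Metric.mem_ball_self (by positivity))
      (by simp only [hb0]; exact summable_zero) (by rw [Metric.mem_ball, Real.dist_eq]; linarith)
    have e1 : (fun t => ∑' n, picY L b y0 n t) = fun t => y0 + ∑' n, picY L b y0 (n+1) t := by
      funext t
      rw [(hsum t).tsum_eq_zero_add]; rfl
    rw [e1]
    refine (hd.const_add y0).congr_deriv ?_
    rw [← (L t).map_tsum (hsum t)]
    rw [(hsum t).tsum_eq_zero_add]; rfl

theorem gron_fwd (f f' : ℝ → E) (hf : ∀ t, HasDerivAt f (f' t) t) (a b δ K ε : ℝ) (hab : a ≤ b)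
    (hK : 1 ≤ K) (hε : 0 ≤ ε) (ha : ‖f a‖ ≤ δ)
    (h : ∀ t, a ≤ t → t ≤ b → ‖f' t‖ ≤ K * ‖f t‖ + ε) : ‖f b‖ ≤ (δ + ε) * Real.exp (K * (b - a)) := by
  have h1 := norm_le_gronwallBound_of_norm_deriv_right_le (f := f) (f' := f') (δ := δ) (K := K)
    (ε := ε) (a := a) (b := b) (fun t _ => (hf t).continuousAt.continuousWithinAt)
    (fun t _ => (hf t).hasDerivWithinAt) ha (fun t ht => h t ht.1 ht.2.le) b ⟨hab, le_rfl⟩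
  refine h1.trans ?_
  rw [gronwallBound_of_K_ne_0 (by linarith)]
  have e1 : 1 ≤ Real.exp (K * (b - a)) := Real.one_le_exp (mul_nonneg (by linarith) (by linarith))
  have e2 : ε / K ≤ ε := div_le_self hε hK
  have e3 : ε / K * (Real.exp (K * (b - a)) - 1) ≤ ε * (Real.exp (K * (b - a)) - 1) :=
    mul_le_mul_of_nonneg_right e2 (by linarith)
  nlinarith

theorem gron_bwd (f f' : ℝ → E) (hf : ∀ t, HasDerivAt f (f' t) t) (a b δ K ε : ℝ) (hab : a ≤ b)
    (hK : 1 ≤ K) (hε : 0 ≤ ε) (hb : ‖f b‖ ≤ δ)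
    (h : ∀ t, a ≤ t → t ≤ b → ‖f' t‖ ≤ K * ‖f t‖ + ε) : ‖f a‖ ≤ (δ + ε) * Real.exp (K * (b - a)) := by
  have := gron_fwd (fun s => f (a + b - s)) (fun s => - f' (a + b - s)) (fun s => by
    have := (hf (a+b-s)).scomp s ((hasDerivAt_id s).const_sub (a+b))
    exact this.congr_deriv (by simp)) a b δ K ε hab hK hε (by simpa using hb) (fun t h1 h2 => by
      rw [norm_neg]; exact h _ (by linarith) (by linarith))
  simpa using this
end


section
variable {E : Type*} [NormedAddCommGroup E] [NormedSpace ℝ E] [CompleteSpace E]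

theorem bddF {F : Type*} [NormedAddCommGroup F] (f : ℝ → ℝ → F)
    (hf : Continuous (fun p : ℝ × ℝ => f p.1 p.2)) (X a b : ℝ) :
    ∃ D, 0 ≤ D ∧ ∀ x t, |x - X| ≤ 1 → a ≤ t → t ≤ b → ‖f x t‖ ≤ D := by
  obtain ⟨D, hD⟩ := ((isCompact_Icc (a := X - 1) (b := X + 1)).prod
    (isCompact_Icc (a := a) (b := b))).exists_bound_of_continuousOn hf.continuousOn
  exact ⟨max D 0, le_max_right _ _, fun x t hx h1 h2 =>
    (hD (x, t) ⟨⟨by linarith [(abs_le.mp hx).1], by linarith [(abs_le.mp hx).2]⟩, h1, h2⟩).trans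
      (le_max_left _ _)⟩

theorem mv1 {F : Type*} [NormedAddCommGroup F] [NormedSpace ℝ F] (f f' : ℝ → F)
    (hf : ∀ x, HasDerivAt f (f' x) x) (X C h : ℝ)
    (hb : ∀ x, |x - X| ≤ |h| → ‖f' x‖ ≤ C) : ‖f (X + h) - f X‖ ≤ C * |h| := by
  have := Convex.norm_image_sub_le_of_norm_hasDerivWithin_le (f := f)
    (f' := f') (C := C) (s := Set.Icc (X - |h|) (X + |h|)) (x := X) (y := X + h)
    (fun s _ => (hf s).hasDerivWithinAt)
    (fun s hs => hb s (abs_le.mpr ⟨by linarith [hs.1], by linarith [hs.2]⟩)) (convex_Icc _ _)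
    ⟨by linarith [abs_nonneg h], by linarith [abs_nonneg h]⟩
    ⟨by linarith [neg_abs_le h], by linarith [le_abs_self h]⟩
  simpa using this

theorem mv2 {F : Type*} [NormedAddCommGroup F] [NormedSpace ℝ F] (f f1 f2 : ℝ → F)
    (hf : ∀ x, HasDerivAt f (f1 x) x) (hf1 : ∀ x, HasDerivAt f1 (f2 x) x) (X C h : ℝ) (hC : 0 ≤ C)
    (hb : ∀ x, |x - X| ≤ |h| → ‖f2 x‖ ≤ C) : ‖f (X + h) - f X - h • f1 X‖ ≤ C * |h| * |h| := by
  have := mv1 (fun x => f x - (x - X) • f1 X) (fun x => f1 x - f1 X) (fun x => by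
    have h1 := ((hasDerivAt_id x).sub_const X).smul_const (f1 X)
    exact ((hf x).sub h1).congr_deriv (by simp)) X (C * |h|) h (fun x hx => by
      have := mv1 f1 f2 hf1 X C (x - X) (fun z hz => hb z (hz.trans hx))
      simp only [add_sub_cancel] at this
      exact this.trans (by gcongr))
  simp only [add_sub_cancel_left, sub_self, zero_smul, sub_zero] at this
  convert this using 2
  abel

theorem transport (A A' B B1 B2 : ℝ → ℝ → E →L[ℝ] E)
    (hA : ∀ X T, HasDerivAt (fun t => A X t) (A' X T) T)
    (hB1 : ∀ X T, HasDerivAt (fun x => B x T) (B1 X T) X)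
    (hB2 : ∀ X T, HasDerivAt (fun x => B1 x T) (B2 X T) X)
    (cA : Continuous (fun p : ℝ × ℝ => A p.1 p.2)) (cB : Continuous (fun p : ℝ × ℝ => B p.1 p.2))
    (cB1 : Continuous (fun p : ℝ × ℝ => B1 p.1 p.2)) (cB2 : Continuous (fun p : ℝ × ℝ => B2 p.1 p.2))
    (a b : ℝ) (hab : a ≤ b)
    (zc : ∀ X T, a ≤ T → T ≤ b → ∀ w, A' X T w + A X T (B X T w) = B1 X T w + B X T (A X T w))
    (v : ℝ → E) (hv : ∀ X, HasDerivAt v (A X b (v X)) X) :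
    ∃ y : ℝ → ℝ → E, (∀ X, y X b = v X) ∧ (∀ X T, HasDerivAt (y X) (B X T (y X T)) T) ∧
      ∀ X, HasDerivAt (fun x => y x a) (A X a (y X a)) X := by
  have cBX : ∀ X, Continuous (fun t => B X t) := fun X =>
    cB.comp (Continuous.prodMk continuous_const continuous_id)
  choose y hyb hyd using fun X => lin_ode (B X) (cBX X) b (v X)
  refine ⟨y, hyb, hyd, fun X => ?_⟩
  obtain ⟨M', hM'0, hM'⟩ := bddF B cB X a b
  obtain ⟨MA, hMA0, hMA⟩ := bddF A cA X a b
  obtain ⟨C1, hC10, hC1⟩ := bddF B1 cB1 X a b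
  obtain ⟨C2, hC20, hC2⟩ := bddF B2 cB2 X a b
  have cy : Continuous (y X) := continuous_iff_continuousAt.mpr fun t => (hyd X t).continuousAt
  obtain ⟨N', hN'⟩ := (isCompact_Icc (a := a) (b := b)).exists_bound_of_continuousOn cy.continuousOn
  set N := max N' 0 with hN
  have hN0 : 0 ≤ N := le_max_right _ _
  have hNy : ∀ t, a ≤ t → t ≤ b → ‖y X t‖ ≤ N := fun t h1 h2 => (hN' t ⟨h1, h2⟩).trans (le_max_left _ _)
  set M := M' + 1 with hM
  set Q := C2 * N + C1 * (MA * N) with hQ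
  have hQ0 : 0 ≤ Q := by positivity
  set E0 := Real.exp (M * (b - a)) with hE0
  have hE0p : 0 < E0 := Real.exp_pos _
  rw [hasDerivAt_iff_isLittleO_nhds_zero, Asymptotics.isLittleO_iff]
  intro c hc
  have hvX := (hv X)
  rw [hasDerivAt_iff_isLittleO_nhds_zero, Asymptotics.isLittleO_iff] at hvX
  have ev1 := hvX (show 0 < c / (2 * E0) by positivity)
  have ev2 : ∀ᶠ h : ℝ in 𝓝 0, |h| < min 1 (c / (2 * E0 * (Q + 1))) := by
    have := Metric.ball_mem_nhds (0:ℝ) (show 0 < min 1 (c / (2 * E0 * (Q + 1))) by positivity)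
    filter_upwards [this] with h hh
    simpa using hh
  filter_upwards [ev1, ev2] with h h1 h2
  have h3 : |h| ≤ 1 := h2.le.trans (min_le_left _ _)
  have h4 : |h| ≤ c / (2 * E0 * (Q + 1)) := h2.le.trans (min_le_right _ _)
  have key := gron_bwd (fun T => y (X+h) T - y X T - h • A X T (y X T))
    (fun T => B (X+h) T (y (X+h) T) - B X T (y X T) - h • (A' X T (y X T) + A X T (B X T (y X T))))
    (fun T => ((hyd (X+h) T).sub (hyd X T)).sub (((hA X T).clm_apply (hyd X T)).const_smul h))
    a b (c / (2 * E0) * ‖h‖) M (Q * |h| * |h|) hab (by linarith) (by positivity)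
    (by simpa only [hyb] using h1) (fun T ha hb => by
      have e : B (X+h) T (y (X+h) T) - B X T (y X T) - h • (A' X T (y X T) + A X T (B X T (y X T)))
        = B (X+h) T (y (X+h) T - y X T - h • A X T (y X T))
          + ((B (X+h) T - B X T - h • B1 X T) (y X T) + h • (B (X+h) T - B X T) (A X T (y X T))) := by
        rw [zc X T ha hb]
        simp only [map_sub, map_smul, ContinuousLinearMap.sub_apply, ContinuousLinearMap.smul_apply,
          smul_add, smul_sub]
        abel
      rw [e]
      have n1 : ‖B (X+h) T‖ ≤ M := (hM' _ _ (by simpa using h3) ha hb).trans (by linarith)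
      have n2 : ‖B (X+h) T - B X T - h • B1 X T‖ ≤ C2 * |h| * |h| :=
        mv2 (fun x => B x T) (fun x => B1 x T) (fun x => B2 x T) (fun x => hB1 x T)
          (fun x => hB2 x T) X C2 h hC20 (fun x hx => hC2 x T (hx.trans h3) ha hb)
      have n3 : ‖B (X+h) T - B X T‖ ≤ C1 * |h| :=
        mv1 (fun x => B x T) (fun x => B1 x T) (fun x => hB1 x T) X C1 h
          (fun x hx => hC1 x T (hx.trans h3) ha hb)
      have n4 := hMA X T (by simp) ha hb
      have n5 := hNy T ha hb
      have n6 : ‖A X T (y X T)‖ ≤ MA * N := ((A X T).le_opNorm _).trans (by gcongr)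
      have m1 : ‖B (X+h) T (y (X+h) T - y X T - h • A X T (y X T))‖ ≤
          M * ‖y (X+h) T - y X T - h • A X T (y X T)‖ :=
        ((B (X+h) T).le_opNorm _).trans (by gcongr)
      have m2 : ‖(B (X+h) T - B X T - h • B1 X T) (y X T)‖ ≤ C2 * |h| * |h| * N :=
        (ContinuousLinearMap.le_opNorm _ _).trans (by gcongr)
      have m3 : ‖h • (B (X+h) T - B X T) (A X T (y X T))‖ ≤ |h| * (C1 * |h| * (MA * N)) := by
        rw [norm_smul, Real.norm_eq_abs]
        gcongr
        exact (ContinuousLinearMap.le_opNorm _ _).trans (by gcongr)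
      refine (norm_add_le _ _).trans ((add_le_add m1 ((norm_add_le _ _).trans (add_le_add m2 m3))).trans_eq ?_)
      rw [hQ]; ring)
  refine key.trans ?_
  rw [← hE0, Real.norm_eq_abs]
  have hk : Q * |h| * |h| * E0 ≤ c / 2 * |h| := by
    rw [le_div_iff₀ (by positivity)] at h4
    have := abs_nonneg h
    nlinarith [mul_nonneg this this, mul_nonneg (mul_nonneg this this) hE0p.le, mul_le_mul_of_nonneg_right h4 this]
  have e2 : c / (2 * E0) * |h| * E0 = c / 2 * |h| := by field_simp
  calc _ = c / (2 * E0) * |h| * E0 + Q * |h| * |h| * E0 := by ring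
    _ ≤ c * |h| := by rw [e2]; linarith
end


theorem bd_cn {a A : ℝ} (c : ℝ) (hc : c ≤ 0) (ha : |a| ≤ A) : |c * a| ≤ (-c) * A := by
  rw [abs_mul, abs_of_nonpos hc]; exact mul_le_mul_of_nonneg_left ha (by linarith)

theorem fin44 {P : Fin 4 → Fin 4 → Prop}
    (h00 : P 0 0) (h01 : P 0 1) (h02 : P 0 2) (h03 : P 0 3)
    (h10 : P 1 0) (h11 : P 1 1) (h12 : P 1 2) (h13 : P 1 3)
    (h20 : P 2 0) (h21 : P 2 1) (h22 : P 2 2) (h23 : P 2 3)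
    (h30 : P 3 0) (h31 : P 3 1) (h32 : P 3 2) (h33 : P 3 3)
    : ∀ i j, P i j := by
  intro i j
  fin_cases i <;> fin_cases j <;> assumption


noncomputable def aM (u : ℕ → ℝ → ℝ → ℝ) (X T : ℝ) : Fin 4 → Fin 4 → ℝ :=
  ![
    ![0,
      1,
      0,
      0],
    ![0,
      0,
      1,
      0],
    ![0,
      0,
      0,
      1],
    ![(-20) * u 2 X T - 120 * (u 0 X T * u 0 X T) + 240 * T,
      (-20) * u 1 X T,
      (-20) * u 0 X T,
      0]]

noncomputable def bM (u : ℕ → ℝ → ℝ → ℝ) (X T : ℝ) : Fin 4 → Fin 4 → ℝ :=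
  ![
    ![(-1) * u 1 X T,
      (-1) * u 0 X T,
      0,
      (-1/12)],
    ![(2/3) * u 2 X T + 10 * (u 0 X T * u 0 X T) - 20 * T,
      (-1/3) * u 1 X T,
      (2/3) * u 0 X T,
      0],
    ![(2/3) * u 3 X T + 20 * (u 0 X T * u 1 X T),
      (1/3) * u 2 X T + 10 * (u 0 X T * u 0 X T) - 20 * T,
      (1/3) * u 1 X T,
      (2/3) * u 0 X T],
    ![(2/3) * u 4 X T + 20 * (u 1 X T * u 1 X T) + (20/3) * (u 0 X T * u 2 X T) - 80 * (u 0 X T * u 0 X T * u 0 X T) + 160 * (T * u 0 X T),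
      u 3 X T + (80/3) * (u 0 X T * u 1 X T),
      (2/3) * u 2 X T - (10/3) * (u 0 X T * u 0 X T) - 20 * T,
      u 1 X T]]

noncomputable def bM1 (u : ℕ → ℝ → ℝ → ℝ) (X T : ℝ) : Fin 4 → Fin 4 → ℝ :=
  ![
    ![(-1) * u 2 X T,
      (-1) * u 1 X T,
      0,
      0],
    ![(2/3) * u 3 X T + 20 * (u 0 X T * u 1 X T),
      (-1/3) * u 2 X T,
      (2/3) * u 1 X T,
      0],
    ![(2/3) * u 4 X T + 20 * (u 1 X T * u 1 X T) + 20 * (u 0 X T * u 2 X T),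
      (1/3) * u 3 X T + 20 * (u 0 X T * u 1 X T),
      (1/3) * u 2 X T,
      (2/3) * u 1 X T],
    ![(2/3) * u 5 X T + (140/3) * (u 1 X T * u 2 X T) + (20/3) * (u 0 X T * u 3 X T) - 240 * (u 0 X T * u 0 X T * u 1 X T) + 160 * (T * u 1 X T),
      u 4 X T + (80/3) * (u 1 X T * u 1 X T) + (80/3) * (u 0 X T * u 2 X T),
      (2/3) * u 3 X T - (20/3) * (u 0 X T * u 1 X T),
      u 2 X T]]

noncomputable def bM2 (u : ℕ → ℝ → ℝ → ℝ) (X T : ℝ) : Fin 4 → Fin 4 → ℝ :=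
  ![
    ![(-1) * u 3 X T,
      (-1) * u 2 X T,
      0,
      0],
    ![(2/3) * u 4 X T + 20 * (u 1 X T * u 1 X T) + 20 * (u 0 X T * u 2 X T),
      (-1/3) * u 3 X T,
      (2/3) * u 2 X T,
      0],
    ![(2/3) * u 5 X T + 60 * (u 1 X T * u 2 X T) + 20 * (u 0 X T * u 3 X T),
      (1/3) * u 4 X T + 20 * (u 1 X T * u 1 X T) + 20 * (u 0 X T * u 2 X T),
      (1/3) * u 3 X T,
      (2/3) * u 2 X T],
    ![(2/3) * u 6 X T + (140/3) * (u 2 X T * u 2 X T) + (160/3) * (u 1 X T * u 3 X T) + (20/3) * (u 0 X T * u 4 X T) - 480 * (u 0 X T * u 1 X T * u 1 X T) - 240 * (u 0 X T * u 0 X T * u 2 X T) + 160 * (T * u 2 X T),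
      u 5 X T + 80 * (u 1 X T * u 2 X T) + (80/3) * (u 0 X T * u 3 X T),
      (2/3) * u 4 X T - (20/3) * (u 1 X T * u 1 X T) - (20/3) * (u 0 X T * u 2 X T),
      u 3 X T]]

noncomputable def aMt (u ut : ℕ → ℝ → ℝ → ℝ) (X T : ℝ) : Fin 4 → Fin 4 → ℝ :=
  ![
    ![0,
      0,
      0,
      0],
    ![0,
      0,
      0,
      0],
    ![0,
      0,
      0,
      0],
    ![-20 * ut 2 X T - 240 * (u 0 X T * ut 0 X T) + 240,
      -20 * ut 1 X T,
      -20 * ut 0 X T,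
      0]]

set_option maxHeartbeats 1000000 in
theorem bM_deriv (u : ℕ → ℝ → ℝ → ℝ) (hU : USol u) (X T : ℝ) :
    ∀ i j, HasDerivAt (fun x => bM u x T i j) (bM1 u X T i j) X := by
  have d0 := hU.hu 0 X T
  have d1 := hU.hu 1 X T
  have d2 := hU.hu 2 X T
  have d3 := hU.hu 3 X T
  have d4 := hU.hu 4 X T
  have d5 := hU.hu 5 X T
  norm_num at d0 d1 d2 d3 d4 d5
  refine fin44
    ?_ ?_ ?_ ?_ ?_ ?_ ?_ ?_ ?_ ?_ ?_ ?_ ?_ ?_ ?_ ?_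
  · show HasDerivAt (fun X => (-1) * u 1 X T) ((-1) * u 2 X T) X
    exact ((hasDerivAt_const X ((-1):ℝ)).mul d1).congr_deriv (by ring)
  · show HasDerivAt (fun X => (-1) * u 0 X T) ((-1) * u 1 X T) X
    exact ((hasDerivAt_const X ((-1):ℝ)).mul d0).congr_deriv (by ring)
  · show HasDerivAt (fun X => 0) (0) X
    exact (hasDerivAt_const X (0:ℝ)).congr_deriv (by ring)
  · show HasDerivAt (fun X => (-1/12)) (0) X
    exact (hasDerivAt_const X ((-1/12):ℝ)).congr_deriv (by ring)
  · show HasDerivAt (fun X => (2/3) * u 2 X T + 10 * (u 0 X T * u 0 X T) - 20 * T) ((2/3) * u 3 X T + 20 * (u 0 X T * u 1 X T)) X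
    exact ((((hasDerivAt_const X ((2/3):ℝ)).mul d2).add ((hasDerivAt_const X (10:ℝ)).mul (d0.mul d0))).sub ((hasDerivAt_const X (20:ℝ)).mul (hasDerivAt_const X T))).congr_deriv (by ring)
  · show HasDerivAt (fun X => (-1/3) * u 1 X T) ((-1/3) * u 2 X T) X
    exact ((hasDerivAt_const X ((-1/3):ℝ)).mul d1).congr_deriv (by ring)
  · show HasDerivAt (fun X => (2/3) * u 0 X T) ((2/3) * u 1 X T) X
    exact ((hasDerivAt_const X ((2/3):ℝ)).mul d0).congr_deriv (by ring)
  · show HasDerivAt (fun X => 0) (0) X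
    exact (hasDerivAt_const X (0:ℝ)).congr_deriv (by ring)
  · show HasDerivAt (fun X => (2/3) * u 3 X T + 20 * (u 0 X T * u 1 X T)) ((2/3) * u 4 X T + 20 * (u 1 X T * u 1 X T) + 20 * (u 0 X T * u 2 X T)) X
    exact (((hasDerivAt_const X ((2/3):ℝ)).mul d3).add ((hasDerivAt_const X (20:ℝ)).mul (d0.mul d1))).congr_deriv (by ring)
  · show HasDerivAt (fun X => (1/3) * u 2 X T + 10 * (u 0 X T * u 0 X T) - 20 * T) ((1/3) * u 3 X T + 20 * (u 0 X T * u 1 X T)) X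
    exact ((((hasDerivAt_const X ((1/3):ℝ)).mul d2).add ((hasDerivAt_const X (10:ℝ)).mul (d0.mul d0))).sub ((hasDerivAt_const X (20:ℝ)).mul (hasDerivAt_const X T))).congr_deriv (by ring)
  · show HasDerivAt (fun X => (1/3) * u 1 X T) ((1/3) * u 2 X T) X
    exact ((hasDerivAt_const X ((1/3):ℝ)).mul d1).congr_deriv (by ring)
  · show HasDerivAt (fun X => (2/3) * u 0 X T) ((2/3) * u 1 X T) X
    exact ((hasDerivAt_const X ((2/3):ℝ)).mul d0).congr_deriv (by ring)
  · show HasDerivAt (fun X => (2/3) * u 4 X T + 20 * (u 1 X T * u 1 X T) + (20/3) * (u 0 X T * u 2 X T) - 80 * (u 0 X T * u 0 X T * u 0 X T) + 160 * (T * u 0 X T)) ((2/3) * u 5 X T + (140/3) * (u 1 X T * u 2 X T) + (20/3) * (u 0 X T * u 3 X T) - 240 * (u 0 X T * u 0 X T * u 1 X T) + 160 * (T * u 1 X T)) X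
    exact ((((((hasDerivAt_const X ((2/3):ℝ)).mul d4).add ((hasDerivAt_const X (20:ℝ)).mul (d1.mul d1))).add ((hasDerivAt_const X ((20/3):ℝ)).mul (d0.mul d2))).sub ((hasDerivAt_const X (80:ℝ)).mul ((d0.mul d0).mul d0))).add ((hasDerivAt_const X (160:ℝ)).mul ((hasDerivAt_const X T).mul d0))).congr_deriv (by simp only [Pi.mul_apply]; ring)
  · show HasDerivAt (fun X => u 3 X T + (80/3) * (u 0 X T * u 1 X T)) (u 4 X T + (80/3) * (u 1 X T * u 1 X T) + (80/3) * (u 0 X T * u 2 X T)) X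
    exact (d3.add ((hasDerivAt_const X ((80/3):ℝ)).mul (d0.mul d1))).congr_deriv (by ring)
  · show HasDerivAt (fun X => (2/3) * u 2 X T - (10/3) * (u 0 X T * u 0 X T) - 20 * T) ((2/3) * u 3 X T - (20/3) * (u 0 X T * u 1 X T)) X
    exact ((((hasDerivAt_const X ((2/3):ℝ)).mul d2).sub ((hasDerivAt_const X ((10/3):ℝ)).mul (d0.mul d0))).sub ((hasDerivAt_const X (20:ℝ)).mul (hasDerivAt_const X T))).congr_deriv (by ring)
  · show HasDerivAt (fun X => u 1 X T) (u 2 X T) X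
    exact d1.congr_deriv (by ring)

set_option maxHeartbeats 1000000 in
theorem bM1_deriv (u : ℕ → ℝ → ℝ → ℝ) (hU : USol u) (X T : ℝ) :
    ∀ i j, HasDerivAt (fun x => bM1 u x T i j) (bM2 u X T i j) X := by
  have d0 := hU.hu 0 X T
  have d1 := hU.hu 1 X T
  have d2 := hU.hu 2 X T
  have d3 := hU.hu 3 X T
  have d4 := hU.hu 4 X T
  have d5 := hU.hu 5 X T
  norm_num at d0 d1 d2 d3 d4 d5
  refine fin44
    ?_ ?_ ?_ ?_ ?_ ?_ ?_ ?_ ?_ ?_ ?_ ?_ ?_ ?_ ?_ ?_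
  · show HasDerivAt (fun X => (-1) * u 2 X T) ((-1) * u 3 X T) X
    exact ((hasDerivAt_const X ((-1):ℝ)).mul d2).congr_deriv (by ring)
  · show HasDerivAt (fun X => (-1) * u 1 X T) ((-1) * u 2 X T) X
    exact ((hasDerivAt_const X ((-1):ℝ)).mul d1).congr_deriv (by ring)
  · show HasDerivAt (fun X => 0) (0) X
    exact (hasDerivAt_const X (0:ℝ)).congr_deriv (by ring)
  · show HasDerivAt (fun X => 0) (0) X
    exact (hasDerivAt_const X (0:ℝ)).congr_deriv (by ring)
  · show HasDerivAt (fun X => (2/3) * u 3 X T + 20 * (u 0 X T * u 1 X T)) ((2/3) * u 4 X T + 20 * (u 1 X T * u 1 X T) + 20 * (u 0 X T * u 2 X T)) X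
    exact (((hasDerivAt_const X ((2/3):ℝ)).mul d3).add ((hasDerivAt_const X (20:ℝ)).mul (d0.mul d1))).congr_deriv (by ring)
  · show HasDerivAt (fun X => (-1/3) * u 2 X T) ((-1/3) * u 3 X T) X
    exact ((hasDerivAt_const X ((-1/3):ℝ)).mul d2).congr_deriv (by ring)
  · show HasDerivAt (fun X => (2/3) * u 1 X T) ((2/3) * u 2 X T) X
    exact ((hasDerivAt_const X ((2/3):ℝ)).mul d1).congr_deriv (by ring)
  · show HasDerivAt (fun X => 0) (0) X
    exact (hasDerivAt_const X (0:ℝ)).congr_deriv (by ring)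
  · show HasDerivAt (fun X => (2/3) * u 4 X T + 20 * (u 1 X T * u 1 X T) + 20 * (u 0 X T * u 2 X T)) ((2/3) * u 5 X T + 60 * (u 1 X T * u 2 X T) + 20 * (u 0 X T * u 3 X T)) X
    exact ((((hasDerivAt_const X ((2/3):ℝ)).mul d4).add ((hasDerivAt_const X (20:ℝ)).mul (d1.mul d1))).add ((hasDerivAt_const X (20:ℝ)).mul (d0.mul d2))).congr_deriv (by ring)
  · show HasDerivAt (fun X => (1/3) * u 3 X T + 20 * (u 0 X T * u 1 X T)) ((1/3) * u 4 X T + 20 * (u 1 X T * u 1 X T) + 20 * (u 0 X T * u 2 X T)) X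
    exact (((hasDerivAt_const X ((1/3):ℝ)).mul d3).add ((hasDerivAt_const X (20:ℝ)).mul (d0.mul d1))).congr_deriv (by ring)
  · show HasDerivAt (fun X => (1/3) * u 2 X T) ((1/3) * u 3 X T) X
    exact ((hasDerivAt_const X ((1/3):ℝ)).mul d2).congr_deriv (by ring)
  · show HasDerivAt (fun X => (2/3) * u 1 X T) ((2/3) * u 2 X T) X
    exact ((hasDerivAt_const X ((2/3):ℝ)).mul d1).congr_deriv (by ring)
  · show HasDerivAt (fun X => (2/3) * u 5 X T + (140/3) * (u 1 X T * u 2 X T) + (20/3) * (u 0 X T * u 3 X T) - 240 * (u 0 X T * u 0 X T * u 1 X T) + 160 * (T * u 1 X T)) ((2/3) * u 6 X T + (140/3) * (u 2 X T * u 2 X T) + (160/3) * (u 1 X T * u 3 X T) + (20/3) * (u 0 X T * u 4 X T) - 480 * (u 0 X T * u 1 X T * u 1 X T) - 240 * (u 0 X T * u 0 X T * u 2 X T) + 160 * (T * u 2 X T)) X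
    exact ((((((hasDerivAt_const X ((2/3):ℝ)).mul d5).add ((hasDerivAt_const X ((140/3):ℝ)).mul (d1.mul d2))).add ((hasDerivAt_const X ((20/3):ℝ)).mul (d0.mul d3))).sub ((hasDerivAt_const X (240:ℝ)).mul ((d0.mul d0).mul d1))).add ((hasDerivAt_const X (160:ℝ)).mul ((hasDerivAt_const X T).mul d1))).congr_deriv (by simp only [Pi.mul_apply]; ring)
  · show HasDerivAt (fun X => u 4 X T + (80/3) * (u 1 X T * u 1 X T) + (80/3) * (u 0 X T * u 2 X T)) (u 5 X T + 80 * (u 1 X T * u 2 X T) + (80/3) * (u 0 X T * u 3 X T)) X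
    exact ((d4.add ((hasDerivAt_const X ((80/3):ℝ)).mul (d1.mul d1))).add ((hasDerivAt_const X ((80/3):ℝ)).mul (d0.mul d2))).congr_deriv (by ring)
  · show HasDerivAt (fun X => (2/3) * u 3 X T - (20/3) * (u 0 X T * u 1 X T)) ((2/3) * u 4 X T - (20/3) * (u 1 X T * u 1 X T) - (20/3) * (u 0 X T * u 2 X T)) X
    exact (((hasDerivAt_const X ((2/3):ℝ)).mul d3).sub ((hasDerivAt_const X ((20/3):ℝ)).mul (d0.mul d1))).congr_deriv (by ring)
  · show HasDerivAt (fun X => u 2 X T) (u 3 X T) X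
    exact d2.congr_deriv (by ring)

theorem aM_deriv (u ut : ℕ → ℝ → ℝ → ℝ) (hU : UTSol u ut) (X T : ℝ) :
    ∀ i j, HasDerivAt (fun t => aM u X t i j) (aMt u ut X T i j) T := by
  have d0 := hU.hut 0 X T
  have d1 := hU.hut 1 X T
  have d2 := hU.hut 2 X T
  refine fin44
    ?_ ?_ ?_ ?_ ?_ ?_ ?_ ?_ ?_ ?_ ?_ ?_ ?_ ?_ ?_ ?_
  · show HasDerivAt (fun T => 0) (0) T
    exact (hasDerivAt_const T (0:ℝ)).congr_deriv (by ring)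
  · show HasDerivAt (fun T => 1) (0) T
    exact (hasDerivAt_const T (1:ℝ)).congr_deriv (by ring)
  · show HasDerivAt (fun T => 0) (0) T
    exact (hasDerivAt_const T (0:ℝ)).congr_deriv (by ring)
  · show HasDerivAt (fun T => 0) (0) T
    exact (hasDerivAt_const T (0:ℝ)).congr_deriv (by ring)
  · show HasDerivAt (fun T => 0) (0) T
    exact (hasDerivAt_const T (0:ℝ)).congr_deriv (by ring)
  · show HasDerivAt (fun T => 0) (0) T
    exact (hasDerivAt_const T (0:ℝ)).congr_deriv (by ring)
  · show HasDerivAt (fun T => 1) (0) T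
    exact (hasDerivAt_const T (1:ℝ)).congr_deriv (by ring)
  · show HasDerivAt (fun T => 0) (0) T
    exact (hasDerivAt_const T (0:ℝ)).congr_deriv (by ring)
  · show HasDerivAt (fun T => 0) (0) T
    exact (hasDerivAt_const T (0:ℝ)).congr_deriv (by ring)
  · show HasDerivAt (fun T => 0) (0) T
    exact (hasDerivAt_const T (0:ℝ)).congr_deriv (by ring)
  · show HasDerivAt (fun T => 0) (0) T
    exact (hasDerivAt_const T (0:ℝ)).congr_deriv (by ring)
  · show HasDerivAt (fun T => 1) (0) T
    exact (hasDerivAt_const T (1:ℝ)).congr_deriv (by ring)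
  · show HasDerivAt (fun T => (-20) * u 2 X T - 120 * (u 0 X T * u 0 X T) + 240 * T) (-20 * ut 2 X T - 240 * (u 0 X T * ut 0 X T) + 240) T
    exact ((((hasDerivAt_const T ((-20):ℝ)).mul d2).sub ((hasDerivAt_const T (120:ℝ)).mul (d0.mul d0))).add ((hasDerivAt_const T (240:ℝ)).mul (hasDerivAt_id T))).congr_deriv (by ring)
  · show HasDerivAt (fun T => (-20) * u 1 X T) (-20 * ut 1 X T) T
    exact ((hasDerivAt_const T ((-20):ℝ)).mul d1).congr_deriv (by ring)
  · show HasDerivAt (fun T => (-20) * u 0 X T) (-20 * ut 0 X T) T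
    exact ((hasDerivAt_const T ((-20):ℝ)).mul d0).congr_deriv (by ring)
  · show HasDerivAt (fun T => 0) (0) T
    exact (hasDerivAt_const T (0:ℝ)).congr_deriv (by ring)

theorem aM_cont (u : ℕ → ℝ → ℝ → ℝ) (cu : ∀ k, Continuous (fun p : ℝ × ℝ => u k p.1 p.2)) :
    ∀ i j, Continuous (fun p : ℝ × ℝ => aM u p.1 p.2 i j) := by
  have d0 := cu 0
  have d1 := cu 1
  have d2 := cu 2
  have d3 := cu 3
  have d4 := cu 4
  have d5 := cu 5
  have d6 := cu 6
  refine fin44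
    ?_ ?_ ?_ ?_ ?_ ?_ ?_ ?_ ?_ ?_ ?_ ?_ ?_ ?_ ?_ ?_
  · show Continuous (fun p : ℝ × ℝ => (0 : ℝ))
    fun_prop
  · show Continuous (fun p : ℝ × ℝ => (1 : ℝ))
    fun_prop
  · show Continuous (fun p : ℝ × ℝ => (0 : ℝ))
    fun_prop
  · show Continuous (fun p : ℝ × ℝ => (0 : ℝ))
    fun_prop
  · show Continuous (fun p : ℝ × ℝ => (0 : ℝ))
    fun_prop
  · show Continuous (fun p : ℝ × ℝ => (0 : ℝ))
    fun_prop
  · show Continuous (fun p : ℝ × ℝ => (1 : ℝ))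
    fun_prop
  · show Continuous (fun p : ℝ × ℝ => (0 : ℝ))
    fun_prop
  · show Continuous (fun p : ℝ × ℝ => (0 : ℝ))
    fun_prop
  · show Continuous (fun p : ℝ × ℝ => (0 : ℝ))
    fun_prop
  · show Continuous (fun p : ℝ × ℝ => (0 : ℝ))
    fun_prop
  · show Continuous (fun p : ℝ × ℝ => (1 : ℝ))
    fun_prop
  · show Continuous (fun p : ℝ × ℝ => ((-20) * u 2 p.1 p.2 - 120 * (u 0 p.1 p.2 * u 0 p.1 p.2) + 240 * p.2 : ℝ))
    fun_prop
  · show Continuous (fun p : ℝ × ℝ => ((-20) * u 1 p.1 p.2 : ℝ))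
    fun_prop
  · show Continuous (fun p : ℝ × ℝ => ((-20) * u 0 p.1 p.2 : ℝ))
    fun_prop
  · show Continuous (fun p : ℝ × ℝ => (0 : ℝ))
    fun_prop

theorem bM_cont (u : ℕ → ℝ → ℝ → ℝ) (cu : ∀ k, Continuous (fun p : ℝ × ℝ => u k p.1 p.2)) :
    ∀ i j, Continuous (fun p : ℝ × ℝ => bM u p.1 p.2 i j) := by
  have d0 := cu 0
  have d1 := cu 1
  have d2 := cu 2
  have d3 := cu 3
  have d4 := cu 4
  have d5 := cu 5
  have d6 := cu 6
  refine fin44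
    ?_ ?_ ?_ ?_ ?_ ?_ ?_ ?_ ?_ ?_ ?_ ?_ ?_ ?_ ?_ ?_
  · show Continuous (fun p : ℝ × ℝ => ((-1) * u 1 p.1 p.2 : ℝ))
    fun_prop
  · show Continuous (fun p : ℝ × ℝ => ((-1) * u 0 p.1 p.2 : ℝ))
    fun_prop
  · show Continuous (fun p : ℝ × ℝ => (0 : ℝ))
    fun_prop
  · show Continuous (fun p : ℝ × ℝ => ((-1/12) : ℝ))
    fun_prop
  · show Continuous (fun p : ℝ × ℝ => ((2/3) * u 2 p.1 p.2 + 10 * (u 0 p.1 p.2 * u 0 p.1 p.2) - 20 * p.2 : ℝ))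
    fun_prop
  · show Continuous (fun p : ℝ × ℝ => ((-1/3) * u 1 p.1 p.2 : ℝ))
    fun_prop
  · show Continuous (fun p : ℝ × ℝ => ((2/3) * u 0 p.1 p.2 : ℝ))
    fun_prop
  · show Continuous (fun p : ℝ × ℝ => (0 : ℝ))
    fun_prop
  · show Continuous (fun p : ℝ × ℝ => ((2/3) * u 3 p.1 p.2 + 20 * (u 0 p.1 p.2 * u 1 p.1 p.2) : ℝ))
    fun_prop
  · show Continuous (fun p : ℝ × ℝ => ((1/3) * u 2 p.1 p.2 + 10 * (u 0 p.1 p.2 * u 0 p.1 p.2) - 20 * p.2 : ℝ))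
    fun_prop
  · show Continuous (fun p : ℝ × ℝ => ((1/3) * u 1 p.1 p.2 : ℝ))
    fun_prop
  · show Continuous (fun p : ℝ × ℝ => ((2/3) * u 0 p.1 p.2 : ℝ))
    fun_prop
  · show Continuous (fun p : ℝ × ℝ => ((2/3) * u 4 p.1 p.2 + 20 * (u 1 p.1 p.2 * u 1 p.1 p.2) + (20/3) * (u 0 p.1 p.2 * u 2 p.1 p.2) - 80 * (u 0 p.1 p.2 * u 0 p.1 p.2 * u 0 p.1 p.2) + 160 * (p.2 * u 0 p.1 p.2) : ℝ))
    fun_prop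
  · show Continuous (fun p : ℝ × ℝ => (u 3 p.1 p.2 + (80/3) * (u 0 p.1 p.2 * u 1 p.1 p.2) : ℝ))
    fun_prop
  · show Continuous (fun p : ℝ × ℝ => ((2/3) * u 2 p.1 p.2 - (10/3) * (u 0 p.1 p.2 * u 0 p.1 p.2) - 20 * p.2 : ℝ))
    fun_prop
  · show Continuous (fun p : ℝ × ℝ => (u 1 p.1 p.2 : ℝ))
    fun_prop

theorem bM1_cont (u : ℕ → ℝ → ℝ → ℝ) (cu : ∀ k, Continuous (fun p : ℝ × ℝ => u k p.1 p.2)) :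
    ∀ i j, Continuous (fun p : ℝ × ℝ => bM1 u p.1 p.2 i j) := by
  have d0 := cu 0
  have d1 := cu 1
  have d2 := cu 2
  have d3 := cu 3
  have d4 := cu 4
  have d5 := cu 5
  have d6 := cu 6
  refine fin44
    ?_ ?_ ?_ ?_ ?_ ?_ ?_ ?_ ?_ ?_ ?_ ?_ ?_ ?_ ?_ ?_
  · show Continuous (fun p : ℝ × ℝ => ((-1) * u 2 p.1 p.2 : ℝ))
    fun_prop
  · show Continuous (fun p : ℝ × ℝ => ((-1) * u 1 p.1 p.2 : ℝ))
    fun_prop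
  · show Continuous (fun p : ℝ × ℝ => (0 : ℝ))
    fun_prop
  · show Continuous (fun p : ℝ × ℝ => (0 : ℝ))
    fun_prop
  · show Continuous (fun p : ℝ × ℝ => ((2/3) * u 3 p.1 p.2 + 20 * (u 0 p.1 p.2 * u 1 p.1 p.2) : ℝ))
    fun_prop
  · show Continuous (fun p : ℝ × ℝ => ((-1/3) * u 2 p.1 p.2 : ℝ))
    fun_prop
  · show Continuous (fun p : ℝ × ℝ => ((2/3) * u 1 p.1 p.2 : ℝ))
    fun_prop
  · show Continuous (fun p : ℝ × ℝ => (0 : ℝ))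
    fun_prop
  · show Continuous (fun p : ℝ × ℝ => ((2/3) * u 4 p.1 p.2 + 20 * (u 1 p.1 p.2 * u 1 p.1 p.2) + 20 * (u 0 p.1 p.2 * u 2 p.1 p.2) : ℝ))
    fun_prop
  · show Continuous (fun p : ℝ × ℝ => ((1/3) * u 3 p.1 p.2 + 20 * (u 0 p.1 p.2 * u 1 p.1 p.2) : ℝ))
    fun_prop
  · show Continuous (fun p : ℝ × ℝ => ((1/3) * u 2 p.1 p.2 : ℝ))
    fun_prop
  · show Continuous (fun p : ℝ × ℝ => ((2/3) * u 1 p.1 p.2 : ℝ))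
    fun_prop
  · show Continuous (fun p : ℝ × ℝ => ((2/3) * u 5 p.1 p.2 + (140/3) * (u 1 p.1 p.2 * u 2 p.1 p.2) + (20/3) * (u 0 p.1 p.2 * u 3 p.1 p.2) - 240 * (u 0 p.1 p.2 * u 0 p.1 p.2 * u 1 p.1 p.2) + 160 * (p.2 * u 1 p.1 p.2) : ℝ))
    fun_prop
  · show Continuous (fun p : ℝ × ℝ => (u 4 p.1 p.2 + (80/3) * (u 1 p.1 p.2 * u 1 p.1 p.2) + (80/3) * (u 0 p.1 p.2 * u 2 p.1 p.2) : ℝ))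
    fun_prop
  · show Continuous (fun p : ℝ × ℝ => ((2/3) * u 3 p.1 p.2 - (20/3) * (u 0 p.1 p.2 * u 1 p.1 p.2) : ℝ))
    fun_prop
  · show Continuous (fun p : ℝ × ℝ => (u 2 p.1 p.2 : ℝ))
    fun_prop

theorem bM2_cont (u : ℕ → ℝ → ℝ → ℝ) (cu : ∀ k, Continuous (fun p : ℝ × ℝ => u k p.1 p.2)) :
    ∀ i j, Continuous (fun p : ℝ × ℝ => bM2 u p.1 p.2 i j) := by
  have d0 := cu 0
  have d1 := cu 1
  have d2 := cu 2
  have d3 := cu 3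
  have d4 := cu 4
  have d5 := cu 5
  have d6 := cu 6
  refine fin44
    ?_ ?_ ?_ ?_ ?_ ?_ ?_ ?_ ?_ ?_ ?_ ?_ ?_ ?_ ?_ ?_
  · show Continuous (fun p : ℝ × ℝ => ((-1) * u 3 p.1 p.2 : ℝ))
    fun_prop
  · show Continuous (fun p : ℝ × ℝ => ((-1) * u 2 p.1 p.2 : ℝ))
    fun_prop
  · show Continuous (fun p : ℝ × ℝ => (0 : ℝ))
    fun_prop
  · show Continuous (fun p : ℝ × ℝ => (0 : ℝ))
    fun_prop
  · show Continuous (fun p : ℝ × ℝ => ((2/3) * u 4 p.1 p.2 + 20 * (u 1 p.1 p.2 * u 1 p.1 p.2) + 20 * (u 0 p.1 p.2 * u 2 p.1 p.2) : ℝ))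
    fun_prop
  · show Continuous (fun p : ℝ × ℝ => ((-1/3) * u 3 p.1 p.2 : ℝ))
    fun_prop
  · show Continuous (fun p : ℝ × ℝ => ((2/3) * u 2 p.1 p.2 : ℝ))
    fun_prop
  · show Continuous (fun p : ℝ × ℝ => (0 : ℝ))
    fun_prop
  · show Continuous (fun p : ℝ × ℝ => ((2/3) * u 5 p.1 p.2 + 60 * (u 1 p.1 p.2 * u 2 p.1 p.2) + 20 * (u 0 p.1 p.2 * u 3 p.1 p.2) : ℝ))
    fun_prop
  · show Continuous (fun p : ℝ × ℝ => ((1/3) * u 4 p.1 p.2 + 20 * (u 1 p.1 p.2 * u 1 p.1 p.2) + 20 * (u 0 p.1 p.2 * u 2 p.1 p.2) : ℝ))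
    fun_prop
  · show Continuous (fun p : ℝ × ℝ => ((1/3) * u 3 p.1 p.2 : ℝ))
    fun_prop
  · show Continuous (fun p : ℝ × ℝ => ((2/3) * u 2 p.1 p.2 : ℝ))
    fun_prop
  · show Continuous (fun p : ℝ × ℝ => ((2/3) * u 6 p.1 p.2 + (140/3) * (u 2 p.1 p.2 * u 2 p.1 p.2) + (160/3) * (u 1 p.1 p.2 * u 3 p.1 p.2) + (20/3) * (u 0 p.1 p.2 * u 4 p.1 p.2) - 480 * (u 0 p.1 p.2 * u 1 p.1 p.2 * u 1 p.1 p.2) - 240 * (u 0 p.1 p.2 * u 0 p.1 p.2 * u 2 p.1 p.2) + 160 * (p.2 * u 2 p.1 p.2) : ℝ))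
    fun_prop
  · show Continuous (fun p : ℝ × ℝ => (u 5 p.1 p.2 + 80 * (u 1 p.1 p.2 * u 2 p.1 p.2) + (80/3) * (u 0 p.1 p.2 * u 3 p.1 p.2) : ℝ))
    fun_prop
  · show Continuous (fun p : ℝ × ℝ => ((2/3) * u 4 p.1 p.2 - (20/3) * (u 1 p.1 p.2 * u 1 p.1 p.2) - (20/3) * (u 0 p.1 p.2 * u 2 p.1 p.2) : ℝ))
    fun_prop
  · show Continuous (fun p : ℝ × ℝ => (u 3 p.1 p.2 : ℝ))
    fun_prop

theorem bM_bd (u : ℕ → ℝ → ℝ → ℝ) (X T C m : ℝ) (hC : 0 ≤ C) (hm : 1 ≤ m)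
    (b0 : |u 0 X T| ≤ C * m^2) (b1 : |u 1 X T| ≤ C * m^3) (b2 : |u 2 X T| ≤ C * m^4)
    (b3 : |u 3 X T| ≤ C * m^5) (b4 : |u 4 X T| ≤ C * m^6) (bT : |T| ≤ m^4) :
    ∀ i j : Fin 4, |bM u X T i j| * m^(j:ℕ) ≤ (200 + 200 * C + 200 * C^2 + 200 * C^3) * m^(3+(i:ℕ)) := by
  have hm0 : 0 ≤ m := by linarith
  have c2 : 0 ≤ C^2 := by positivity
  have c3 : 0 ≤ C^3 := by positivity
  refine fin44
    ?_ ?_ ?_ ?_ ?_ ?_ ?_ ?_ ?_ ?_ ?_ ?_ ?_ ?_ ?_ ?_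
  · show |(-1) * u 1 X T| * m^0 ≤ (200 + 200 * C + 200 * C^2 + 200 * C^3) * m^(3+0)
    have h := (bd_cn ((-1)) (by norm_num) b1)
    refine (mul_le_mul_of_nonneg_right h (by positivity : 0 ≤ m^0)).trans ?_
    have e : 0 ≤ (200 + 200 * C + 200 * C^2 + 200 * C^3 - ((1) * C^1)) * m^(3+0) := mul_nonneg (by norm_num; linarith) (by positivity)
    norm_num [abs_of_neg] at e ⊢
    linarith
  · show |(-1) * u 0 X T| * m^1 ≤ (200 + 200 * C + 200 * C^2 + 200 * C^3) * m^(3+0)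
    have h := (bd_cn ((-1)) (by norm_num) b0)
    refine (mul_le_mul_of_nonneg_right h (by positivity : 0 ≤ m^1)).trans ?_
    have e : 0 ≤ (200 + 200 * C + 200 * C^2 + 200 * C^3 - ((1) * C^1)) * m^(3+0) := mul_nonneg (by norm_num; linarith) (by positivity)
    norm_num [abs_of_neg] at e ⊢
    linarith
  · show |0| * m^2 ≤ (200 + 200 * C + 200 * C^2 + 200 * C^3) * m^(3+0)
    rw [abs_zero, zero_mul]; positivity
  · show |(-1/12)| * m^3 ≤ (200 + 200 * C + 200 * C^2 + 200 * C^3) * m^(3+0)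
    rw [show |((-1/12:ℝ))| = 1/12 by norm_num [abs_of_neg]]
    exact mul_le_mul_of_nonneg_right (by linarith) (by positivity)
  · show |(2/3) * u 2 X T + 10 * (u 0 X T * u 0 X T) - 20 * T| * m^0 ≤ (200 + 200 * C + 200 * C^2 + 200 * C^3) * m^(3+1)
    have h := (bd_sub (bd_add (bd_c ((2/3)) (by norm_num) b2) (bd_c (10) (by norm_num) (bd_mul b0 b0))) (bd_c (20) (by norm_num) bT))
    refine (mul_le_mul_of_nonneg_right h (by positivity : 0 ≤ m^0)).trans ?_
    have e : 0 ≤ (200 + 200 * C + 200 * C^2 + 200 * C^3 - ((2/3) * C^1 + 10 * C^2 + 20 * C^0)) * m^(3+1) := mul_nonneg (by norm_num; linarith) (by positivity)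
    norm_num [abs_of_neg] at e ⊢
    linarith
  · show |(-1/3) * u 1 X T| * m^1 ≤ (200 + 200 * C + 200 * C^2 + 200 * C^3) * m^(3+1)
    have h := (bd_cn ((-1/3)) (by norm_num) b1)
    refine (mul_le_mul_of_nonneg_right h (by positivity : 0 ≤ m^1)).trans ?_
    have e : 0 ≤ (200 + 200 * C + 200 * C^2 + 200 * C^3 - ((1/3) * C^1)) * m^(3+1) := mul_nonneg (by norm_num; linarith) (by positivity)
    norm_num [abs_of_neg] at e ⊢
    linarith
  · show |(2/3) * u 0 X T| * m^2 ≤ (200 + 200 * C + 200 * C^2 + 200 * C^3) * m^(3+1)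
    have h := (bd_c ((2/3)) (by norm_num) b0)
    refine (mul_le_mul_of_nonneg_right h (by positivity : 0 ≤ m^2)).trans ?_
    have e : 0 ≤ (200 + 200 * C + 200 * C^2 + 200 * C^3 - ((2/3) * C^1)) * m^(3+1) := mul_nonneg (by norm_num; linarith) (by positivity)
    norm_num [abs_of_neg] at e ⊢
    linarith
  · show |0| * m^3 ≤ (200 + 200 * C + 200 * C^2 + 200 * C^3) * m^(3+1)
    rw [abs_zero, zero_mul]; positivity
  · show |(2/3) * u 3 X T + 20 * (u 0 X T * u 1 X T)| * m^0 ≤ (200 + 200 * C + 200 * C^2 + 200 * C^3) * m^(3+2)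
    have h := (bd_add (bd_c ((2/3)) (by norm_num) b3) (bd_c (20) (by norm_num) (bd_mul b0 b1)))
    refine (mul_le_mul_of_nonneg_right h (by positivity : 0 ≤ m^0)).trans ?_
    have e : 0 ≤ (200 + 200 * C + 200 * C^2 + 200 * C^3 - ((2/3) * C^1 + 20 * C^2)) * m^(3+2) := mul_nonneg (by norm_num; linarith) (by positivity)
    norm_num [abs_of_neg] at e ⊢
    linarith
  · show |(1/3) * u 2 X T + 10 * (u 0 X T * u 0 X T) - 20 * T| * m^1 ≤ (200 + 200 * C + 200 * C^2 + 200 * C^3) * m^(3+2)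
    have h := (bd_sub (bd_add (bd_c ((1/3)) (by norm_num) b2) (bd_c (10) (by norm_num) (bd_mul b0 b0))) (bd_c (20) (by norm_num) bT))
    refine (mul_le_mul_of_nonneg_right h (by positivity : 0 ≤ m^1)).trans ?_
    have e : 0 ≤ (200 + 200 * C + 200 * C^2 + 200 * C^3 - ((1/3) * C^1 + 10 * C^2 + 20 * C^0)) * m^(3+2) := mul_nonneg (by norm_num; linarith) (by positivity)
    norm_num [abs_of_neg] at e ⊢
    linarith
  · show |(1/3) * u 1 X T| * m^2 ≤ (200 + 200 * C + 200 * C^2 + 200 * C^3) * m^(3+2)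
    have h := (bd_c ((1/3)) (by norm_num) b1)
    refine (mul_le_mul_of_nonneg_right h (by positivity : 0 ≤ m^2)).trans ?_
    have e : 0 ≤ (200 + 200 * C + 200 * C^2 + 200 * C^3 - ((1/3) * C^1)) * m^(3+2) := mul_nonneg (by norm_num; linarith) (by positivity)
    norm_num [abs_of_neg] at e ⊢
    linarith
  · show |(2/3) * u 0 X T| * m^3 ≤ (200 + 200 * C + 200 * C^2 + 200 * C^3) * m^(3+2)
    have h := (bd_c ((2/3)) (by norm_num) b0)
    refine (mul_le_mul_of_nonneg_right h (by positivity : 0 ≤ m^3)).trans ?_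
    have e : 0 ≤ (200 + 200 * C + 200 * C^2 + 200 * C^3 - ((2/3) * C^1)) * m^(3+2) := mul_nonneg (by norm_num; linarith) (by positivity)
    norm_num [abs_of_neg] at e ⊢
    linarith
  · show |(2/3) * u 4 X T + 20 * (u 1 X T * u 1 X T) + (20/3) * (u 0 X T * u 2 X T) - 80 * (u 0 X T * u 0 X T * u 0 X T) + 160 * (T * u 0 X T)| * m^0 ≤ (200 + 200 * C + 200 * C^2 + 200 * C^3) * m^(3+3)
    have h := (bd_add (bd_sub (bd_add (bd_add (bd_c ((2/3)) (by norm_num) b4) (bd_c (20) (by norm_num) (bd_mul b1 b1))) (bd_c ((20/3)) (by norm_num) (bd_mul b0 b2))) (bd_c (80) (by norm_num) (bd_mul (bd_mul b0 b0) b0))) (bd_c (160) (by norm_num) (bd_mul bT b0)))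
    refine (mul_le_mul_of_nonneg_right h (by positivity : 0 ≤ m^0)).trans ?_
    have e : 0 ≤ (200 + 200 * C + 200 * C^2 + 200 * C^3 - ((2/3) * C^1 + 20 * C^2 + (20/3) * C^2 + 80 * C^3 + 160 * C^1)) * m^(3+3) := mul_nonneg (by norm_num; linarith) (by positivity)
    norm_num [abs_of_neg] at e ⊢
    linarith
  · show |u 3 X T + (80/3) * (u 0 X T * u 1 X T)| * m^1 ≤ (200 + 200 * C + 200 * C^2 + 200 * C^3) * m^(3+3)
    have h := (bd_add b3 (bd_c ((80/3)) (by norm_num) (bd_mul b0 b1)))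
    refine (mul_le_mul_of_nonneg_right h (by positivity : 0 ≤ m^1)).trans ?_
    have e : 0 ≤ (200 + 200 * C + 200 * C^2 + 200 * C^3 - (1 * C^1 + (80/3) * C^2)) * m^(3+3) := mul_nonneg (by norm_num; linarith) (by positivity)
    norm_num [abs_of_neg] at e ⊢
    linarith
  · show |(2/3) * u 2 X T - (10/3) * (u 0 X T * u 0 X T) - 20 * T| * m^2 ≤ (200 + 200 * C + 200 * C^2 + 200 * C^3) * m^(3+3)
    have h := (bd_sub (bd_sub (bd_c ((2/3)) (by norm_num) b2) (bd_c ((10/3)) (by norm_num) (bd_mul b0 b0))) (bd_c (20) (by norm_num) bT))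
    refine (mul_le_mul_of_nonneg_right h (by positivity : 0 ≤ m^2)).trans ?_
    have e : 0 ≤ (200 + 200 * C + 200 * C^2 + 200 * C^3 - ((2/3) * C^1 + (10/3) * C^2 + 20 * C^0)) * m^(3+3) := mul_nonneg (by norm_num; linarith) (by positivity)
    norm_num [abs_of_neg] at e ⊢
    linarith
  · show |u 1 X T| * m^3 ≤ (200 + 200 * C + 200 * C^2 + 200 * C^3) * m^(3+3)
    have h := b1
    refine (mul_le_mul_of_nonneg_right h (by positivity : 0 ≤ m^3)).trans ?_
    have e : 0 ≤ (200 + 200 * C + 200 * C^2 + 200 * C^3 - (1 * C^1)) * m^(3+3) := mul_nonneg (by norm_num; linarith) (by positivity)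
    norm_num [abs_of_neg] at e ⊢
    linarith


noncomputable def mkC : (Fin 4 → Fin 4 → ℝ) →L[ℝ] ((Fin 4 → ℝ) →L[ℝ] (Fin 4 → ℝ)) :=
  LinearMap.toContinuousLinearMap
    { toFun := fun M => ContinuousLinearMap.pi fun i => ∑ j, M i j • ContinuousLinearMap.proj j
      map_add' := by
        intro M N
        ext w i
        simp [ContinuousLinearMap.sum_apply, add_mul, Finset.sum_add_distrib]
      map_smul' := by
        intro c M
        ext w i
        simp [ContinuousLinearMap.sum_apply, Finset.mul_sum, mul_assoc] }

theorem mkC_apply (M : Fin 4 → Fin 4 → ℝ) (w : Fin 4 → ℝ) (i : Fin 4) :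
    mkC M w i = ∑ j, M i j * w j := by
  simp [mkC, ContinuousLinearMap.sum_apply]

theorem mkC_deriv (m : ℝ → Fin 4 → Fin 4 → ℝ) (m' : Fin 4 → Fin 4 → ℝ) (x : ℝ)
    (h : ∀ i j, HasDerivAt (fun x => m x i j) (m' i j) x) :
    HasDerivAt (fun x => mkC (m x)) (mkC m') x := by
  have : HasDerivAt m m' x := hasDerivAt_pi.mpr fun i => hasDerivAt_pi.mpr fun j => h i j
  exact mkC.hasFDerivAt.comp_hasDerivAt x this

theorem mkC_cont (m : ℝ → ℝ → Fin 4 → Fin 4 → ℝ)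
    (h : ∀ i j, Continuous (fun p : ℝ × ℝ => m p.1 p.2 i j)) :
    Continuous (fun p : ℝ × ℝ => mkC (m p.1 p.2)) :=
  mkC.continuous.comp (continuous_pi fun i => continuous_pi fun j => h i j)

theorem zero_curv (u ut : ℕ → ℝ → ℝ → ℝ) (hU : UTSol u ut) (X T : ℝ)
    (hW : ∀ k ≤ 3, ut k X T + qk u T k X = 0) (w : Fin 4 → ℝ) :
    mkC (aMt u ut X T) w + mkC (aM u X T) (mkC (bM u X T) w)
      = mkC (bM1 u X T) w + mkC (bM u X T) (mkC (aM u X T) w) := by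
  have w0 : ut 0 X T = -(qk u T 0 X) := by linarith [hW 0 (by norm_num)]
  have w1 : ut 1 X T = -(qk u T 1 X) := by linarith [hW 1 (by norm_num)]
  have w2 : ut 2 X T = -(qk u T 2 X) := by linarith [hW 2 (by norm_num)]
  have h4 := hU.h4 X T
  have h5 := hU.h5 X T
  funext i
  simp only [Pi.add_apply, mkC_apply, Fin.sum_univ_four]
  fin_cases i
  · simp [aM, aMt, bM, bM1]; ring
  · simp [aM, aMt, bM, bM1]; ring
  · simp [aM, aMt, bM, bM1]; ring
  · simp [aM, aMt, bM, bM1, w0, w1, w2, qk, h4, h5]; ring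


theorem muf_mono (X T S : ℝ) (h : |T| ≤ |S|) : muf X T ≤ muf X S := by
  have h1 : muf X T ^ 12 ≤ muf X S ^ 12 := by
    rw [muf_pow, muf_pow]
    have := pow_le_pow_left₀ (abs_nonneg T) h 3
    linarith
  exact (pow_le_pow_iff_left₀ (muf_pos _ _).le (muf_pos _ _).le (by norm_num)).mp h1

theorem scaled (u : ℕ → ℝ → ℝ → ℝ) (X m K a b : ℝ) (hab : a ≤ b) (hK : 0 ≤ K) (hm : 1 ≤ m)
    (hB : ∀ t, a ≤ t → t ≤ b → ∀ i j : Fin 4, |bM u X t i j| * m^(j:ℕ) ≤ K * m^(3+(i:ℕ)))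
    (y : ℝ → Fin 4 → ℝ) (hy : ∀ t, HasDerivAt y (mkC (bM u X t) (y t)) t) (δ : ℝ) (hδ : 0 ≤ δ) :
    ((∀ k, |y b k| / m^(k:ℕ) ≤ δ) → ∀ k, |y a k| / m^(k:ℕ) ≤ δ * Real.exp ((4*K*m^3+1)*(b-a))) ∧
    ((∀ k, |y a k| / m^(k:ℕ) ≤ δ) → ∀ k, |y b k| / m^(k:ℕ) ≤ δ * Real.exp ((4*K*m^3+1)*(b-a))) := by
  have hm0 : 0 < m := by linarith
  set f : ℝ → Fin 4 → ℝ := fun t k => y t k / m^(k:ℕ) with hf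
  set f' : ℝ → Fin 4 → ℝ := fun t k => (mkC (bM u X t) (y t)) k / m^(k:ℕ) with hf'
  have hd : ∀ t, HasDerivAt f (f' t) t := fun t => hasDerivAt_pi.mpr fun k =>
    ((hasDerivAt_pi.mp (hy t) k).div_const _)
  have hK1 : 1 ≤ 4*K*m^3+1 := by have : 0 ≤ 4*K*m^3 := by positivity
                                 linarith
  have nrm : ∀ t k, ‖f t k‖ = |y t k| / m^(k:ℕ) := by
    intro t k
    simp only [hf, Real.norm_eq_abs, abs_div, abs_of_pos (pow_pos hm0 _)]
  have key : ∀ t, a ≤ t → t ≤ b → ‖f' t‖ ≤ (4*K*m^3+1) * ‖f t‖ + 0 := by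
    intro t h1 h2
    have hn := norm_nonneg (f t)
    have h3 : ‖f' t‖ ≤ (4*K*m^3) * ‖f t‖ := by
      rw [pi_norm_le_iff_of_nonneg (by positivity)]
      intro i
      simp only [hf', Real.norm_eq_abs, abs_div, abs_of_pos (pow_pos hm0 _)]
      rw [div_le_iff₀ (pow_pos hm0 _), mkC_apply]
      have : ∀ j : Fin 4, |bM u X t i j * y t j| ≤ K * m^(3+(i:ℕ)) * ‖f t‖ := by
        intro j
        have e : y t j = m^(j:ℕ) * f t j := by
          simp only [hf]; field_simp
        have hj : |f t j| ≤ ‖f t‖ := norm_le_pi_norm (f t) j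
        rw [e, abs_mul, abs_mul, abs_of_pos (pow_pos hm0 _), ← mul_assoc]
        exact mul_le_mul (hB t h1 h2 i j) hj (abs_nonneg _) (by positivity)
      refine (Finset.abs_sum_le_sum_abs _ _).trans ((Finset.sum_le_sum fun j _ => this j).trans ?_)
      rw [Finset.sum_const, Finset.card_univ, Fintype.card_fin, pow_add]
      simp only [nsmul_eq_mul]
      push_cast
      apply le_of_eq; ring
    linarith
  constructor
  · intro h k
    have := gron_bwd f f' hd a b δ _ 0 hab hK1 le_rfl
      ((pi_norm_le_iff_of_nonneg hδ).mpr fun k => by rw [nrm]; exact h k) key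
    rw [add_zero] at this
    rw [← nrm]
    exact (norm_le_pi_norm (f a) k).trans this
  · intro h k
    have := gron_fwd f f' hd a b δ _ 0 hab hK1 le_rfl
      ((pi_norm_le_iff_of_nonneg hδ).mpr fun k => by rw [nrm]; exact h k) key
    rw [add_zero] at this
    rw [← nrm]
    exact (norm_le_pi_norm (f b) k).trans this

theorem bM_K (u : ℕ → ℝ → ℝ → ℝ) (hU : USol u) : ∃ K, 0 ≤ K ∧ ∀ X T S, |T| ≤ |S| →
    ∀ i j : Fin 4, |bM u X T i j| * muf X S^(j:ℕ) ≤ K * muf X S^(3+(i:ℕ)) := by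
  obtain ⟨C, hC, hb⟩ := lem_apriori u hU.hu hU.h4 hU.h5
  obtain ⟨D, hD⟩ := qk_growth hU
  have hD0 : 0 ≤ D := by
    have := (abs_nonneg _).trans (hD 0 0 0 (by norm_num))
    have h2 := pow_pos (muf_pos 0 0) (0+5)
    exact nonneg_of_mul_nonneg_left this h2
  set C' := C + 12 * (D + C^2 + C^2) with hC'
  have hC0 : 0 ≤ C' := by positivity
  have hCC : C ≤ C' := by rw [hC']; have : 0 ≤ 12 * (D + C^2 + C^2) := by positivity
                          linarith
  refine ⟨200 + 200 * C' + 200 * C'^2 + 200 * C'^3, by positivity, fun X T S h => ?_⟩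
  have hm := muf_mono X T S h
  have hmT := muf_ge_one X T
  have hp : ∀ k : ℕ, muf X T^k ≤ muf X S^k := fun k => pow_le_pow_left₀ (muf_pos _ _).le hm k
  have g : ∀ k ≤ 3, |u k X T| ≤ C' * muf X S^(k+2) := fun k hk =>
    (hb X T k hk).trans (mul_le_mul hCC (hp _) (by positivity) hC0)
  have g4 : |u 4 X T| ≤ C' * muf X S^6 := by
    have e : u 4 X T = 12 * (qk u T 1 X - u 1 X T * u 1 X T - u 0 X T * u 2 X T) := by
      simp only [qk]; ring
    have b1 := hb X T 1 (by norm_num)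
    have b0 := hb X T 0 (by norm_num)
    have b2 := hb X T 2 (by norm_num)
    have := bd_c 12 (by norm_num) (bd_sub (bd_sub (hD X T 1 (by norm_num)) (bd_mul b1 b1)) (bd_mul b0 b2))
    rw [e]
    refine this.trans ?_
    have e2 : 12 * (D * muf X T^(1+5) + C * muf X T^(1+2) * (C * muf X T^(1+2))
       + C * muf X T^(0+2) * (C * muf X T^(2+2))) = 12 * (D + C^2 + C^2) * muf X T^6 := by ring
    rw [e2]
    refine mul_le_mul ?_ (hp 6) (by positivity) hC0
    linarith
  exact bM_bd u X T C' (muf X S) hC0 (muf_ge_one _ _) (g 0 (by norm_num)) (g 1 (by norm_num))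
    (g 2 (by norm_num)) (g 3 (by norm_num)) g4 ((muf_T X T).trans (hp 4))

theorem muf_cube (X S : ℝ) : muf X S^3 ≤ |X| + (2 + |S|^3) := by
  have h1 : muf X S^3 ≤ muf X S^6 := pow_le_pow_right₀ (muf_ge_one _ _) (by norm_num)
  have h2 := muf_pow X S
  have hs : 0 ≤ |S|^3 := by positivity
  have hx := abs_nonneg X
  have h3 : muf X S^6 ≤ |X| + (2 + |S|^3) := by
    apply (pow_le_pow_iff_left₀ (pow_pos (muf_pos X S) 6).le (by positivity) two_ne_zero).mp
    rw [← pow_mul, h2, ← sq_abs X]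
    nlinarith [mul_nonneg hx hs]
  exact h1.trans h3

theorem triv_transport (u ut : ℕ → ℝ → ℝ → ℝ) (hU : UTSol u ut) (a b : ℝ) (hab : a ≤ b)
    (hW : ∀ T, a ≤ T → T ≤ b → ∀ k ≤ 3, ∀ X, ut k X T + qk u T k X = 0) (ha : Triv u a) :
    Triv u b := by
  intro v hL ⟨C, hC⟩ X
  have hL4 : ∀ X, v 4 X = (-20 * u 2 X b - 120 * (u 0 X b * u 0 X b) + 240 * b) * v 0 X
      + (-20 * u 1 X b) * v 1 X + (-20 * u 0 X b) * v 2 X := by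
    intro X; rw [hL.h4 X]; ring
  obtain ⟨y, hyb, hyT, hyX⟩ := transport (fun X T => mkC (aM u X T)) (fun X T => mkC (aMt u ut X T))
    (fun X T => mkC (bM u X T)) (fun X T => mkC (bM1 u X T)) (fun X T => mkC (bM2 u X T))
    (fun X T => mkC_deriv _ _ _ (aM_deriv u ut hU X T))
    (fun X T => mkC_deriv (fun x => bM u x T) _ _ (bM_deriv u hU.toUSol X T))
    (fun X T => mkC_deriv (fun x => bM1 u x T) _ _ (bM1_deriv u hU.toUSol X T))
    (mkC_cont (aM u) (aM_cont u hU.cu)) (mkC_cont (bM u) (bM_cont u hU.cu))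
    (mkC_cont (bM1 u) (bM1_cont u hU.cu)) (mkC_cont (bM2 u) (bM2_cont u hU.cu))
    a b hab (fun X T h1 h2 w => zero_curv u ut hU X T (fun k hk => hW T h1 h2 k hk X) w)
    (fun X k => v (k:ℕ) X) (fun X => by
      refine hasDerivAt_pi.mpr fun i => ?_
      have := hL.hd (i:ℕ) (by omega) X
      refine this.congr_deriv ?_
      rw [mkC_apply, Fin.sum_univ_four]
      fin_cases i
      · simp [aM]
      · simp [aM]
      · simp [aM]
      · simp [aM, hL4 X])
  obtain ⟨K, hK0, hK⟩ := bM_K u hU.toUSol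
  set S := |a| + |b| with hS
  have hS0 : 0 ≤ S := by positivity
  have hTS : ∀ t, a ≤ t → t ≤ b → |t| ≤ |S| := by
    intro t h1 h2
    rw [abs_of_nonneg hS0, hS, abs_le]
    have := neg_abs_le a
    have := le_abs_self b
    have := abs_nonneg a
    have := abs_nonneg b
    constructor <;> linarith
  have hsc := fun X => scaled u X (muf X S) K a b hab hK0 (muf_ge_one _ _)
    (fun t h1 h2 => hK X t S (hTS t h1 h2)) (y X) (hyT X)
  -- growth of the transported solution
  have yb : ∀ X, ∀ k : Fin 4, |y X b k| / muf X S^(k:ℕ) ≤ Nv v b X := by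
    intro X k
    rw [hyb]
    have h1 := Nv_bd v b X k (by omega)
    rw [div_le_iff₀ (pow_pos (muf_pos _ _) _)]
    refine h1.trans (mul_le_mul_of_nonneg_left ?_ (Nv_nonneg _ _ _))
    exact pow_le_pow_left₀ (muf_pos _ _).le (muf_mono _ _ _ (hTS b hab le_rfl)) _
  set Q := 2 + |S|^3 with hQ
  have hQ0 : 0 ≤ Q := by positivity
  have hC0 : 0 ≤ C := by
    have := (Nv_nonneg v b 0).trans (hC 0)
    exact nonneg_of_mul_nonneg_left this (Real.exp_pos _)
  have hba : 0 ≤ b - a := by linarith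
  have ya : ∀ X, ∀ k : Fin 4, |y X a k| ≤
      (Q * C * Real.exp ((4*K*Q+1)*(b-a))) * Real.exp ((2 + 4*K*(b-a)) * |X|) := by
    intro X k
    have h1 := (hsc X _ (Nv_nonneg v b X)).1 (yb X) k
    rw [div_le_iff₀ (pow_pos (muf_pos _ _) _)] at h1
    have p : muf X S^(k:ℕ) ≤ Q * Real.exp |X| :=
      (mu_le12 X S k (by omega)).trans (poly_exp X S)
    have e : Real.exp ((4*K*muf X S^3+1)*(b-a)) ≤ Real.exp ((4*K*Q+1)*(b-a)) * Real.exp (4*K*(b-a)*|X|) := by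
      rw [← Real.exp_add]
      apply Real.exp_le_exp.mpr
      have h3 := mul_le_mul_of_nonneg_left (muf_cube X S) (mul_nonneg (mul_nonneg (by norm_num : (0:ℝ) ≤ 4) hK0) hba)
      nlinarith
    have hx : 0 ≤ Real.exp |X| := (Real.exp_pos _).le
    calc |y X a k| ≤ Nv v b X * Real.exp ((4*K*muf X S^3+1)*(b-a)) * muf X S^(k:ℕ) := h1
      _ ≤ (C * Real.exp |X|) * (Real.exp ((4*K*Q+1)*(b-a)) * Real.exp (4*K*(b-a)*|X|)) * (Q * Real.exp |X|) := by
          refine mul_le_mul (mul_le_mul (hC X) e (Real.exp_pos _).le (by positivity)) p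
            (pow_pos (muf_pos _ _) _).le (by positivity)
      _ = _ := by
          have : Real.exp ((2 + 4*K*(b-a)) * |X|) = Real.exp |X| * Real.exp (4*K*(b-a)*|X|) * Real.exp |X| := by
            rw [← Real.exp_add, ← Real.exp_add]; congr 1; ring
          rw [this]; ring
  set z : ℕ → ℝ → ℝ := fun k X => if h : k < 4 then y X a ⟨k, h⟩ else
    (-20 * u 2 X a - 120 * (u 0 X a * u 0 X a) + 240 * a) * y X a 0
      + (-20 * u 1 X a) * y X a 1 + (-20 * u 0 X a) * y X a 2 with hz
  have z0 : z 0 = fun X => y X a 0 := rfl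
  have z1 : z 1 = fun X => y X a 1 := rfl
  have z2 : z 2 = fun X => y X a 2 := rfl
  have z3 : z 3 = fun X => y X a 3 := rfl
  have z4 : z 4 = fun X => (-20 * u 2 X a - 120 * (u 0 X a * u 0 X a) + 240 * a) * y X a 0
      + (-20 * u 1 X a) * y X a 1 + (-20 * u 0 X a) * y X a 2 := by
    funext X; simp [hz]
  have zd : ∀ i : Fin 4, ∀ X, HasDerivAt (fun x => y x a i) (∑ j, aM u X a i j * y X a j) X := by
    intro i X
    have := hasDerivAt_pi.mp (hyX X) i
    exact this.congr_deriv (mkC_apply _ _ _)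
  obtain ⟨w, hw, hwz⟩ := mkLin u hU.toUSol a z (by
    intro k hk X
    interval_cases k
    · rw [z0]; refine (zd 0 X).congr_deriv ?_
      rw [z1, Fin.sum_univ_four]; simp [aM]
    · rw [z1]; refine (zd 1 X).congr_deriv ?_
      rw [z2, Fin.sum_univ_four]; simp [aM]
    · rw [z2]; refine (zd 2 X).congr_deriv ?_
      rw [z3, Fin.sum_univ_four]; simp [aM]
    · rw [z3]; refine (zd 3 X).congr_deriv ?_
      rw [z4, Fin.sum_univ_four]; simp [aM]) (by
    intro X
    rw [z4, z0, z1, z2]; ring)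
  have hwk : ∀ k : Fin 4, ∀ X, w k X = y X a k := by
    intro k X
    rw [hwz k (by omega)]
    simp [hz]
  have grow := k_to_1 u hU.toUSol a w hw (2 + 4*K*(b-a))
    (4 * (Q * C * Real.exp ((4*K*Q+1)*(b-a)))) (by positivity) (by
      intro X
      refine (Nv_le_sum _ _ _).trans ?_
      have : ∀ k ∈ Finset.range 4, |w k X| ≤
          (Q * C * Real.exp ((4*K*Q+1)*(b-a))) * Real.exp ((2 + 4*K*(b-a)) * |X|) := by
        intro k hk
        have hk4 := Finset.mem_range.mp hk
        have := ya X ⟨k, hk4⟩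
        rw [← hwk ⟨k, hk4⟩ X] at this
        exact this
      refine (Finset.sum_le_sum this).trans ?_
      rw [Finset.sum_const, Finset.card_range]
      simp only [nsmul_eq_mul]
      push_cast
      apply le_of_eq; ring)
  have hw0 := ha w hw grow X
  have ya0 : ∀ k : Fin 4, |y X a k| / muf X S^(k:ℕ) ≤ 0 := by
    intro k
    rw [← hwk, Nv_zero w a X hw0 k (by omega)]
    simp
  have yb0 := (hsc X 0 le_rfl).2 ya0
  have : ∀ k ∈ Finset.range 4, |v k X| ≤ 0 := by
    intro k hk
    have hk4 := Finset.mem_range.mp hk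
    have := yb0 ⟨k, hk4⟩
    rw [hyb, zero_mul, div_le_iff₀ (pow_pos (muf_pos _ _) _), zero_mul] at this
    exact this
  refine le_antisymm ((Nv_le_sum v b X).trans ?_) (Nv_nonneg _ _ _)
  exact Finset.sum_nonpos this


theorem W_cont (u ut : ℕ → ℝ → ℝ → ℝ) (hU : UTSol u ut) (X : ℝ) (k : ℕ) (hk : k ≤ 3) :
    Continuous (fun T => ut k X T + qk u T k X) := by
  have c : ∀ k, Continuous (fun T => u k X T) := fun k =>
    (hU.cu k).comp (Continuous.prodMk continuous_const continuous_id)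
  have ct : ∀ k, Continuous (fun T => ut k X T) := fun k =>
    (hU.cut k).comp (Continuous.prodMk continuous_const continuous_id)
  have c0 := c 0
  have c1 := c 1
  have c2 := c 2
  have c3 := c 3
  have c4 := c 4
  have c5 := c 5
  have c6 := c 6
  refine (ct k).add ?_
  interval_cases k <;> simp only [qk] <;> fun_prop

theorem triv_all (u ut : ℕ → ℝ → ℝ → ℝ) (hU : UTSol u ut) (T : ℝ) : Triv u T := by
  obtain ⟨T0, hT0⟩ := triv_neg u hU.toUSol
  by_contra hT
  have hTT : T0 < T := by
    by_contra h
    exact hT (hT0 T (not_lt.mp h))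
  set s : Set ℝ := {t | ¬ Triv u t} with hs
  have hne : s.Nonempty := ⟨T, hT⟩
  have hbdd : BddBelow s := ⟨T0, fun t ht => by
    by_contra h
    exact ht (hT0 t (not_le.mp h).le)⟩
  set c := sInf s with hc
  have hcT0 : T0 ≤ c := le_csInf hne fun t ht => by
    by_contra h
    exact ht (hT0 t (not_le.mp h).le)
  have hlt : ∀ t < c, Triv u t := fun t ht => by
    by_contra h
    exact absurd (csInf_le hbdd h) (not_le.mpr ht)
  have hWlt : ∀ t < c, ∀ k ≤ 3, ∀ X, ut k X t + qk u t k X = 0 := fun t ht => W_zero hU t (hlt t ht)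
  have hW : ∀ t ≤ c, ∀ k ≤ 3, ∀ X, ut k X t + qk u t k X = 0 := by
    intro t ht k hk X
    rcases ht.lt_or_eq with h | h
    · exact hWlt t h k hk X
    · rw [h]; clear ht h t
      have h1 : Tendsto (fun T => ut k X T + qk u T k X) (𝓝[<] c) (𝓝 (ut k X c + qk u c k X)) :=
        ((W_cont u ut hU X k hk).tendsto c).mono_left nhdsWithin_le_nhds
      have h2 : Tendsto (fun T => ut k X T + qk u T k X) (𝓝[<] c) (𝓝 0) := by
        refine tendsto_const_nhds.congr' ?_
        filter_upwards [self_mem_nhdsWithin] with r hr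
        exact (hWlt r hr k hk X).symm
      exact tendsto_nhds_unique h1 h2
  have hTc : Triv u c := triv_transport u ut hU T0 c hcT0 (fun t _ h2 => hW t h2) (hT0 T0 le_rfl)
  obtain ⟨δ, hδ, hop⟩ := triv_open u hU.toUSol hU.cu c hTc
  have : c + δ ≤ c := by
    refine le_csInf hne fun t ht => ?_
    by_contra h
    push Not at h
    have h1 : c ≤ t := csInf_le hbdd ht
    exact ht (hop t (by rw [abs_of_nonneg (by linarith)]; linarith))
  linarith

theorem pd1_smooth (g : ℝ × ℝ → ℝ) (hg : ContDiff ℝ (⊤:ℕ∞) g) : ContDiff ℝ (⊤:ℕ∞) (pd1 g) := by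
  have : ContDiff ℝ (⊤:ℕ∞) (fun p => fderiv ℝ g p (1,0)) :=
    (hg.fderiv_right (m := (⊤:ℕ∞)) (by norm_cast)).clm_apply contDiff_const
  exact this

theorem pd2_smooth (g : ℝ × ℝ → ℝ) (hg : ContDiff ℝ (⊤:ℕ∞) g) : ContDiff ℝ (⊤:ℕ∞) (pd2 g) := by
  have : ContDiff ℝ (⊤:ℕ∞) (fun p => fderiv ℝ g p (0,1)) :=
    (hg.fderiv_right (m := (⊤:ℕ∞)) (by norm_cast)).clm_apply contDiff_const
  exact this

theorem pd1_hd (g : ℝ × ℝ → ℝ) (hg : ContDiff ℝ (⊤:ℕ∞) g) (X T : ℝ) :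
    HasDerivAt (fun x => g (x, T)) (pd1 g (X, T)) X := by
  have h1 := (hg.differentiable (by simp)).differentiableAt (x := (X,T)) |>.hasFDerivAt
  have h2 : HasDerivAt (fun x : ℝ => (x, T)) ((1:ℝ),(0:ℝ)) X :=
    (hasDerivAt_id X).prodMk (hasDerivAt_const X T)
  exact h1.comp_hasDerivAt X h2

theorem pd2_hd (g : ℝ × ℝ → ℝ) (hg : ContDiff ℝ (⊤:ℕ∞) g) (X T : ℝ) :
    HasDerivAt (fun t => g (X, t)) (pd2 g (X, T)) T := by
  have h1 := (hg.differentiable (by simp)).differentiableAt (x := (X,T)) |>.hasFDerivAt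
  have h2 : HasDerivAt (fun t : ℝ => (X, t)) ((0:ℝ),(1:ℝ)) T :=
    (hasDerivAt_const T X).prodMk (hasDerivAt_id T)
  exact h1.comp_hasDerivAt T h2

theorem pd_comm (g : ℝ × ℝ → ℝ) (hg : ContDiff ℝ (⊤:ℕ∞) g) : pd1 (pd2 g) = pd2 (pd1 g) := by
  funext p
  have hd : DifferentiableAt ℝ (fderiv ℝ g) p :=
    ((hg.fderiv_right (m := (⊤:ℕ∞)) (by norm_cast)).differentiable (by simp)).differentiableAt
  have hs : IsSymmSndFDerivAt ℝ g p :=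
    (hg.contDiffAt).isSymmSndFDerivAt (by simp; exact WithTop.coe_le_coe.mpr (OrderTop.le_top 2))
  have e : ∀ a b : ℝ × ℝ, fderiv ℝ (fun q => fderiv ℝ g q a) p b = fderiv ℝ (fderiv ℝ g) p b a := by
    intro a b
    have := (hd.hasFDerivAt.clm_apply (hasFDerivAt_const a p)).fderiv
    rw [this]; simp
  show fderiv ℝ (fun q => fderiv ℝ g q (0,1)) p (1,0) = fderiv ℝ (fun q => fderiv ℝ g q (1,0)) p (0,1)
  rw [e, e]
  exact hs _ _

/-- Any smooth solution of the P_I² relation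
`X = U T − [U³/6 + (U_X² + 2 U U_XX)/24 + U_XXXX/240]`, as a function of `(X,T)`,
solves the KdV equation `U_T + U U_X + U_XXX/12 = 0`.  Points are `p = (X,T)`. -/
theorem stmt13 (U : ℝ × ℝ → ℝ) (hU : ContDiff ℝ (⊤ : ℕ∞) U)
    (heq : ∀ p : ℝ × ℝ, p.1 = U p * p.2 -
      ((1 / 6) * U p ^ 3 + (1 / 24) * ((pd1 U p) ^ 2 + 2 * U p * pd1 (pd1 U) p)
        + (1 / 240) * pd1 (pd1 (pd1 (pd1 U))) p)) :
    ∀ p : ℝ × ℝ, pd2 U p + U p * pd1 U p + (1 / 12) * pd1 (pd1 (pd1 U)) p = 0 := by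
  set g : ℕ → ℝ × ℝ → ℝ := fun k => pd1^[k] U with hg
  have gs : ∀ k, g (k+1) = pd1 (g k) := fun k => Function.iterate_succ_apply' _ _ _
  have g0 : g 0 = U := rfl
  have gc : ∀ k, ContDiff ℝ (⊤ : ℕ∞) (g k) := by
    intro k
    induction k with
    | zero => exact hU
    | succ k ih => rw [gs]; exact pd1_smooth _ ih
  have hu : ∀ k X T, HasDerivAt (fun x => g k (x, T)) (g (k+1) (X, T)) X := by
    intro k X T
    rw [gs]; exact pd1_hd _ (gc k) X T
  have h4 : ∀ X T, g 4 (X,T) = -10 * g 1 (X,T)^2 - 20 * g 0 (X,T) * g 2 (X,T) - 40 * g 0 (X,T)^3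
      + 240 * T * g 0 (X,T) - 240 * X := by
    intro X T
    have := heq (X, T)
    simp only [gs, g0]
    simp only at this
    linarith
  have h5 : ∀ X T, g 5 (X,T) = -40 * g 1 (X,T) * g 2 (X,T) - 20 * g 0 (X,T) * g 3 (X,T)
      - 120 * g 0 (X,T)^2 * g 1 (X,T) + 240 * T * g 1 (X,T) - 240 := by
    intro X T
    have e : (fun x => g 4 (x,T)) = fun X => -10 * g 1 (X,T)^2 - 20 * g 0 (X,T) * g 2 (X,T)
      - 40 * g 0 (X,T)^3 + 240 * T * g 0 (X,T) - 240 * X := funext fun x => h4 x T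
    have h := hu 4 X T
    rw [e] at h
    have u0 := hu 0 X T
    have u1 := hu 1 X T
    have u2 := hu 2 X T
    have h' := (((((u1.pow 2).const_mul (-10)).sub ((u0.const_mul 20).mul u2)).sub
      ((u0.pow 3).const_mul 40)).add (u0.const_mul (240*T))).sub ((hasDerivAt_id X).const_mul 240)
    rw [h.unique h']
    simp
    ring
  have hS : UTSol (fun k X T => g k (X,T)) (fun k X T => pd2 (g k) (X,T)) :=
    { hu := hu
      h4 := h4
      h5 := h5
      hut := fun k X T => pd2_hd _ (gc k) X T
      hutx := fun k X T => by
        have := pd1_hd _ (pd2_smooth _ (gc k)) X T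
        rw [pd_comm _ (gc k), ← gs] at this
        exact this
      cu := fun k => (gc k).continuous
      cut := fun k => (pd2_smooth _ (gc k)).continuous }
  rintro ⟨X, T⟩
  have := W_zero hS T (triv_all _ _ hS T) 0 (by norm_num) X
  simp only [qk, gs, g0] at this
  linarith
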